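/- arXiv:0709.2821 — 2 statements merged into one kernel-verified Lean document; each statement's English description precedes it below -/
import Mathlib

section
/- Let N ≥ 1 and m ≥ 1 be integers and let q satisfy q > 1 if N ≤ 2m and 1 < q ≤ (N+2m)/(N−2m) if N > 2m. If u is a bounded classical solution of the half-space Dirichlet problem (−Δ)^m u = u^q with u ≥ 0, then u depends only on the x₁-variable: u(x) = u(y) whenever x, y ∈ {x₁ ≥ 0} satisfy x₁ = y₁. -/
noncomputable def lap {N : ℕ} (f : EuclideanSpace ℝ (Fin N) → ℝ)
    (x : EuclideanSpace ℝ (Fin N)) : ℝ :=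
  ∑ i : Fin N, iteratedDeriv 2 (fun t : ℝ => f (x + t • EuclideanSpace.single i (1 : ℝ))) 0

noncomputable def polyLap {N : ℕ} (m : ℕ) (f : EuclideanSpace ℝ (Fin N) → ℝ)
    (x : EuclideanSpace ℝ (Fin N)) : ℝ :=
  (-1 : ℝ) ^ m * (lap^[m] f x)

/-- The first coordinate vector `e₁ = (1,0,…,0)` of `ℝ^N`. -/
noncomputable def e1 (N : ℕ) [NeZero N] : EuclideanSpace ℝ (Fin N) :=
  EuclideanSpace.single 0 1

/-- `u` is a bounded classical solution of the half-space Dirichlet problem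
`(-Δ)^m u = u^q`. -/
def IsBCSol (N m : ℕ) [NeZero N] (q : ℝ) (u : EuclideanSpace ℝ (Fin N) → ℝ) : Prop :=
  ContDiffOn ℝ (2 * m : ℕ) u {x : EuclideanSpace ℝ (Fin N) | 0 < x 0} ∧
  ContDiffOn ℝ (2 * m - 1 : ℕ) u {x : EuclideanSpace ℝ (Fin N) | 0 ≤ x 0} ∧
  (∀ j : ℕ, j ≤ 2 * m - 1 → ∃ C : ℝ, ∀ x : EuclideanSpace ℝ (Fin N), 0 ≤ x 0 →
    ‖iteratedFDerivWithin ℝ j u {y : EuclideanSpace ℝ (Fin N) | 0 ≤ y 0} x‖ ≤ C) ∧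
  (∀ x : EuclideanSpace ℝ (Fin N), 0 < x 0 → polyLap m u x = u x ^ q) ∧
  (∀ j : ℕ, j < m → ∀ x : EuclideanSpace ℝ (Fin N), x 0 = 0 →
    iteratedFDerivWithin ℝ j u {y : EuclideanSpace ℝ (Fin N) | 0 ≤ y 0} x (fun _ => e1 N) = 0)

namespace HalfSpace

open Set Filter Topology MeasureTheory EuclideanGeometry
open scoped ContDiff

set_option linter.unusedSectionVars false

/-- The Euclidean space `ℝ^N`. -/
abbrev Eu (N : ℕ) := EuclideanSpace ℝ (Fin N)

/-- The `i`-th partial derivative. -/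
noncomputable def pd {N : ℕ} (i : Fin N) (f : Eu N → ℝ) (y : Eu N) : ℝ :=
  fderiv ℝ f y (EuclideanSpace.single i 1)

lemma two_le_smooth : (2 : WithTop ℕ∞) ≤ ∞ :=
  WithTop.coe_le_coe.2 (le_top : (2 : ℕ∞) ≤ ⊤)

section Laplacian

variable {N : ℕ} {f g : Eu N → ℝ} {y : Eu N}

lemma hasDerivAt_line (y v : Eu N) (t : ℝ) : HasDerivAt (fun s : ℝ => y + s • v) v t := by
  simpa using ((hasDerivAt_id t).smul_const v).const_add y

lemma lap_eq_sum_pd (h : ContDiffAt ℝ 2 f y) : lap f y = ∑ i, pd i (pd i f) y := by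
  unfold lap
  refine Finset.sum_congr rfl fun i _ => ?_
  set v : Eu N := EuclideanSpace.single i 1 with hv
  have hline : Tendsto (fun s : ℝ => y + s • v) (𝓝 0) (𝓝 y) := by
    have := (hasDerivAt_line y v 0).continuousAt.tendsto
    simpa using this
  have h1 : ∀ᶠ z in 𝓝 y, DifferentiableAt ℝ f z := by
    filter_upwards [h.eventually (by simp)] with z hz
    exact hz.differentiableAt (by simp)
  have h2 : deriv (fun s : ℝ => f (y + s • v)) =ᶠ[𝓝 0] fun s => pd i f (y + s • v) := by
    filter_upwards [hline.eventually h1] with s hs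
    exact (hs.hasFDerivAt.comp_hasDerivAt s (hasDerivAt_line y v s)).deriv
  rw [iteratedDeriv_succ, iteratedDeriv_one, h2.deriv_eq]
  have h3 : DifferentiableAt ℝ (fderiv ℝ f) y :=
    (h.fderiv_right (m := 1) (by norm_num)).differentiableAt (by simp)
  have h4 : DifferentiableAt ℝ (pd i f) y := h3.clm_apply (differentiableAt_const _)
  have h5 : HasFDerivAt (pd i f) (fderiv ℝ (pd i f) y) (y + (0 : ℝ) • v) := by
    simpa using h4.hasFDerivAt
  exact (h5.comp_hasDerivAt (0 : ℝ) (hasDerivAt_line y v 0)).deriv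

lemma contDiff_pd {n k : WithTop ℕ∞} (hf : ContDiff ℝ n f) (hk : k + 1 ≤ n) (i : Fin N) :
    ContDiff ℝ k (pd i f) :=
  (hf.fderiv_right hk).clm_apply contDiff_const

lemma lap_eq_fun (hf : ContDiff ℝ 2 f) : lap f = fun y => ∑ i, pd i (pd i f) y :=
  funext fun _ => lap_eq_sum_pd hf.contDiffAt

lemma contDiff_lap {k : ℕ} (hf : ContDiff ℝ (k + 2 : ℕ) f) : ContDiff ℝ k (lap f) := by
  rw [lap_eq_fun (hf.of_le (by norm_cast; omega))]
  refine ContDiff.sum fun i _ => ?_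
  refine contDiff_pd (contDiff_pd (k := (k + 1 : ℕ)) hf ?_ i) ?_ i
  · norm_cast
  · norm_cast

lemma contDiff_lap_smooth (hf : ContDiff ℝ ∞ f) : ContDiff ℝ ∞ (lap f) := by
  rw [contDiff_infty] at hf ⊢
  exact fun n => contDiff_lap (hf (n + 2))

lemma contDiff_lap_iterate (hf : ContDiff ℝ ∞ f) (k : ℕ) : ContDiff ℝ ∞ (lap^[k] f) := by
  induction k generalizing f with
  | zero => exact hf
  | succ k ih => exact ih (contDiff_lap_smooth hf)

lemma lap_congr (h : f =ᶠ[𝓝 y] g) : lap f y = lap g y := by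
  unfold lap
  refine Finset.sum_congr rfl fun i _ => ?_
  refine Filter.EventuallyEq.iteratedDeriv_eq 2 ?_
  have := (hasDerivAt_line y (EuclideanSpace.single i 1) 0).continuousAt.tendsto
  simp only [zero_smul, add_zero] at this
  exact this.eventually h

lemma lap_iterate_congr (h : f =ᶠ[𝓝 y] g) (k : ℕ) : lap^[k] f =ᶠ[𝓝 y] lap^[k] g := by
  induction k generalizing f g with
  | zero => exact h
  | succ k ih =>
    refine ih ?_
    filter_upwards [eventually_eventually_nhds.2 h] with z hz
    exact lap_congr hz

lemma lap_iterate_eqOn {U : Set (Eu N)} (hU : IsOpen U) (h : EqOn f g U) (k : ℕ) :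
    EqOn (lap^[k] f) (lap^[k] g) U := fun _ hz =>
  (lap_iterate_congr (h.eventuallyEq_of_mem (hU.mem_nhds hz)) k).eq_of_nhds

lemma lap_const_zero : lap (fun _ : Eu N => (0 : ℝ)) = fun _ => 0 := by
  funext y
  simp [lap]

lemma lap_iterate_zero (k : ℕ) : lap^[k] (fun _ : Eu N => (0 : ℝ)) = fun _ => 0 := by
  induction k with
  | zero => rfl
  | succ k ih => rw [Function.iterate_succ_apply, lap_const_zero, ih]

lemma pd_add (hf : ContDiff ℝ 1 f) (hg : ContDiff ℝ 1 g) (i : Fin N) :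
    pd i (fun z => f z + g z) = fun z => pd i f z + pd i g z := by
  funext z
  simp only [pd]
  rw [fderiv_fun_add (hf.differentiable (by simp) z) (hg.differentiable (by simp) z)]
  rfl

lemma pd_mul (hf : ContDiff ℝ 1 f) (hg : ContDiff ℝ 1 g) (i : Fin N) :
    pd i (fun z => f z * g z) = fun z => f z * pd i g z + pd i f z * g z := by
  funext z
  simp only [pd]
  rw [fderiv_fun_mul (hf.differentiable (by simp) z) (hg.differentiable (by simp) z)]
  simp [mul_comm]

lemma pd_const_mul (hf : ContDiff ℝ 1 f) (c : ℝ) (i : Fin N) :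
    pd i (fun z => c * f z) = fun z => c * pd i f z := by
  funext z
  simp only [pd]
  rw [fderiv_const_mul (hf.differentiable (by simp) z)]
  rfl

lemma lap_add (hf : ContDiff ℝ ∞ f) (hg : ContDiff ℝ ∞ g) :
    lap (fun z => f z + g z) = fun z => lap f z + lap g z := by
  have h2 : (2 : WithTop ℕ∞) ≤ ∞ := two_le_smooth
  have h1 : (1 : WithTop ℕ∞) ≤ ∞ := by exact_mod_cast le_top
  rw [lap_eq_fun ((hf.add hg).of_le h2), lap_eq_fun (hf.of_le h2), lap_eq_fun (hg.of_le h2)]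
  funext z
  rw [← Finset.sum_add_distrib]
  refine Finset.sum_congr rfl fun i _ => ?_
  rw [pd_add (hf.of_le h1) (hg.of_le h1),
    pd_add ((contDiff_pd (k := ∞) hf (by simp) i).of_le h1)
      ((contDiff_pd (k := ∞) hg (by simp) i).of_le h1)]

lemma lap_const_mul (hf : ContDiff ℝ ∞ f) (c : ℝ) :
    lap (fun z => c * f z) = fun z => c * lap f z := by
  have h2 : (2 : WithTop ℕ∞) ≤ ∞ := two_le_smooth
  have h1 : (1 : WithTop ℕ∞) ≤ ∞ := by exact_mod_cast le_top
  rw [lap_eq_fun ((contDiff_const.mul hf).of_le h2), lap_eq_fun (hf.of_le h2)]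
  funext z
  rw [Finset.mul_sum]
  refine Finset.sum_congr rfl fun i _ => ?_
  rw [pd_const_mul (hf.of_le h1),
    pd_const_mul ((contDiff_pd (k := ∞) hf (by simp) i).of_le h1)]

lemma lap_iterate_add (hf : ContDiff ℝ ∞ f) (hg : ContDiff ℝ ∞ g) (k : ℕ) :
    lap^[k] (fun z => f z + g z) = fun z => lap^[k] f z + lap^[k] g z := by
  induction k generalizing f g with
  | zero => rfl
  | succ k ih =>
    simp only [Function.iterate_succ_apply]
    rw [lap_add hf hg, ih (contDiff_lap_smooth hf) (contDiff_lap_smooth hg)]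

lemma lap_iterate_const_mul (hf : ContDiff ℝ ∞ f) (c : ℝ) (k : ℕ) :
    lap^[k] (fun z => c * f z) = fun z => c * lap^[k] f z := by
  induction k generalizing f with
  | zero => rfl
  | succ k ih =>
    simp only [Function.iterate_succ_apply]
    rw [lap_const_mul hf, ih (contDiff_lap_smooth hf)]

lemma hasCompactSupport_pd (hf : HasCompactSupport f) (i : Fin N) : HasCompactSupport (pd i f) :=
  hf.fderiv_apply (𝕜 := ℝ) _

lemma hasCompactSupport_lap (hf : HasCompactSupport f) : HasCompactSupport (lap f) := by
  refine hf.of_isClosed_subset (isClosed_tsupport _) (closure_minimal ?_ (isClosed_tsupport _))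
  intro z hz
  by_contra hz'
  refine hz ?_
  have : f =ᶠ[𝓝 z] fun _ => 0 := notMem_tsupport_iff_eventuallyEq.1 hz'
  rw [lap_congr this, lap_const_zero]

lemma hasCompactSupport_lap_iterate (hf : HasCompactSupport f) (k : ℕ) :
    HasCompactSupport (lap^[k] f) := by
  induction k generalizing f with
  | zero => exact hf
  | succ k ih => exact ih (hasCompactSupport_lap hf)

lemma integral_mul_pd (hf : ContDiff ℝ 1 f) (hg : ContDiff ℝ 1 g) (hc : HasCompactSupport g)
    (i : Fin N) : ∫ z, f z * pd i g z = - ∫ z, pd i f z * g z := by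
  refine integral_mul_fderiv_eq_neg_fderiv_mul_of_integrable ?_ ?_ ?_
    (fun z _ => hf.differentiable (by simp) z) (fun z _ => hg.differentiable (by simp) z)
  · exact ((contDiff_pd (k := 0) hf (by simp) i).continuous.mul hg.continuous).integrable_of_hasCompactSupport
      hc.mul_left
  · exact (hf.continuous.mul (contDiff_pd (k := 0) hg (by simp) i).continuous).integrable_of_hasCompactSupport
      (hasCompactSupport_pd hc i).mul_left
  · exact (hf.continuous.mul hg.continuous).integrable_of_hasCompactSupport hc.mul_left

lemma integral_mul_lap (hf : ContDiff ℝ 2 f) (hg : ContDiff ℝ 2 g) (hc : HasCompactSupport g) :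
    ∫ z, f z * lap g z = ∫ z, lap f z * g z := by
  rw [lap_eq_fun hf, lap_eq_fun hg]
  simp only [Finset.mul_sum, Finset.sum_mul]
  have hf1 := fun i => contDiff_pd (k := 1) hf (by norm_num) i
  have hg1 := fun i => contDiff_pd (k := 1) hg (by norm_num) i
  have hf2 := fun i => contDiff_pd (k := 0) (hf1 i) (by norm_num) i
  have hg2 := fun i => contDiff_pd (k := 0) (hg1 i) (by norm_num) i
  rw [integral_finsetSum, integral_finsetSum]
  · refine Finset.sum_congr rfl fun i _ => ?_
    rw [integral_mul_pd (hf.of_le (by norm_num)) (hg1 i) (hasCompactSupport_pd hc i),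
      integral_mul_pd (hf1 i) (hg.of_le (by norm_num)) hc, neg_neg]
  · exact fun i _ => ((hf2 i).continuous.mul hg.continuous).integrable_of_hasCompactSupport hc.mul_left
  · exact fun i _ => (hf.continuous.mul (hg2 i).continuous).integrable_of_hasCompactSupport
      (hasCompactSupport_pd (hasCompactSupport_pd hc i) i).mul_left

lemma integral_mul_lap_iterate {k : ℕ} (hf : ContDiff ℝ (2 * k : ℕ) f) (hg : ContDiff ℝ ∞ g)
    (hc : HasCompactSupport g) : ∫ z, f z * lap^[k] g z = ∫ z, lap^[k] f z * g z := by
  induction k generalizing f with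
  | zero => rfl
  | succ k ih =>
    have h2 : (2 : WithTop ℕ∞) ≤ ∞ := two_le_smooth
    rw [Function.iterate_succ_apply', Function.iterate_succ_apply,
      integral_mul_lap (hf.of_le (by norm_cast; omega))
        ((contDiff_lap_iterate hg k).of_le h2) (hasCompactSupport_lap_iterate hc k)]
    exact ih (contDiff_lap hf)

end Laplacian

section Cutoff

variable {N : ℕ} {f g : Eu N → ℝ} {y : Eu N}

lemma one_le_smooth : (1 : WithTop ℕ∞) ≤ ∞ :=
  WithTop.coe_le_coe.2 (le_top : (1 : ℕ∞) ≤ ⊤)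

/-- The open half-space `{x₁ > 0}`. -/
abbrev upper (N : ℕ) [NeZero N] : Set (Eu N) := {x | 0 < x 0}

lemma contDiff_coord {n : WithTop ℕ∞} (i : Fin N) : ContDiff ℝ n (fun z : Eu N => z i) := by
  fun_prop

lemma isOpen_upper [NeZero N] : IsOpen (upper N) :=
  isOpen_lt continuous_const (contDiff_coord (n := 0) 0).continuous

lemma pd_comp_coord [NeZero N] {φ : ℝ → ℝ} (hφ : ContDiff ℝ ∞ φ) (c : ℝ) (i : Fin N) :
    pd i (fun z : Eu N => φ (c * z 0)) =
      fun z => (if i = 0 then c else 0) * deriv φ (c * z 0) := by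
  funext z
  have h1 : HasFDerivAt (fun z : Eu N => c * z 0)
      (c • (EuclideanSpace.proj 0 : Eu N →L[ℝ] ℝ)) z :=
    (EuclideanSpace.proj (𝕜 := ℝ) (0 : Fin N)).hasFDerivAt.const_mul c
  have h2 := ((hφ.differentiable (by simp)) (c * z 0)).hasDerivAt.comp_hasFDerivAt z h1
  rw [pd]
  erw [h2.fderiv]
  simp [mul_comm, eq_comm]

lemma lap_coord_mul [NeZero N] {φ : ℝ → ℝ} (hφ : ContDiff ℝ ∞ φ) (hf : ContDiff ℝ ∞ f) (c : ℝ) :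
    lap (fun z => φ (c * z 0) * f z) = fun z =>
      c ^ 2 * (deriv (deriv φ) (c * z 0) * f z) +
        (c * (deriv φ (c * z 0) * (2 * pd 0 f z)) + φ (c * z 0) * lap f z) := by
  have hφ1 : ContDiff ℝ ∞ (deriv φ) := (contDiff_infty_iff_deriv.1 hφ).2
  have hc : ∀ ψ : ℝ → ℝ, ContDiff ℝ ∞ ψ → ContDiff ℝ ∞ (fun z : Eu N => ψ (c * z 0)) :=
    fun ψ hψ => hψ.comp (contDiff_const.mul (contDiff_coord 0))
  have hf1 := fun i => contDiff_pd (k := ∞) hf (by simp) i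
  rw [lap_eq_fun (((hc φ hφ).mul hf).of_le two_le_smooth), lap_eq_fun (hf.of_le two_le_smooth)]
  funext z
  have key : ∀ i : Fin N, pd i (pd i fun z => φ (c * z 0) * f z) z =
      (if i = 0 then c ^ 2 * (deriv (deriv φ) (c * z 0) * f z) +
        c * (deriv φ (c * z 0) * (2 * pd 0 f z)) else 0) + φ (c * z 0) * pd i (pd i f) z := by
    intro i
    rw [pd_mul ((hc φ hφ).of_le one_le_smooth) (hf.of_le one_le_smooth), pd_comp_coord hφ]
    rw [pd_add (((hc φ hφ).mul (hf1 i)).of_le one_le_smooth)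
      (((contDiff_const.mul (hc _ hφ1)).mul hf).of_le one_le_smooth),
      pd_mul ((hc φ hφ).of_le one_le_smooth) ((hf1 i).of_le one_le_smooth), pd_comp_coord hφ,
      pd_mul ((contDiff_const.mul (hc _ hφ1)).of_le one_le_smooth) (hf.of_le one_le_smooth),
      pd_const_mul ((hc _ hφ1).of_le one_le_smooth), pd_comp_coord hφ1]
    by_cases hi : i = 0
    · subst hi
      simp only [if_true]
      ring
    · simp [hi]
  rw [Finset.sum_congr rfl fun i _ => key i, Finset.sum_add_distrib, Finset.mul_sum]
  simp [add_assoc]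

lemma strip_bound [NeZero N] (j : ℕ) {φ : ℝ → ℝ} (hφ : ContDiff ℝ ∞ φ) (hf : ContDiff ℝ ∞ f)
    (hc : HasCompactSupport f) : ∃ C : ℝ, 0 ≤ C ∧ ∀ δ : ℝ, 0 < δ → δ ≤ 1 → ∀ y : Eu N, 0 < y 0 →
      y 0 ≤ δ → |lap^[j] (fun z => φ (δ⁻¹ * z 0) * f z) y| ≤ C * δ⁻¹ ^ (2 * j) := by
  induction j generalizing φ f with
  | zero =>
    obtain ⟨A, hA⟩ := isCompact_Icc.exists_bound_of_continuousOn (s := Icc (0 : ℝ) 1)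
      hφ.continuous.continuousOn
    obtain ⟨B, hB⟩ := hc.exists_bound_of_continuous hf.continuous
    have hA0 : 0 ≤ A := (norm_nonneg _).trans (hA 0 (by simp))
    have hB0 : 0 ≤ B := (norm_nonneg _).trans (hB 0)
    refine ⟨A * B, mul_nonneg hA0 hB0, fun δ h0 h1 y hy hyδ => ?_⟩
    simp only [Function.iterate_zero, id_eq, mul_zero, pow_zero, mul_one, abs_mul]
    refine mul_le_mul (hA _ ⟨by positivity, ?_⟩) (hB y) (abs_nonneg _) hA0
    rw [inv_mul_le_iff₀ h0, mul_one]
    exact hyδ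
  | succ j ih =>
    have hφ1 : ContDiff ℝ ∞ (deriv φ) := (contDiff_infty_iff_deriv.1 hφ).2
    have hφ2 : ContDiff ℝ ∞ (deriv (deriv φ)) := (contDiff_infty_iff_deriv.1 hφ1).2
    have hpd := contDiff_pd (k := ∞) hf (by simp) 0
    have hcpd : HasCompactSupport (fun z => 2 * pd 0 f z) :=
      (hasCompactSupport_pd hc 0).mul_left (f := fun _ => (2 : ℝ))
    obtain ⟨A, hA0, hA⟩ := ih hφ2 hf hc
    obtain ⟨B, hB0, hB⟩ := ih hφ1 (contDiff_const.mul hpd) hcpd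
    obtain ⟨D, hD0, hD⟩ := ih hφ (contDiff_lap_smooth hf) (hasCompactSupport_lap hc)
    refine ⟨A + B + D, by positivity, fun δ h0 h1 y hy hyδ => ?_⟩
    have hcc : ∀ ψ : ℝ → ℝ, ContDiff ℝ ∞ ψ → ContDiff ℝ ∞ (fun z : Eu N => ψ (δ⁻¹ * z 0)) :=
      fun ψ hψ => hψ.comp (contDiff_const.mul (contDiff_coord 0))
    have e1 := (hcc _ hφ2).mul hf
    have e2 := (hcc _ hφ1).mul ((contDiff_const (c := (2 : ℝ))).mul hpd)
    have e3 := (hcc _ hφ).mul (contDiff_lap_smooth hf)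
    rw [Function.iterate_succ_apply, lap_coord_mul hφ hf,
      lap_iterate_add (contDiff_const.mul e1) ((contDiff_const.mul e2).add e3),
      lap_iterate_add (contDiff_const.mul e2) e3, lap_iterate_const_mul e1,
      lap_iterate_const_mul e2]
    have hA' := hA δ h0 h1 y hy hyδ
    have hB' := hB δ h0 h1 y hy hyδ
    have hD' := hD δ h0 h1 y hy hyδ
    have hδ : 1 ≤ δ⁻¹ := (one_le_inv₀ h0).2 h1
    set P := δ⁻¹ ^ (2 * j) with hP
    have hP0 : 0 ≤ P := by positivity
    have hpow : δ⁻¹ ^ (2 * (j + 1)) = δ⁻¹ ^ 2 * P := by rw [hP]; ring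
    rw [hpow]
    refine (abs_add_le _ _).trans ?_
    refine (add_le_add le_rfl (abs_add_le _ _)).trans ?_
    rw [abs_mul, abs_mul, abs_of_nonneg (by positivity : (0 : ℝ) ≤ δ⁻¹ ^ 2),
      abs_of_nonneg (by positivity : (0 : ℝ) ≤ δ⁻¹)]
    have q1 : δ⁻¹ ≤ δ⁻¹ ^ 2 := by nlinarith
    have q2 : 1 ≤ δ⁻¹ ^ 2 := by nlinarith
    have t1 := mul_le_mul_of_nonneg_left hA' (by positivity : (0 : ℝ) ≤ δ⁻¹ ^ 2)
    have t2 := mul_le_mul q1 hB' (abs_nonneg _) (by positivity : (0 : ℝ) ≤ δ⁻¹ ^ 2)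
    have t3 := mul_le_mul q2 hD' (abs_nonneg _) (by positivity : (0 : ℝ) ≤ δ⁻¹ ^ 2)
    rw [one_mul] at t3
    linarith

lemma integral_mul_lap_iterate_upper [NeZero N] {u : Eu N → ℝ} {k : ℕ}
    (hu : ContDiffOn ℝ (2 * k : ℕ) u (upper N)) (hg : ContDiff ℝ ∞ g) (hc : HasCompactSupport g)
    {δ : ℝ} (hδ : 0 < δ) (h0 : ∀ y, y 0 ≤ δ → g y = 0) :
    ∫ z, u z * lap^[k] g z = ∫ z, lap^[k] u z * g z := by
  set θ : Eu N → ℝ := fun z => Real.smoothTransition (4 / δ * z 0 - 1) with hθ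
  have hθs : ContDiff ℝ ∞ θ :=
    Real.smoothTransition.contDiff.comp
      ((contDiff_const.mul (contDiff_coord 0)).sub contDiff_const)
  have hθ0 : ∀ z : Eu N, z 0 ≤ δ / 4 → θ z = 0 := fun z hz => by
    refine Real.smoothTransition.zero_of_nonpos ?_
    have : 4 / δ * z 0 ≤ 4 / δ * (δ / 4) := by gcongr
    have e : 4 / δ * (δ / 4) = 1 := by field_simp
    linarith
  have hθ1 : ∀ z : Eu N, δ / 2 ≤ z 0 → θ z = 1 := fun z hz => by
    refine Real.smoothTransition.one_of_one_le ?_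
    have : 4 / δ * (δ / 2) ≤ 4 / δ * z 0 := by gcongr
    have e : 4 / δ * (δ / 2) = 2 := by field_simp; norm_num
    linarith
  have hcoord : Continuous fun z : Eu N => z 0 := (contDiff_coord (n := 0) 0).continuous
  have hθu : ContDiff ℝ (2 * k : ℕ) (fun z => θ z * u z) := by
    rw [contDiff_iff_contDiffAt]
    intro z
    by_cases hz : 0 < z 0
    · exact (contDiff_infty.1 hθs (2 * k)).contDiffAt.mul
        (hu.contDiffAt (isOpen_upper.mem_nhds hz))
    · have : (fun z => θ z * u z) =ᶠ[𝓝 z] fun _ => 0 := by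
        have h4 : ∀ᶠ w : Eu N in 𝓝 z, w 0 < δ / 4 :=
          (isOpen_lt hcoord continuous_const).mem_nhds (by simp; linarith)
        filter_upwards [h4] with w hw
        simp [hθ0 w hw.le]
      exact contDiffAt_const.congr_of_eventuallyEq this
  have key := integral_mul_lap_iterate hθu hg hc
  have hl : ∀ z, u z * lap^[k] g z = θ z * u z * lap^[k] g z := fun z => by
    by_cases hz : z 0 < δ
    · have : g =ᶠ[𝓝 z] fun _ => 0 := by
        have h4 : ∀ᶠ w : Eu N in 𝓝 z, w 0 < δ := (isOpen_lt hcoord continuous_const).mem_nhds hz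
        filter_upwards [h4] with w hw
        exact h0 w hw.le
      rw [(lap_iterate_congr this k).eq_of_nhds, lap_iterate_zero]
      simp
    · rw [hθ1 z (by linarith), one_mul]
  have hr : ∀ z, lap^[k] u z * g z = lap^[k] (fun z => θ z * u z) z * g z := fun z => by
    by_cases hz : z 0 ≤ δ
    · simp [h0 z hz]
    · congr 1
      refine (lap_iterate_congr ?_ k).eq_of_nhds
      have h4 : ∀ᶠ w : Eu N in 𝓝 z, δ / 2 < w 0 :=
        (isOpen_lt continuous_const hcoord).mem_nhds (by simp; linarith)
      filter_upwards [h4] with w hw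
      rw [hθ1 w hw.le, one_mul]
  simp only [hl, hr]
  exact key

lemma lap_comp_affine (hf : ContDiff ℝ ∞ f) (c : ℝ) (b : Eu N) :
    lap (fun z => f (c • (z - b))) = fun z => c ^ 2 * lap f (c • (z - b)) := by
  have hpd : ∀ {h : Eu N → ℝ}, ContDiff ℝ ∞ h → ∀ i, pd i (fun z => h (c • (z - b))) =
      fun z => c * pd i h (c • (z - b)) := by
    intro h hh i
    funext z
    have h1 : HasFDerivAt (fun z : Eu N => c • (z - b)) (c • ContinuousLinearMap.id ℝ (Eu N)) z :=
      ((hasFDerivAt_id z).sub_const b).const_smul c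
    have h2 := ((hh.differentiable (by simp)) (c • (z - b))).hasFDerivAt.comp z h1
    rw [pd]
    erw [h2.fderiv]
    simp [pd]
  have ha : ∀ {h : Eu N → ℝ}, ContDiff ℝ ∞ h → ContDiff ℝ ∞ (fun z => h (c • (z - b))) :=
    fun hh => hh.comp ((contDiff_id.sub contDiff_const).const_smul c)
  rw [lap_eq_fun ((ha hf).of_le two_le_smooth), lap_eq_fun (hf.of_le two_le_smooth)]
  funext z
  rw [Finset.mul_sum]
  refine Finset.sum_congr rfl fun i _ => ?_
  have hfi := contDiff_pd (k := ∞) hf (by simp) i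
  rw [hpd hf, pd_const_mul ((ha hfi).of_le one_le_smooth), hpd hfi]
  ring

lemma lap_iterate_comp_affine (hf : ContDiff ℝ ∞ f) (c : ℝ) (b : Eu N) (k : ℕ) :
    lap^[k] (fun z => f (c • (z - b))) = fun z => c ^ (2 * k) * lap^[k] f (c • (z - b)) := by
  induction k generalizing f with
  | zero => simp
  | succ k ih =>
    have ha : ContDiff ℝ ∞ (fun z => lap f (c • (z - b))) :=
      (contDiff_lap_smooth hf).comp ((contDiff_id.sub contDiff_const).const_smul c)
    rw [Function.iterate_succ_apply, lap_comp_affine hf, lap_iterate_const_mul ha,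
      ih (contDiff_lap_smooth hf), Function.iterate_succ_apply]
    funext z
    ring

lemma contDiff_lap_param {F : ℝ × Eu N → ℝ} (hF : ContDiff ℝ ∞ F) :
    ContDiff ℝ ∞ (fun p : ℝ × Eu N => lap (fun z => F (p.1, z)) p.2) := by
  have hpd : ∀ {G : ℝ × Eu N → ℝ}, ContDiff ℝ ∞ G → ∀ i, (fun p : ℝ × Eu N =>
      pd i (fun z => G (p.1, z)) p.2) = fun p => fderiv ℝ G p (0, EuclideanSpace.single i 1) := by
    intro G hG i
    funext p
    have h1 : HasFDerivAt (fun z : Eu N => (p.1, z)) (ContinuousLinearMap.inr ℝ ℝ (Eu N)) p.2 :=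
      hasFDerivAt_prodMk_right p.1 p.2
    have h2 := ((hG.differentiable (by simp)) (p.1, p.2)).hasFDerivAt.comp p.2 h1
    rw [pd]
    erw [h2.fderiv]
    simp
  have hsm : ∀ {G : ℝ × Eu N → ℝ}, ContDiff ℝ ∞ G → ∀ i, ContDiff ℝ ∞ (fun p : ℝ × Eu N =>
      pd i (fun z => G (p.1, z)) p.2) := by
    intro G hG i
    rw [hpd hG]
    exact (hG.fderiv_right (m := ∞) (by simp)).clm_apply contDiff_const
  have hs : ∀ s, ContDiff ℝ ∞ fun z => F (s, z) := fun s =>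
    hF.comp (contDiff_const.prodMk contDiff_id)
  have : (fun p : ℝ × Eu N => lap (fun z => F (p.1, z)) p.2) =
      fun p => ∑ i, pd i (pd i fun z => F (p.1, z)) p.2 := by
    funext p
    rw [lap_eq_fun ((hs p.1).of_le two_le_smooth)]
  rw [this]
  exact ContDiff.sum fun i _ => hsm (hsm hF i) i

lemma contDiff_lap_iterate_param {F : ℝ × Eu N → ℝ} (hF : ContDiff ℝ ∞ F) (k : ℕ) :
    ContDiff ℝ ∞ (fun p : ℝ × Eu N => lap^[k] (fun z => F (p.1, z)) p.2) := by
  induction k generalizing F with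
  | zero => exact hF
  | succ k ih => exact ih (contDiff_lap_param hF)

end Cutoff

section Kernel

/-- The parametric moment `∫₀¹ t^k κ(d + t p) dt`. -/
noncomputable def moment (k : ℕ) (κ : ℝ → ℝ) (z : ℝ × ℝ) : ℝ :=
  ∫ t in (0 : ℝ)..1, t ^ k * κ (z.1 + t * z.2)

lemma hasFDerivAt_moment (k : ℕ) {κ : ℝ → ℝ} (hκ : ContDiff ℝ 1 κ) (z : ℝ × ℝ) :
    HasFDerivAt (moment k κ) (moment k (deriv κ) z • ContinuousLinearMap.fst ℝ ℝ ℝ +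
      moment (k + 1) (deriv κ) z • ContinuousLinearMap.snd ℝ ℝ ℝ) z := by
  have hκd : Continuous (deriv κ) := hκ.continuous_deriv (by simp)
  have hcκ := hκ.continuous
  set F' : ℝ × ℝ → ℝ → (ℝ × ℝ →L[ℝ] ℝ) := fun w t =>
    (t ^ k * deriv κ (w.1 + t * w.2)) • (ContinuousLinearMap.fst ℝ ℝ ℝ +
      t • ContinuousLinearMap.snd ℝ ℝ ℝ) with hF'
  have hF'c : Continuous fun q : (ℝ × ℝ) × ℝ => F' q.1 q.2 := by
    simp only [hF']
    fun_prop
  obtain ⟨C, hC⟩ := ((isCompact_closedBall z 1).prod (isCompact_Icc (a := (0 : ℝ)) (b := 1))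
    ).exists_bound_of_continuousOn hF'c.continuousOn
  have key := intervalIntegral.hasFDerivAt_integral_of_dominated_of_fderiv_le (μ := volume)
    (a := 0) (b := 1) (s := Metric.ball z 1) (x₀ := z) (F := fun w t => t ^ k * κ (w.1 + t * w.2))
    (F' := F') (bound := fun _ => C) (Metric.ball_mem_nhds z one_pos)
    (Eventually.of_forall fun w => by
      exact (Continuous.aestronglyMeasurable (by fun_prop)))
    ((by fun_prop : Continuous _).intervalIntegrable _ _)
    ((by exact hF'c.comp (continuous_const.prodMk continuous_id) :
      Continuous (F' z)).aestronglyMeasurable)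
    (ae_of_all _ fun t ht w hw => by
      rw [uIoc_of_le zero_le_one] at ht
      exact hC (w, t) ⟨Metric.ball_subset_closedBall hw, ht.1.le, ht.2⟩)
    intervalIntegrable_const
    (ae_of_all _ fun t _ w _ => by
      have h1 : HasFDerivAt (fun w : ℝ × ℝ => w.1 + t * w.2)
          (ContinuousLinearMap.fst ℝ ℝ ℝ + t • ContinuousLinearMap.snd ℝ ℝ ℝ) w :=
        hasFDerivAt_fst.add (hasFDerivAt_snd.const_mul t)
      have h2 := (((hκ.differentiable (by simp)) (w.1 + t * w.2)).hasDerivAt.comp_hasFDerivAt w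
        h1).const_mul (t ^ k)
      simpa [hF', smul_smul, mul_assoc] using h2)
  refine key.congr_fderiv ?_
  have hInt : IntervalIntegrable (F' z) volume 0 1 :=
    (by exact hF'c.comp (continuous_const.prodMk continuous_id) :
      Continuous (F' z)).intervalIntegrable _ _
  ext
  · simp only [ContinuousLinearMap.comp_apply, ContinuousLinearMap.inl_apply]
    rw [ContinuousLinearMap.intervalIntegral_apply hInt]
    simp [hF', moment]
  · simp only [ContinuousLinearMap.comp_apply, ContinuousLinearMap.inr_apply]
    rw [ContinuousLinearMap.intervalIntegral_apply hInt]
    simp only [hF', moment, _root_.add_apply, _root_.smul_apply,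
      ContinuousLinearMap.coe_fst', ContinuousLinearMap.coe_snd', smul_eq_mul]
    simp only [mul_zero, zero_add, mul_one]
    refine intervalIntegral.integral_congr fun t _ => ?_
    ring

lemma contDiff_moment (k : ℕ) {κ : ℝ → ℝ} (hκ : ContDiff ℝ ∞ κ) : ContDiff ℝ ∞ (moment k κ) := by
  rw [contDiff_infty]
  intro n
  induction n generalizing k κ with
  | zero =>
    refine contDiff_zero.2 (continuous_iff_continuousAt.2 fun z => ?_)
    exact (hasFDerivAt_moment k (hκ.of_le one_le_smooth) z).continuousAt
  | succ n ih =>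
    have hκ1 : ContDiff ℝ ∞ (deriv κ) := (contDiff_infty_iff_deriv.1 hκ).2
    refine (contDiff_succ_iff_hasFDerivAt).2 ⟨_, ?_, hasFDerivAt_moment k (hκ.of_le one_le_smooth)⟩
    exact ((ih k hκ1).smul contDiff_const).add ((ih (k + 1) hκ1).smul contDiff_const)

/-- The kernel `∫₀^p τ^k κ(d + τ) dτ` as a function of `(d, p)`. -/
noncomputable def ker (k : ℕ) (κ : ℝ → ℝ) (z : ℝ × ℝ) : ℝ := z.2 ^ (k + 1) * moment k κ z

lemma ker_eq_integral (k : ℕ) (κ : ℝ → ℝ) (z : ℝ × ℝ) :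
    ker k κ z = ∫ τ in (0 : ℝ)..z.2, τ ^ k * κ (z.1 + τ) := by
  have := intervalIntegral.smul_integral_comp_mul_right (a := 0) (b := 1)
    (fun τ => τ ^ k * κ (z.1 + τ)) z.2
  simp only [zero_mul, one_mul] at this
  rw [← this, ker, moment, smul_eq_mul, ← intervalIntegral.integral_const_mul,
    ← intervalIntegral.integral_const_mul]
  refine intervalIntegral.integral_congr fun t _ => ?_
  ring

lemma contDiff_ker (k : ℕ) {κ : ℝ → ℝ} (hκ : ContDiff ℝ ∞ κ) : ContDiff ℝ ∞ (ker k κ) :=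
  (contDiff_snd.pow (k + 1)).mul (contDiff_moment k hκ)

lemma hasFDerivAt_ker (k : ℕ) {κ : ℝ → ℝ} (hκ : ContDiff ℝ ∞ κ) (z : ℝ × ℝ) :
    HasFDerivAt (ker k κ) (ker k (deriv κ) z • ContinuousLinearMap.fst ℝ ℝ ℝ +
      (z.2 ^ k * κ (z.1 + z.2)) • ContinuousLinearMap.snd ℝ ℝ ℝ) z := by
  have hm := hasFDerivAt_moment k (hκ.of_le one_le_smooth) z
  have hp : HasFDerivAt (fun z : ℝ × ℝ => z.2 ^ (k + 1)) (((k + 1 : ℕ) * z.2 ^ k) •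
      ContinuousLinearMap.snd ℝ ℝ ℝ) z := by
    simpa using (hasFDerivAt_snd (𝕜 := ℝ) (p := z)).pow (k + 1)
  have hd := hp.mul hm
  refine hd.congr_fderiv ?_
  have hsnd : HasDerivAt (fun p : ℝ => ker k κ (z.1, p)) (z.2 ^ k * κ (z.1 + z.2)) z.2 := by
    have e : (fun p : ℝ => ker k κ (z.1, p)) = fun p => ∫ τ in (0 : ℝ)..p, τ ^ k * κ (z.1 + τ) :=
      funext fun p => ker_eq_integral k κ (z.1, p)
    rw [e]
    have hc : Continuous fun τ => τ ^ k * κ (z.1 + τ) := by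
      have := hκ.continuous
      fun_prop
    exact intervalIntegral.integral_hasDerivAt_right (hc.intervalIntegrable _ _)
      (hc.stronglyMeasurableAtFilter _ _) hc.continuousAt
  have hd2 := (HasFDerivAt.comp_hasDerivAt z.2 (f := fun p : ℝ => (z.1, p)) (by exact hd)
    ((hasDerivAt_const z.2 z.1).prodMk (hasDerivAt_id z.2)))
  have huniq := hsnd.unique hd2
  ext
  · simp [ker]
  · rw [ContinuousLinearMap.comp_apply, ContinuousLinearMap.comp_apply]
    simp only [ContinuousLinearMap.inr_apply]
    rw [← huniq]
    simp

lemma ker_succ_deriv (k : ℕ) {κ : ℝ → ℝ} (hκ : ContDiff ℝ ∞ κ) (z : ℝ × ℝ) :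
    ker (k + 1) (deriv κ) z = z.2 ^ (k + 1) * κ (z.1 + z.2) - (k + 1) * ker k κ z := by
  have hκd : Continuous (deriv κ) := (hκ.of_le one_le_smooth).continuous_deriv (by simp)
  have hc := hκ.continuous
  rw [ker_eq_integral, ker_eq_integral]
  have h := intervalIntegral.integral_mul_deriv_eq_deriv_mul (a := 0) (b := z.2)
    (u := fun τ => τ ^ (k + 1)) (u' := fun τ => (k + 1) * τ ^ k)
    (v := fun τ => κ (z.1 + τ)) (v' := fun τ => deriv κ (z.1 + τ))
    (fun τ _ => by simpa using hasDerivAt_pow (k + 1) τ)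
    (fun τ _ => by
      simpa using (((hκ.differentiable (by simp)) (z.1 + τ)).hasDerivAt).comp_const_add z.1 τ)
    ((by fun_prop : Continuous _).intervalIntegrable _ _)
    ((by fun_prop : Continuous _).intervalIntegrable _ _)
  rw [h, ← intervalIntegral.integral_const_mul]
  simp [mul_assoc]

lemma ker_by_parts (k : ℕ) {κ : ℝ → ℝ} (hκ : ContDiff ℝ ∞ κ) (z : ℝ × ℝ) (c : ℝ) :
    z.1 * ker k (deriv (deriv κ)) z + c * ker k (deriv κ) z +
      z.2 ^ (k + 1) * deriv κ (z.1 + z.2) =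
    ker k (fun σ => σ * deriv (deriv κ) σ + c * deriv κ σ) z + (k + 1) * ker k (deriv κ) z := by
  have hκ1 : ContDiff ℝ ∞ (deriv κ) := (contDiff_infty_iff_deriv.1 hκ).2
  have hκ2 : ContDiff ℝ ∞ (deriv (deriv κ)) := (contDiff_infty_iff_deriv.1 hκ1).2
  have c1 := hκ1.continuous
  have c2 := hκ2.continuous
  have h := ker_succ_deriv k hκ1 z
  have h2 : ker k (fun σ => σ * deriv (deriv κ) σ + c * deriv κ σ) z =
      z.1 * ker k (deriv (deriv κ)) z + c * ker k (deriv κ) z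
        + ker (k + 1) (deriv (deriv κ)) z := by
    simp only [ker_eq_integral]
    rw [← intervalIntegral.integral_const_mul, ← intervalIntegral.integral_const_mul,
      ← intervalIntegral.integral_add ((by fun_prop : Continuous _).intervalIntegrable _ _)
        ((by fun_prop : Continuous _).intervalIntegrable _ _),
      ← intervalIntegral.integral_add ((by fun_prop : Continuous _).intervalIntegrable _ _)
        ((by fun_prop : Continuous _).intervalIntegrable _ _)]
    refine intervalIntegral.integral_congr fun t _ => ?_
    ring
  linarith

end Kernel

section Radial

variable {N : ℕ} [NeZero N]

/-- The pair `(‖y - x‖², 4 x₁ y₁)`. -/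
noncomputable def dp (x y : Eu N) : ℝ × ℝ := (‖y - x‖ ^ 2, 4 * x 0 * y 0)

/-- The radial kernel `∫₀^{4 x₁ y₁} τ^k κ(‖y - x‖² + τ) dτ`. -/
noncomputable def rker (k : ℕ) (κ : ℝ → ℝ) (x y : Eu N) : ℝ := ker k κ (dp x y)

/-- The operator `κ ↦ σ κ'' + (N/2 + 1) κ'`. -/
noncomputable def radOp (N : ℕ) (κ : ℝ → ℝ) (σ : ℝ) : ℝ :=
  σ * deriv (deriv κ) σ + (N / 2 + 1) * deriv κ σ

lemma contDiff_deriv_smooth {κ : ℝ → ℝ} (hκ : ContDiff ℝ ∞ κ) : ContDiff ℝ ∞ (deriv κ) :=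
  (contDiff_infty_iff_deriv.1 hκ).2

lemma contDiff_radOp {κ : ℝ → ℝ} (hκ : ContDiff ℝ ∞ κ) : ContDiff ℝ ∞ (radOp N κ) :=
  (contDiff_id.mul (contDiff_deriv_smooth (contDiff_deriv_smooth hκ))).add
    (contDiff_const.mul (contDiff_deriv_smooth hκ))

lemma contDiff_dp (x : Eu N) : ContDiff ℝ ∞ (dp x) :=
  ((contDiff_id.sub contDiff_const).norm_sq ℝ).prodMk (contDiff_const.mul (contDiff_coord 0))

lemma contDiff_rker (k : ℕ) {κ : ℝ → ℝ} (hκ : ContDiff ℝ ∞ κ) (x : Eu N) :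
    ContDiff ℝ ∞ (rker k κ x) :=
  (contDiff_ker k hκ).comp (contDiff_dp x)

lemma inner_single_one (v : Eu N) (i : Fin N) :
    inner ℝ v (EuclideanSpace.single i (1 : ℝ)) = v i := by
  rw [EuclideanSpace.inner_single_right]
  simp

lemma pd_comp_dp {Φ : ℝ × ℝ → ℝ} {A B : ℝ} {x y : Eu N}
    (h : HasFDerivAt Φ (A • ContinuousLinearMap.fst ℝ ℝ ℝ + B • ContinuousLinearMap.snd ℝ ℝ ℝ)
      (dp x y)) (i : Fin N) :
    pd i (fun y => Φ (dp x y)) y = A * (2 * (y i - x i)) + B * (if i = 0 then 4 * x 0 else 0) := by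
  have h1 : HasFDerivAt (fun y : Eu N => ‖y - x‖ ^ 2) (2 • (innerSL ℝ (y - x)).comp
      (ContinuousLinearMap.id ℝ (Eu N))) y := ((hasFDerivAt_id y).sub_const x).norm_sq
  have h2 : HasFDerivAt (fun z : Eu N => 4 * x 0 * z 0)
      ((4 * x 0) • (EuclideanSpace.proj 0 : Eu N →L[ℝ] ℝ)) y :=
    (EuclideanSpace.proj (𝕜 := ℝ) (0 : Fin N)).hasFDerivAt.const_mul (4 * x 0)
  have h3 := h.comp y (h1.prodMk h2)
  rw [pd]
  erw [h3.fderiv]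
  by_cases hi : i = 0
  · subst hi
    simp [inner_single_one]
  · simp [hi, Ne.symm hi, inner_single_one]

lemma pd_rker (k : ℕ) {κ : ℝ → ℝ} (hκ : ContDiff ℝ ∞ κ) (x : Eu N) (i : Fin N) :
    pd i (rker k κ x) = fun y => rker k (deriv κ) x y * (2 * (y i - x i)) +
      (4 * x 0 * y 0) ^ k * κ ((dp x y).1 + (dp x y).2) * (if i = 0 then 4 * x 0 else 0) :=
  funext fun y => pd_comp_dp (hasFDerivAt_ker k hκ (dp x y)) i

lemma pd_comp_sum {κ : ℝ → ℝ} (hκ : ContDiff ℝ ∞ κ) (x : Eu N) (i : Fin N) :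
    pd i (fun y => κ ((dp x y).1 + (dp x y).2)) = fun y => deriv κ ((dp x y).1 + (dp x y).2) *
      (2 * (y i - x i) + (if i = 0 then 4 * x 0 else 0)) := by
  funext y
  have h : HasFDerivAt (fun z : ℝ × ℝ => κ (z.1 + z.2)) (deriv κ ((dp x y).1 + (dp x y).2) •
      ContinuousLinearMap.fst ℝ ℝ ℝ + deriv κ ((dp x y).1 + (dp x y).2) •
      ContinuousLinearMap.snd ℝ ℝ ℝ) (dp x y) := by
    have := ((hκ.differentiable (by simp)) ((dp x y).1 + (dp x y).2)).hasDerivAt.comp_hasFDerivAt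
      (dp x y) (f := fun z : ℝ × ℝ => z.1 + z.2) ((hasFDerivAt_fst (𝕜 := ℝ) (p := dp x y)).add (hasFDerivAt_snd (p := dp x y)))
    simp only [smul_add] at this
    exact this
  rw [pd_comp_dp h i]
  ring

lemma pd_coord_sub (i j : Fin N) (b : ℝ) :
    pd i (fun y : Eu N => y j - b) = fun _ => if i = j then 1 else 0 := by
  funext y
  have h2 : HasFDerivAt (fun z : Eu N => z j - b) (EuclideanSpace.proj j : Eu N →L[ℝ] ℝ) y :=
    (EuclideanSpace.proj (𝕜 := ℝ) j).hasFDerivAt.sub_const b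
  rw [pd, h2.fderiv]
  by_cases h : i = j
  · simp [h]
  · simp [h, Ne.symm h]

lemma pd_coord_pow (i : Fin N) (c : ℝ) (k : ℕ) :
    pd i (fun y : Eu N => (c * y 0) ^ k) = fun y =>
      (if i = 0 then c else 0) * (k * (c * y 0) ^ (k - 1)) := by
  have := pd_comp_coord (N := N) (φ := fun s => s ^ k) (by fun_prop) c i
  simpa using this

lemma contDiff_sum_dp {κ : ℝ → ℝ} (hκ : ContDiff ℝ ∞ κ) (x : Eu N) :
    ContDiff ℝ ∞ (fun y => κ ((dp x y).1 + (dp x y).2)) :=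
  hκ.comp ((contDiff_dp x).fst.add (contDiff_dp x).snd)

lemma sum_sq_dp (x y : Eu N) : ∑ i, (y i - x i) ^ 2 = (dp x y).1 := by
  simp [dp, EuclideanSpace.norm_sq_eq]

lemma lap_rker (k : ℕ) {κ : ℝ → ℝ} (hκ : ContDiff ℝ ∞ κ) (x : Eu N) :
    lap (rker k κ x) = fun y => 4 * rker k (radOp N κ) x y + 4 * (k * rker k (deriv κ) x y) +
      16 * x 0 ^ 2 * (k * ((4 * x 0 * y 0) ^ (k - 1) * κ ((dp x y).1 + (dp x y).2))) := by
  have hκ1 := contDiff_deriv_smooth hκ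
  have o := one_le_smooth
  rw [lap_eq_fun ((contDiff_rker k hκ x).of_le two_le_smooth)]
  funext y
  have hs : ∀ i : Fin N, pd i (pd i (rker k κ x)) y =
      4 * rker k (deriv (deriv κ)) x y * (y i - x i) ^ 2 + 2 * rker k (deriv κ) x y +
      (if i = 0 then 4 * x 0 * ((4 * x 0 * y 0) ^ k * deriv κ ((dp x y).1 + (dp x y).2) *
        (4 * (y 0 - x 0) + 4 * x 0) +
        4 * x 0 * (k * ((4 * x 0 * y 0) ^ (k - 1) * κ ((dp x y).1 + (dp x y).2)))) else 0) := by
    intro i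
    have c1 : ContDiff ℝ 1 (fun y : Eu N => 2 * (y i - x i)) :=
      contDiff_const.mul ((contDiff_coord i).sub contDiff_const)
    have c1' : ContDiff ℝ 1 (fun y : Eu N => (y i - x i)) :=
      ((contDiff_coord i).sub contDiff_const)
    have c2 : ContDiff ℝ 1 (fun y : Eu N => (4 * x 0 * y 0) ^ k) :=
      (contDiff_const.mul (contDiff_coord 0)).pow k
    have c3 := (contDiff_sum_dp hκ x).of_le o
    have c4 := (contDiff_rker k hκ1 x).of_le o
    rw [pd_rker k hκ x i]
    have e : (fun y => rker k (deriv κ) x y * (2 * (y i - x i)) +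
      (4 * x 0 * y 0) ^ k * κ ((dp x y).1 + (dp x y).2) * (if i = 0 then 4 * x 0 else 0)) =
      fun y => rker k (deriv κ) x y * (2 * (y i - x i)) +
      (if i = 0 then 4 * x 0 else 0) * ((4 * x 0 * y 0) ^ k * κ ((dp x y).1 + (dp x y).2)) := by
      funext y; ring
    rw [e, pd_add (c4.mul c1) (contDiff_const.mul (c2.mul c3)), pd_const_mul (c2.mul c3),
      pd_mul c4 c1, pd_mul c2 c3, pd_const_mul c1', pd_coord_sub, pd_rker k hκ1,
      pd_comp_sum hκ, pd_coord_pow]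
    by_cases h : i = 0
    · subst h
      simp only [if_true]
      ring
    · simp only [h, if_false, if_true]
      ring
  rw [Finset.sum_congr rfl fun i _ => hs i, Finset.sum_add_distrib, Finset.sum_add_distrib,
    ← Finset.mul_sum, sum_sq_dp]
  have hp := ker_by_parts k hκ (dp x y) (N / 2)
  have hr : rker k (radOp N κ) x y = ker k (fun σ => σ * deriv (deriv κ) σ + N / 2 * deriv κ σ)
      (dp x y) + rker k (deriv κ) x y := by
    have c1 := hκ1.continuous
    have c2 := (contDiff_deriv_smooth hκ1).continuous
    simp only [rker, ker_eq_integral]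
    rw [← intervalIntegral.integral_add ((by fun_prop : Continuous _).intervalIntegrable _ _)
        ((by fun_prop : Continuous _).intervalIntegrable _ _)]
    refine intervalIntegral.integral_congr fun t _ => ?_
    simp only [radOp]
    ring
  rw [hr]
  simp only [Finset.sum_const, Finset.card_univ, Fintype.card_fin, Finset.sum_ite_eq',
    Finset.mem_univ, if_true, nsmul_eq_mul]
  simp only [rker] at hp ⊢
  have e2 : (dp x y).2 = 4 * x 0 * y 0 := rfl
  rw [e2] at hp ⊢
  have e3 : (4 * x 0 * y 0) ^ (k + 1) = (4 * x 0 * y 0) ^ k * (4 * x 0 * y 0) := pow_succ _ _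
  rw [e3] at hp
  linear_combination 4 * hp

lemma lap_rker_zero {κ : ℝ → ℝ} (hκ : ContDiff ℝ ∞ κ) (x : Eu N) :
    lap (rker 0 κ x) = fun y => 4 * rker 0 (radOp N κ) x y := by
  rw [lap_rker 0 hκ x]
  simp

lemma lap_rker_succ (k : ℕ) {κ : ℝ → ℝ} (hκ : ContDiff ℝ ∞ κ) (x : Eu N) :
    lap (rker (k + 1) κ x) = fun y => 4 * rker (k + 1) (radOp N κ) x y +
      ((-4 * (k + 1) ^ 2) * rker k κ x y + (4 * (k + 1) * (4 * x 0) ^ (k + 1)) *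
        (y 0 ^ k * ((y 0 + x 0) * κ ((dp x y).1 + (dp x y).2)))) := by
  rw [lap_rker (k + 1) hκ x]
  funext y
  have h := ker_succ_deriv k hκ (dp x y)
  have e2 : (dp x y).2 = 4 * x 0 * y 0 := rfl
  simp only [rker]
  rw [h, e2]
  push_cast
  simp only [mul_pow]
  ring

lemma lap_coord_add_mul {κ : ℝ → ℝ} (hκ : ContDiff ℝ ∞ κ) (x : Eu N) :
    lap (fun y => (y 0 + x 0) * κ ((dp x y).1 + (dp x y).2)) = fun y =>
      4 * (y 0 + x 0) * radOp N κ ((dp x y).1 + (dp x y).2) := by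
  have hκ1 := contDiff_deriv_smooth hκ
  have o := one_le_smooth
  have hd := contDiff_sum_dp hκ x
  have c0 : ContDiff ℝ ∞ (fun y : Eu N => y 0 - (-x 0)) := (contDiff_coord 0).sub contDiff_const
  have e0 : (fun y : Eu N => (y 0 + x 0) * κ ((dp x y).1 + (dp x y).2)) =
      fun y => (y 0 - (-x 0)) * κ ((dp x y).1 + (dp x y).2) := by simp
  rw [e0, lap_eq_fun ((c0.mul hd).of_le two_le_smooth)]
  funext y
  have hs : ∀ i : Fin N, pd i (pd i (fun y => (y 0 - (-x 0)) * κ ((dp x y).1 + (dp x y).2))) y =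
      (y 0 + x 0) * (deriv (deriv κ) ((dp x y).1 + (dp x y).2)) * 4 * (y i - x i) ^ 2 +
      2 * (y 0 + x 0) * deriv κ ((dp x y).1 + (dp x y).2) +
      (if i = 0 then (y 0 + x 0) * (deriv (deriv κ) ((dp x y).1 + (dp x y).2)) *
        (16 * x 0 * (y 0 - x 0) + (4 * x 0) ^ 2) +
        2 * deriv κ ((dp x y).1 + (dp x y).2) * (2 * (y 0 - x 0) + 4 * x 0) else 0) := by
    intro i
    have c1' : ContDiff ℝ 1 (fun y : Eu N => (y i - x i)) :=
      ((contDiff_coord i).sub contDiff_const)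
    have c5 : ContDiff ℝ 1 (fun y : Eu N => (y i - (x i - (if i = 0 then 2 * x 0 else 0)))) :=
      ((contDiff_coord i).sub contDiff_const)
    have c6 := contDiff_const (c := (2 : ℝ)) (n := 1) |>.mul c5
    have c3 := (contDiff_sum_dp hκ1 x).of_le o
    have ei : (fun y => deriv κ ((dp x y).1 + (dp x y).2) *
      (2 * (y i - x i) + (if i = 0 then 4 * x 0 else 0))) = fun y =>
      deriv κ ((dp x y).1 + (dp x y).2) *
      (2 * (y i - (x i - (if i = 0 then 2 * x 0 else 0)))) := by
      funext y; split_ifs <;> ring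
    rw [pd_mul (c0.of_le o) (hd.of_le o), pd_coord_sub, pd_comp_sum hκ, ei,
      pd_add ((c0.of_le o).mul (c3.mul c6)) (contDiff_const.mul (hd.of_le o)),
      pd_mul (c0.of_le o) (c3.mul c6), pd_mul c3 c6, pd_const_mul c5, pd_coord_sub, pd_coord_sub,
      pd_comp_sum hκ1, pd_const_mul (hd.of_le o), pd_comp_sum hκ]
    by_cases h : i = 0
    · subst h
      simp only [if_true]
      ring
    · simp only [h, if_false, if_true]
      ring
  rw [Finset.sum_congr rfl fun i _ => hs i, Finset.sum_add_distrib, Finset.sum_add_distrib,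
    ← Finset.mul_sum, sum_sq_dp]
  simp only [Finset.sum_const, Finset.card_univ, Fintype.card_fin, Finset.sum_ite_eq',
    Finset.mem_univ, if_true, nsmul_eq_mul, radOp]
  have e2 : (dp x y).2 = 4 * x 0 * y 0 := rfl
  generalize hD : (dp x y).1 + (dp x y).2 = D
  have hD' : (dp x y).1 = D - 4 * x 0 * y 0 := by rw [← hD, e2]; ring
  rw [hD']
  ring

lemma pd_comm {f : Eu N → ℝ} (hf : ContDiff ℝ ∞ f) (i j : Fin N) :
    pd i (pd j f) = pd j (pd i f) := by
  funext y
  have hd : ∀ v, DifferentiableAt ℝ (fun z => fderiv ℝ f z v) y := fun v =>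
    ((hf.fderiv_right (m := ∞) (by simp)).clm_apply contDiff_const).differentiable (by simp) y
  have hd' : DifferentiableAt ℝ (fderiv ℝ f) y :=
    (hf.fderiv_right (m := ∞) (by simp)).differentiable (by simp) y
  have hsymm := (hf.contDiffAt (x := y)).isSymmSndFDerivAt (by simpa using two_le_smooth)
  have key : ∀ i j : Fin N, pd i (pd j f) y = fderiv ℝ (fderiv ℝ f) y
      (EuclideanSpace.single i 1) (EuclideanSpace.single j 1) := by
    intro i j
    have : HasFDerivAt (fun z => fderiv ℝ f z (EuclideanSpace.single j 1))
      ((fderiv ℝ (fderiv ℝ f) y).flip (EuclideanSpace.single j 1)) y := by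
      have := hd'.hasFDerivAt.clm_apply (hasFDerivAt_const (EuclideanSpace.single j (1 : ℝ)) y)
      simpa using this
    change fderiv ℝ (fun z => fderiv ℝ f z (EuclideanSpace.single j 1)) y _ = _
    rw [this.fderiv]
    rfl
  rw [key, key]
  exact hsymm.eq _ _

lemma pd_zero_of_eqOn {U : Set (Eu N)} (hU : IsOpen U) {f : Eu N → ℝ} (h : EqOn f 0 U)
    (i : Fin N) : EqOn (pd i f) 0 U := by
  intro y hy
  have : f =ᶠ[𝓝 y] fun _ => 0 := h.eventuallyEq_of_mem (hU.mem_nhds hy)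
  simp [pd, this.fderiv_eq]

lemma lap_pd_comm {f : Eu N → ℝ} (hf : ContDiff ℝ ∞ f) (i : Fin N) :
    lap (pd i f) = pd i (lap f) := by
  have hp := fun j => contDiff_pd (k := ∞) hf (by simp) j
  have hpp := fun j => contDiff_pd (k := ∞) (hp j) (by simp) j
  rw [lap_eq_fun ((hp i).of_le two_le_smooth), lap_eq_fun (hf.of_le two_le_smooth)]
  funext y
  have : fderiv ℝ (fun y => ∑ j, pd j (pd j f) y) y = ∑ j, fderiv ℝ (pd j (pd j f)) y :=
    fderiv_fun_sum fun j _ => (hpp j).differentiable (by simp) y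
  simp only [pd] at this ⊢
  rw [this, _root_.sum_apply]
  refine Finset.sum_congr rfl fun j _ => ?_
  have e1 := pd_comm hf j i
  have e2 := pd_comm (hp j) j i
  exact congrFun ((congrArg (pd j) e1).trans e2) y

lemma lap_iterate_coord_pow_mul {U : Set (Eu N)} (hU : IsOpen U) (j : ℕ) {h : Eu N → ℝ}
    (hh : ContDiff ℝ ∞ h) (h0 : EqOn (lap h) 0 U) {n : ℕ} (hn : j + 1 ≤ n) :
    EqOn (lap^[n] (fun y => y 0 ^ j * h y)) 0 U := by
  induction j using Nat.strong_induction_on generalizing h n with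
  | _ j ih =>
    obtain ⟨n, rfl⟩ : ∃ k, n = k + 1 := ⟨n - 1, by omega⟩
    have hp : ContDiff ℝ ∞ (pd 0 h) := contDiff_pd (k := ∞) hh (by simp) 0
    have hp0 : EqOn (lap (pd 0 h)) 0 U := by
      rw [lap_pd_comm hh]
      exact pd_zero_of_eqOn hU h0 0
    have e := lap_coord_mul (N := N) (φ := fun s => s ^ j) (by fun_prop) hh 1
    simp only [one_mul, one_pow] at e
    have hd1 : deriv (fun s : ℝ => s ^ j) = fun s => (j : ℝ) * s ^ (j - 1) := by
      funext s; simp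
    rw [hd1] at e
    have hd2 : deriv (fun s : ℝ => (j : ℝ) * s ^ (j - 1)) =
        fun s => (j : ℝ) * ((j - 1 : ℕ) * s ^ (j - 1 - 1)) := by
      funext s; simp
    rw [hd2] at e
    rw [Function.iterate_succ_apply, e]
    have cp : ∀ i : ℕ, ContDiff ℝ ∞ (fun y : Eu N => y 0 ^ i) := fun i =>
      (contDiff_coord 0).pow i
    have e2 : EqOn (fun z : Eu N => j * ((j - 1 : ℕ) * z 0 ^ (j - 1 - 1)) * h z +
        (j * z 0 ^ (j - 1) * (2 * pd 0 h z) + z 0 ^ j * lap h z))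
        (fun z => (j * ((j - 1 : ℕ) : ℝ)) * (z 0 ^ (j - 1 - 1) * h z) +
          (2 * j : ℝ) * (z 0 ^ (j - 1) * pd 0 h z)) U := by
      intro z hz
      have := h0 hz
      simp only [Pi.zero_apply] at this
      simp only [this]
      ring
    refine (lap_iterate_eqOn hU e2 n).trans ?_
    intro z hz
    have s1 := (cp (j - 1 - 1)).mul hh
    have s2 := (cp (j - 1)).mul hp
    rw [lap_iterate_add (contDiff_const.mul s1) (contDiff_const.mul s2),
      lap_iterate_const_mul s1, lap_iterate_const_mul s2]
    rcases Nat.eq_zero_or_pos j with rfl | hj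
    · simp
    · have a2 := ih (j - 1) (by omega) hp hp0 (n := n) (by omega) hz
      have a1 := ih (j - 1 - 1) (by omega) hh h0 (n := n) (by omega) hz
      simp only [Pi.zero_apply] at a1 a2 ⊢
      rw [a1, a2]
      simp

lemma sq_le_sum_dp {x y : Eu N} (hx : 0 ≤ x 0) (hy : 0 ≤ y 0) :
    x 0 ^ 2 ≤ (dp x y).1 + (dp x y).2 := by
  have h1 : (y 0 - x 0) ^ 2 ≤ (dp x y).1 := by
    rw [← sum_sq_dp]
    exact Finset.single_le_sum (f := fun i => (y i - x i) ^ 2) (fun i _ => sq_nonneg _)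
      (Finset.mem_univ 0)
  have e2 : (dp x y).2 = 4 * x 0 * y 0 := rfl
  rw [e2]
  nlinarith [mul_nonneg hx hy, sq_nonneg (y 0)]

lemma exists_lap_iterate_rker (k : ℕ) : ∃ c : ℕ → ℝ, ∀ (κ : ℝ → ℝ) (x : Eu N),
    ContDiff ℝ ∞ κ → 0 < x 0 → (∀ σ : ℝ, x 0 ^ 2 ≤ σ → radOp N κ σ = 0) → ∀ y ∈ upper N,
    lap^[k + 1] (rker k κ x) y =
      ∑ j ∈ Finset.range (k + 1), c j * lap^[j] (rker j (radOp N κ) x) y := by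
  induction k with
  | zero =>
    refine ⟨fun _ => 4, fun κ x hκ _ _ y _ => ?_⟩
    simp [lap_rker_zero hκ x]
  | succ k ih =>
    obtain ⟨c, hc⟩ := ih
    refine ⟨fun j => if j = k + 1 then 4 else (-4 * (k + 1) ^ 2) * c j,
      fun κ x hκ hx h0 y hy => ?_⟩
    have hh : ContDiff ℝ ∞ (fun y : Eu N => (y 0 + x 0) * κ ((dp x y).1 + (dp x y).2)) :=
      ((contDiff_coord 0).add contDiff_const).mul (contDiff_sum_dp hκ x)
    have hh0 : EqOn (lap (fun y : Eu N => (y 0 + x 0) * κ ((dp x y).1 + (dp x y).2))) 0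
        (upper N) := by
      intro z hz
      rw [lap_coord_add_mul hκ]
      simp [h0 _ (sq_le_sum_dp hx.le (le_of_lt hz))]
    have hz := lap_iterate_coord_pow_mul isOpen_upper k hh hh0 (le_refl (k + 1)) hy
    have s1 := contDiff_rker (k + 1) (contDiff_radOp (N := N) hκ) x
    have s2 := contDiff_rker k hκ x
    have s3 : ContDiff ℝ ∞ (fun y : Eu N => y 0 ^ k * ((y 0 + x 0) *
        κ ((dp x y).1 + (dp x y).2))) := ((contDiff_coord 0).pow k).mul hh
    rw [Function.iterate_succ_apply, lap_rker_succ k hκ x,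
      lap_iterate_add (contDiff_const.mul s1)
        ((contDiff_const.mul s2).add (contDiff_const.mul s3)),
      lap_iterate_add (contDiff_const.mul s2) (contDiff_const.mul s3),
      lap_iterate_const_mul s1, lap_iterate_const_mul s2, lap_iterate_const_mul s3]
    simp only [Pi.zero_apply] at hz
    beta_reduce
    rw [hz, hc κ x hκ hx h0 y hy, Finset.sum_range_succ _ (k + 1), Finset.mul_sum]
    simp only [if_true, mul_zero, add_zero]
    rw [add_comm]
    congr 1
    refine Finset.sum_congr rfl fun j hj => ?_
    have : j ≠ k + 1 := by
      have := Finset.mem_range.1 hj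
      omega
    simp [this, mul_assoc]

end Radial

section KernelScaling

lemma ker_smul (k : ℕ) (κ : ℝ → ℝ) (c : ℝ) (z : ℝ × ℝ) :
    ker k κ (c • z) = c ^ (k + 1) * ker k (fun σ => κ (c * σ)) z := by
  simp only [ker, moment, Prod.smul_fst, Prod.smul_snd, smul_eq_mul, mul_pow, mul_assoc]
  have : ∀ t : ℝ, c * z.1 + t * (c * z.2) = c * (z.1 + t * z.2) := fun t => by ring
  simp only [this]

lemma ker_const_mul (k : ℕ) (κ : ℝ → ℝ) (b : ℝ) (z : ℝ × ℝ) :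
    ker k (fun σ => b * κ σ) z = b * ker k κ z := by
  simp only [ker, moment]
  simp only [mul_left_comm _ b, intervalIntegral.integral_const_mul]

lemma moment_congr (k : ℕ) {κ κ' : ℝ → ℝ} {z : ℝ × ℝ} (hz : 0 ≤ z.2)
    (h : ∀ σ, z.1 ≤ σ → κ σ = κ' σ) : moment k κ z = moment k κ' z := by
  refine intervalIntegral.integral_congr fun t ht => ?_
  rw [uIcc_of_le zero_le_one] at ht
  rw [h _ (le_add_of_nonneg_right (mul_nonneg ht.1 hz))]

lemma ker_congr (k : ℕ) {κ κ' : ℝ → ℝ} {z : ℝ × ℝ} (hz : 0 ≤ z.2)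
    (h : ∀ σ, z.1 ≤ σ → κ σ = κ' σ) : ker k κ z = ker k κ' z := by
  rw [ker, ker, moment_congr k hz h]

lemma ker_truncate (k : ℕ) {κ : ℝ → ℝ} (hκ : Continuous κ) (h0 : ∀ σ, 1 ≤ σ → κ σ = 0)
    {d p : ℝ} (hd : 0 ≤ d) (hdp : 1 ≤ d + p) : ker k κ (d, p) = moment k κ (d, 1) := by
  have h1 : ker k κ (d, 1) = moment k κ (d, 1) := by simp [ker]
  rw [← h1, ker_eq_integral, ker_eq_integral]
  have hc : Continuous fun τ : ℝ => τ ^ k * κ (d + τ) := by fun_prop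
  rw [← intervalIntegral.integral_add_adjacent_intervals (hc.intervalIntegrable 0 1)
    (hc.intervalIntegrable 1 p)]
  have : ∫ τ in (1 : ℝ)..p, τ ^ k * κ (d + τ) = ∫ τ in (1 : ℝ)..p, 0 := by
    refine intervalIntegral.integral_congr fun τ hτ => ?_
    rw [h0, mul_zero]
    rcases le_total 1 p with h | h
    · rw [uIcc_of_le h] at hτ
      linarith [hτ.1]
    · rw [uIcc_of_ge h] at hτ
      linarith [hτ.1]
  simp [this]

end KernelScaling

section Regularization

/-- A smooth function agreeing with `σ^(-N/2)` for `σ ≥ 1/2` and vanishing for `σ ≤ 1/4`. -/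
noncomputable def kapOne (N : ℕ) (σ : ℝ) : ℝ :=
  Real.smoothTransition (4 * σ - 1) * σ ^ (-(N / 2 : ℝ))

/-- The rescaling of `kapOne` that agrees with `σ^(-N/2)` for `σ ≥ ε²`. -/
noncomputable def kap (N : ℕ) (ε σ : ℝ) : ℝ := ε⁻¹ ^ N * kapOne N (ε⁻¹ ^ 2 * σ)

variable {N : ℕ}

lemma contDiff_kapOne : ContDiff ℝ ∞ (kapOne N) := by
  rw [contDiff_iff_contDiffAt]
  intro σ
  by_cases h : σ = 0
  · subst h
    have : kapOne N =ᶠ[𝓝 0] fun _ => 0 := by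
      filter_upwards [gt_mem_nhds (show (0 : ℝ) < 1 / 4 by norm_num)] with s hs
      rw [kapOne, Real.smoothTransition.zero_of_nonpos (by linarith), zero_mul]
    exact contDiffAt_const.congr_of_eventuallyEq this
  · exact (Real.smoothTransition.contDiffAt.comp σ
      ((contDiffAt_const.mul contDiffAt_id).sub contDiffAt_const)).mul
      (Real.contDiffAt_rpow_const_of_ne h)

lemma contDiff_kap (ε : ℝ) : ContDiff ℝ ∞ (kap N ε) :=
  contDiff_const.mul (contDiff_kapOne.comp (contDiff_const.mul contDiff_id))

lemma kapOne_eq {σ : ℝ} (h : 1 / 2 ≤ σ) : kapOne N σ = σ ^ (-(N / 2 : ℝ)) := by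
  rw [kapOne, Real.smoothTransition.one_of_one_le (by linarith), one_mul]

lemma kapOne_nonneg (σ : ℝ) : 0 ≤ kapOne N σ := by
  rcases le_total σ (1 / 4) with h | h
  · rw [kapOne, Real.smoothTransition.zero_of_nonpos (by linarith), zero_mul]
  · exact mul_nonneg (Real.smoothTransition.nonneg _) (Real.rpow_nonneg (by linarith) _)

lemma kapOne_le {σ : ℝ} (h : 0 ≤ σ) : kapOne N σ ≤ σ ^ (-(N / 2 : ℝ)) :=
  mul_le_of_le_one_left (Real.rpow_nonneg h _) (Real.smoothTransition.le_one _)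

lemma inv_pow_mul_rpow {ε σ : ℝ} (hε : 0 < ε) (hσ : 0 ≤ σ) :
    ε⁻¹ ^ N * (ε⁻¹ ^ 2 * σ) ^ (-(N / 2 : ℝ)) = σ ^ (-(N / 2 : ℝ)) := by
  have hi : 0 < ε⁻¹ := inv_pos.2 hε
  rw [Real.mul_rpow (by positivity) hσ, ← mul_assoc]
  have : (ε⁻¹ ^ 2) ^ (-(N / 2 : ℝ)) = (ε⁻¹ ^ N)⁻¹ := by
    rw [← Real.rpow_natCast, ← Real.rpow_mul hi.le, ← Real.rpow_natCast, ← Real.rpow_neg hi.le]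
    congr 1
    push_cast
    ring
  rw [this, mul_inv_cancel₀ (by positivity), one_mul]

lemma kap_eq {ε σ : ℝ} (hε : 0 < ε) (h : ε ^ 2 ≤ σ) : kap N ε σ = σ ^ (-(N / 2 : ℝ)) := by
  have h1 : 1 ≤ ε⁻¹ ^ 2 * σ := by
    rw [inv_pow, ← div_eq_inv_mul, le_div_iff₀ (by positivity)]
    linarith
  rw [kap, kapOne_eq (by linarith), inv_pow_mul_rpow hε ((sq_nonneg ε).trans h)]

lemma kap_nonneg {ε : ℝ} (hε : 0 < ε) (σ : ℝ) : 0 ≤ kap N ε σ :=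
  mul_nonneg (by positivity) (kapOne_nonneg _)

lemma kap_le {ε σ : ℝ} (hε : 0 < ε) (h : 0 ≤ σ) : kap N ε σ ≤ σ ^ (-(N / 2 : ℝ)) := by
  rw [← inv_pow_mul_rpow hε h]
  exact mul_le_mul_of_nonneg_left (kapOne_le (by positivity)) (by positivity)

lemma radOp_kapOne {σ : ℝ} (h : 1 ≤ σ) : radOp N (kapOne N) σ = 0 := by
  have hd : ∀ s : ℝ, 1 / 2 < s → deriv (kapOne N) s = -(N / 2 : ℝ) * s ^ (-(N / 2 : ℝ) - 1) := by
    intro s hs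
    have he : kapOne N =ᶠ[𝓝 s] fun s => s ^ (-(N / 2 : ℝ)) := by
      filter_upwards [lt_mem_nhds hs] with r hr using kapOne_eq hr.le
    rw [he.deriv_eq]
    exact (Real.hasDerivAt_rpow_const (Or.inl (by linarith))).deriv
  have he : deriv (kapOne N) =ᶠ[𝓝 σ] fun s => -(N / 2 : ℝ) * s ^ (-(N / 2 : ℝ) - 1) := by
    filter_upwards [lt_mem_nhds (show 1 / 2 < σ by linarith)] with r hr using hd r hr
  have hσ : 0 < σ := by linarith
  have h2 := ((Real.hasDerivAt_rpow_const (x := σ) (p := -(N / 2 : ℝ) - 1)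
    (Or.inl hσ.ne')).const_mul (-(N / 2 : ℝ))).deriv
  rw [radOp, hd σ (by linarith), he.deriv_eq, h2, Real.rpow_sub_one hσ.ne' (-(N / 2 : ℝ) - 1)]
  field_simp
  ring

lemma radOp_kap (ε σ : ℝ) :
    radOp N (kap N ε) σ = ε⁻¹ ^ (N + 2) * radOp N (kapOne N) (ε⁻¹ ^ 2 * σ) := by
  have h1 : deriv (kap N ε) = fun σ => ε⁻¹ ^ (N + 2) * deriv (kapOne N) (ε⁻¹ ^ 2 * σ) := by
    funext s
    change deriv (fun σ => ε⁻¹ ^ N * kapOne N (ε⁻¹ ^ 2 * σ)) s = _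
    rw [deriv_const_mul_field, deriv_comp_mul_left, smul_eq_mul, pow_add, mul_assoc]
  have h2 : deriv (deriv (kap N ε)) = fun σ =>
      ε⁻¹ ^ (N + 2) * (ε⁻¹ ^ 2 * deriv (deriv (kapOne N)) (ε⁻¹ ^ 2 * σ)) := by
    rw [h1]
    funext s
    rw [deriv_const_mul_field, deriv_comp_mul_left, smul_eq_mul]
  rw [radOp, radOp, h2, h1]
  ring

variable [NeZero N]

/-- The Green kernel of `(-Δ)^m` in the half-space with Dirichlet conditions, up to a constant. -/
noncomputable def green (m : ℕ) (x y : Eu N) : ℝ :=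
  ∫ τ in (0 : ℝ)..(4 * x 0 * y 0), τ ^ (m - 1) * (‖y - x‖ ^ 2 + τ) ^ (-(N / 2 : ℝ))

lemma rker_kap_eq_green (m : ℕ) {ε : ℝ} (hε : 0 < ε) {x y : Eu N} (hx : 0 ≤ x 0) (hy : 0 ≤ y 0)
    (h : ε ≤ ‖y - x‖) : rker (m - 1) (kap N ε) x y = green m x y := by
  have hp : 0 ≤ 4 * x 0 * y 0 := by positivity
  rw [rker, ker_eq_integral, green]
  refine intervalIntegral.integral_congr fun τ hτ => ?_
  simp only [dp] at hτ ⊢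
  rw [uIcc_of_le hp] at hτ
  rw [kap_eq hε]
  have : ε ^ 2 ≤ ‖y - x‖ ^ 2 := by gcongr
  linarith [hτ.1]

lemma rker_kap_nonneg (k : ℕ) {ε : ℝ} (hε : 0 < ε) {x y : Eu N} (hx : 0 ≤ x 0) (hy : 0 ≤ y 0) :
    0 ≤ rker k (kap N ε) x y := by
  have hp : 0 ≤ 4 * x 0 * y 0 := by positivity
  rw [rker, ker_eq_integral]
  refine intervalIntegral.integral_nonneg hp fun τ hτ => ?_
  exact mul_nonneg (pow_nonneg hτ.1 _) (kap_nonneg hε _)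

lemma continuousOn_green_integrand (k : ℕ) {x y : Eu N} (hxy : y ≠ x) {p : ℝ} :
    ContinuousOn (fun τ : ℝ => τ ^ k * (‖y - x‖ ^ 2 + τ) ^ (-(N / 2 : ℝ))) (Icc 0 p) := by
  have hd : 0 < ‖y - x‖ := norm_pos_iff.2 (sub_ne_zero.2 hxy)
  refine (continuous_pow k).continuousOn.mul
    ((continuous_const.add continuous_id).continuousOn.rpow_const fun τ hτ => Or.inl ?_)
  have h0 : (0 : ℝ) ≤ τ := hτ.1
  exact (show (0 : ℝ) < ‖y - x‖ ^ 2 + τ by positivity).ne'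

lemma rker_kap_le_green (m : ℕ) {ε : ℝ} (hε : 0 < ε) {x y : Eu N} (hx : 0 ≤ x 0) (hy : 0 ≤ y 0)
    (hxy : y ≠ x) : rker (m - 1) (kap N ε) x y ≤ green m x y := by
  have hp : 0 ≤ 4 * x 0 * y 0 := by positivity
  rw [rker, ker_eq_integral, green]
  have hc := (contDiff_kap (N := N) ε).continuous
  have hi := (continuousOn_green_integrand (m - 1) hxy (p := 4 * x 0 * y 0))
  rw [← uIcc_of_le hp] at hi
  refine intervalIntegral.integral_mono_on hp
    ((by fun_prop : Continuous _).intervalIntegrable _ _) hi.intervalIntegrable fun τ hτ => ?_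
  have := hτ.1
  exact mul_le_mul_of_nonneg_left (kap_le hε (by simp only [dp]; positivity)) (by positivity)

/-- The profile of the iterated Laplacian of the regularized kernel. -/
noncomputable def bump (k : ℕ) (z : Eu N) : ℝ := moment k (radOp N (kapOne N)) (‖z‖ ^ 2, 1)

lemma contDiff_bump (k : ℕ) : ContDiff ℝ ∞ (bump (N := N) k) :=
  (contDiff_moment k (contDiff_radOp contDiff_kapOne)).comp
    ((contDiff_id.norm_sq ℝ).prodMk contDiff_const)

lemma bump_eq_zero (k : ℕ) {z : Eu N} (hz : 1 ≤ ‖z‖) : bump k z = 0 := by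
  rw [bump, moment]
  have : ∀ t ∈ uIcc (0 : ℝ) 1, t ^ k * radOp N (kapOne N) (‖z‖ ^ 2 + t * 1) = 0 := by
    intro t ht
    rw [uIcc_of_le zero_le_one] at ht
    rw [radOp_kapOne, mul_zero]
    nlinarith [ht.1]
  rw [intervalIntegral.integral_congr (g := fun _ => 0) this]
  simp

lemma rker_radOp_kap (k : ℕ) {ε : ℝ} (hε : 0 < ε) {x y : Eu N} (hx : ε ≤ x 0) (hy : 0 ≤ y 0) :
    rker k (radOp N (kap N ε)) x y = ε⁻¹ ^ N * ε ^ (2 * k) * bump k (ε⁻¹ • (y - x)) := by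
  have e1 : radOp N (kap N ε) = fun σ => ε⁻¹ ^ (N + 2) *
      (fun σ => radOp N (kapOne N) (ε⁻¹ ^ 2 * σ)) σ := funext fun σ => radOp_kap ε σ
  have e2 := ker_smul k (radOp N (kapOne N)) (ε⁻¹ ^ 2) (dp x y)
  have hi : ε⁻¹ ^ 2 * (ε ^ 2) = 1 := by
    rw [← mul_pow, inv_mul_cancel₀ hε.ne', one_pow]
  have e3 : ker k (radOp N (kapOne N)) (ε⁻¹ ^ 2 • dp x y) = bump k (ε⁻¹ • (y - x)) := by
    have : ε⁻¹ ^ 2 • dp x y = (‖ε⁻¹ • (y - x)‖ ^ 2, ε⁻¹ ^ 2 * (4 * x 0 * y 0)) := by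
      ext
      · simp [dp, norm_smul, mul_pow]
      · simp [dp]
    rw [this, bump]
    refine ker_truncate k (contDiff_radOp contDiff_kapOne).continuous
      (fun σ hσ => radOp_kapOne hσ) (by positivity) ?_
    have h1 := sq_le_sum_dp (hε.le.trans hx) hy
    have h2 : ε ^ 2 ≤ x 0 ^ 2 := by gcongr
    have h3 : ‖ε⁻¹ • (y - x)‖ ^ 2 = ε⁻¹ ^ 2 * ‖y - x‖ ^ 2 := by
      simp [norm_smul, mul_pow]
    rw [h3, ← mul_add, ← hi]
    refine mul_le_mul_of_nonneg_left ?_ (by positivity)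
    exact h2.trans h1
  rw [rker, e1, ker_const_mul, ← e3, e2]
  have : ε⁻¹ ^ (N + 2) = ε⁻¹ ^ N * ε ^ (2 * k) * (ε⁻¹ ^ 2) ^ (k + 1) := by
    have h2 : (ε⁻¹ ^ 2) ^ k * ε ^ (2 * k) = 1 := by rw [pow_mul ε, ← mul_pow, hi, one_pow]
    rw [pow_add, pow_succ (ε⁻¹ ^ 2)]
    linear_combination (-ε⁻¹ ^ N * ε⁻¹ ^ 2) * h2
  rw [this]
  ring

/-- The iterated Laplacian of the regularized kernel is a rescaled fixed bump. -/
lemma exists_lap_iterate_kap (m : ℕ) (hm : 0 < m) : ∃ Ψ : Eu N → ℝ, Continuous Ψ ∧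
    (∀ z, 1 < ‖z‖ → Ψ z = 0) ∧ ∀ (ε : ℝ) (x : Eu N), 0 < ε → ε ≤ x 0 → ∀ y ∈ upper N,
    lap^[m] (rker (m - 1) (kap N ε) x) y = ε⁻¹ ^ N * Ψ (ε⁻¹ • (y - x)) := by
  obtain ⟨k, rfl⟩ : ∃ k, m = k + 1 := ⟨m - 1, by omega⟩
  obtain ⟨c, hc⟩ := exists_lap_iterate_rker (N := N) k
  refine ⟨fun z => ∑ j ∈ Finset.range (k + 1), c j * lap^[j] (bump j) z, ?_, ?_, ?_⟩
  · exact continuous_finsetSum _ fun j _ =>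
      continuous_const.mul (contDiff_lap_iterate (contDiff_bump j) j).continuous
  · intro z hz
    refine Finset.sum_eq_zero fun j _ => ?_
    have hU : IsOpen {z : Eu N | 1 < ‖z‖} := isOpen_lt continuous_const continuous_norm
    have h0 : EqOn (bump (N := N) j) (fun _ => 0) {z : Eu N | 1 < ‖z‖} :=
      fun w hw => bump_eq_zero j (le_of_lt hw)
    rw [lap_iterate_eqOn hU h0 j hz, lap_iterate_zero, mul_zero]
  · intro ε x hε hx y hy
    rw [Nat.add_sub_cancel, hc (kap N ε) x (contDiff_kap ε) (hε.trans_le hx) ?_ y hy,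
      Finset.mul_sum]
    · refine Finset.sum_congr rfl fun j _ => ?_
      have he : EqOn (rker j (radOp N (kap N ε)) x)
          (fun y => (ε⁻¹ ^ N * ε ^ (2 * j)) * bump j (ε⁻¹ • (y - x))) (upper N) :=
        fun w hw => rker_radOp_kap j hε hx (le_of_lt hw)
      have hs : ContDiff ℝ ∞ (fun y : Eu N => bump j (ε⁻¹ • (y - x))) :=
        (contDiff_bump j).comp ((contDiff_id.sub contDiff_const).const_smul _)
      rw [lap_iterate_eqOn isOpen_upper he j hy, lap_iterate_const_mul hs,
        lap_iterate_comp_affine (contDiff_bump j)]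
      have : ε ^ (2 * j) * ε⁻¹ ^ (2 * j) = 1 := by
        rw [← mul_pow, mul_inv_cancel₀ hε.ne', one_pow]
      linear_combination (ε⁻¹ ^ N * c j * lap^[j] (bump j) (ε⁻¹ • (y - x))) * this
    · intro σ hσ
      rw [radOp_kap, radOp_kapOne, mul_zero]
      rw [inv_pow, ← div_eq_inv_mul, le_div_iff₀ (by positivity), one_mul]
      exact le_trans (by gcongr) hσ

end Regularization

section BoundaryDecay

variable {N m : ℕ} [NeZero N] {q : ℝ} {u : Eu N → ℝ}

lemma uniqueDiffOn_closed_half : UniqueDiffOn ℝ {y : Eu N | 0 ≤ y 0} := by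
  refine uniqueDiffOn_convex ?_ ?_
  · intro x hx y hy a b ha hb _
    simp only [mem_ofPred_eq, PiLp.add_apply, PiLp.smul_apply, smul_eq_mul] at *
    positivity
  · refine ⟨e1 N, interior_mono (show upper N ⊆ {y : Eu N | 0 ≤ y 0} from
      fun z (hz : 0 < z 0) => hz.le) ?_⟩
    rw [isOpen_upper.interior_eq]
    simp [e1]

lemma norm_e1 : ‖e1 N‖ = 1 := by simp [e1]

lemma e1_zero : e1 N 0 = 1 := by simp [e1]

lemma exists_abs_le_pow (hm : 0 < m) (hsol : IsBCSol N m q u) :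
    ∃ C : ℝ, 0 ≤ C ∧ ∀ y : Eu N, 0 ≤ y 0 → |u y| ≤ C * y 0 ^ m := by
  obtain ⟨-, hu, hb, -, hbc⟩ := hsol
  set S := {y : Eu N | 0 ≤ y 0} with hS
  have hSu : UniqueDiffOn ℝ S := uniqueDiffOn_closed_half
  have key : ∀ i : ℕ, i ≤ m → ∃ C : ℝ, 0 ≤ C ∧ ∀ y ∈ S,
      ‖iteratedFDerivWithin ℝ (m - i) u S y (fun _ => e1 N)‖ ≤ C * y 0 ^ i := by
    intro i
    induction i with
    | zero =>
      intro _
      obtain ⟨C, hC⟩ := hb m (by omega)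
      have hC0 : 0 ≤ C := (norm_nonneg _).trans (hC 0 (by simp))
      refine ⟨C, hC0, fun y hy => ?_⟩
      rw [pow_zero, mul_one]
      refine (ContinuousMultilinearMap.le_opNorm _ _).trans ?_
      simpa [norm_e1] using hC y hy
    | succ i ih =>
      intro hi
      obtain ⟨C, hC0, hC⟩ := ih (by omega)
      refine ⟨C, hC0, fun y hy => ?_⟩
      set j := m - (i + 1) with hj
      have hji : m - i = j + 1 := by omega
      rw [hji] at hC
      have hdiff := hu.differentiableOn_iteratedFDerivWithin (m := j)
        (by norm_cast; omega) hSu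
      set b : Eu N := y - y 0 • e1 N with hbdef
      have hb0 : b 0 = 0 := by simp [hbdef, e1_zero]
      set g : ℝ → ℝ := fun s => iteratedFDerivWithin ℝ j u S (b + s • e1 N) (fun _ => e1 N) with hg
      have hline0 : ∀ s : ℝ, (b + s • e1 N) 0 = s := fun s => by simp [hb0, e1_zero]
      have hder : ∀ s ∈ Icc (0 : ℝ) (y 0), HasDerivWithinAt g
          (iteratedFDerivWithin ℝ (j + 1) u S (b + s • e1 N) (fun _ => e1 N)) (Icc 0 (y 0)) s := by
        intro s hs
        have hmem : b + s • e1 N ∈ S := by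
          change (0 : ℝ) ≤ (b + s • e1 N) 0
          rw [hline0]; exact hs.1
        have h1 := (hdiff _ hmem).hasFDerivWithinAt
        have h2 : HasDerivWithinAt (fun s : ℝ => b + s • e1 N) (e1 N) (Icc 0 (y 0)) s :=
          (hasDerivAt_line b (e1 N) s).hasDerivWithinAt
        have h3 := h1.comp_hasDerivWithinAt s h2 (fun r hr => by
          change (0 : ℝ) ≤ (b + r • e1 N) 0
          rw [hline0]; exact hr.1)
        have h4 := (ContinuousMultilinearMap.apply ℝ (fun _ : Fin j => Eu N) ℝ
          (fun _ => e1 N)).hasFDerivAt.comp_hasDerivWithinAt s h3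
        rw [iteratedFDerivWithin_succ_apply_left]
        exact h4
      have hbound : ∀ s ∈ Ico (0 : ℝ) (y 0),
          ‖iteratedFDerivWithin ℝ (j + 1) u S (b + s • e1 N) (fun _ => e1 N)‖ ≤ C * y 0 ^ i := by
        intro s hs
        have hmem : b + s • e1 N ∈ S := by
          change (0 : ℝ) ≤ (b + s • e1 N) 0
          rw [hline0]; exact hs.1
        refine (hC _ hmem).trans ?_
        rw [hline0]
        have := hs.1
        have := hs.2.le
        gcongr
      have hmv := norm_image_sub_le_of_norm_deriv_le_segment' hder hbound (y 0)
        (right_mem_Icc.2 hy)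
      have hg0 : g 0 = 0 := by
        simp only [hg, zero_smul, add_zero]
        exact hbc j (by omega) b hb0
      have hgy : g (y 0) = iteratedFDerivWithin ℝ j u S y (fun _ => e1 N) := by
        simp [hg, hbdef]
      rw [hg0, hgy, sub_zero, sub_zero] at hmv
      rwa [pow_succ, ← mul_assoc]
  obtain ⟨C, hC0, hC⟩ := key m le_rfl
  refine ⟨C, hC0, fun y hy => ?_⟩
  have := hC y hy
  rw [Nat.sub_self, iteratedFDerivWithin_zero_apply, Real.norm_eq_abs] at this
  exact this

lemma exists_abs_le (hsol : IsBCSol N m q u) :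
    ∃ M : ℝ, 0 < M ∧ ∀ y : Eu N, 0 ≤ y 0 → |u y| ≤ M := by
  obtain ⟨C, hC⟩ := hsol.2.2.1 0 (by omega)
  refine ⟨max C 1, by positivity, fun y hy => le_max_of_le_left ?_⟩
  have := hC y hy
  rwa [norm_iteratedFDerivWithin_zero, Real.norm_eq_abs] at this

end BoundaryDecay

section BoundaryParts

variable {N m : ℕ} [NeZero N] {u F₀ : Eu N → ℝ}

lemma setIntegral_upper_eq {h : Eu N → ℝ} (h0 : ∀ y, y 0 ≤ 0 → h y = 0) :
    ∫ y in upper N, h y = ∫ y, h y :=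
  setIntegral_eq_integral_of_forall_compl_eq_zero fun y hy => h0 y (not_lt.1 hy)

lemma lap_iterate_zero_of_eventuallyEq {f : Eu N → ℝ} {y : Eu N} (h : f =ᶠ[𝓝 y] fun _ => 0)
    (k : ℕ) : lap^[k] f y = 0 := by
  rw [(lap_iterate_congr h k).eq_of_nhds, lap_iterate_zero]

lemma integral_upper_by_parts {C B : ℝ} (hC : 0 ≤ C)
    (hu : ContDiffOn ℝ (2 * m : ℕ) u (upper N))
    (hum : ∀ y : Eu N, 0 ≤ y 0 → |u y| ≤ C * y 0 ^ m)
    (hB : ∀ y ∈ upper N, |lap^[m] u y| ≤ B) (hcont : ContinuousOn (lap^[m] u) (upper N))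
    (hF : ContDiff ℝ ∞ F₀) (hFc : HasCompactSupport F₀) :
    ∫ y in upper N, u y * lap^[m] (fun y => y 0 ^ m * F₀ y) y =
      ∫ y in upper N, lap^[m] u y * (y 0 ^ m * F₀ y) := by
  have hms : MeasurableSet (upper N) := isOpen_upper.measurableSet
  set F : Eu N → ℝ := fun y => y 0 ^ m * F₀ y with hFdef
  have hFs : ContDiff ℝ ∞ F := ((contDiff_coord 0).pow m).mul hF
  have hFcs : HasCompactSupport F := hFc.mul_left
  set η : ℝ → ℝ := fun t => Real.smoothTransition (2 * t - 1) with hη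
  have hηs : ContDiff ℝ ∞ η :=
    Real.smoothTransition.contDiff.comp ((contDiff_const.mul contDiff_id).sub contDiff_const)
  have hη0 : ∀ t, t ≤ 1 / 2 → η t = 0 := fun t ht =>
    Real.smoothTransition.zero_of_nonpos (by linarith)
  have hη1 : ∀ t, 1 ≤ t → η t = 1 := fun t ht => Real.smoothTransition.one_of_one_le (by linarith)
  have hηle : ∀ t, |η t| ≤ 1 := fun t => by
    rw [abs_of_nonneg (Real.smoothTransition.nonneg _)]
    exact Real.smoothTransition.le_one _
  set ζ : ℝ → ℝ := fun t => t ^ m * η t with hζ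
  have hζs : ContDiff ℝ ∞ ζ := (contDiff_id.pow m).mul hηs
  obtain ⟨Cs, hCs0, hCs⟩ := strip_bound m hζs hF hFc
  set δ : ℕ → ℝ := fun n => 1 / ((n : ℝ) + 1) with hδ
  have hδ0 : ∀ n, 0 < δ n := fun n => Nat.one_div_pos_of_nat
  have hδ1 : ∀ n, δ n ≤ 1 := fun n => by
    simp only [hδ]
    rw [div_le_one (by positivity)]
    linarith [Nat.cast_nonneg (α := ℝ) n]
  have hδlim : Tendsto δ atTop (𝓝 0) := tendsto_one_div_add_atTop_nhds_zero_nat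
  set g : ℕ → Eu N → ℝ := fun n y => ζ ((δ n)⁻¹ * y 0) * F₀ y with hg
  have hgs : ∀ n, ContDiff ℝ ∞ (g n) := fun n =>
    (hζs.comp (contDiff_const.mul (contDiff_coord 0))).mul hF
  have hgc : ∀ n, HasCompactSupport (g n) := fun n => hFc.mul_left
  have hg0 : ∀ n y, y 0 ≤ δ n / 2 → g n y = 0 := by
    intro n y hy
    have : (δ n)⁻¹ * y 0 ≤ 1 / 2 := by
      rw [← div_eq_inv_mul, div_le_iff₀ (hδ0 n)]
      linarith
    simp [hg, hζ, hη0 _ this]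
  have hgF : ∀ n y, δ n ^ m * g n y = η ((δ n)⁻¹ * y 0) * F y := by
    intro n y
    have : δ n ^ m * ((δ n)⁻¹ * y 0) ^ m = y 0 ^ m := by
      rw [← mul_pow, mul_inv_cancel_left₀ (hδ0 n).ne']
    simp only [hg, hζ, hFdef]
    linear_combination (η ((δ n)⁻¹ * y 0) * F₀ y) * this
  have hgF1 : ∀ n y, δ n < y 0 → (fun y => δ n ^ m * g n y) =ᶠ[𝓝 y] F := by
    intro n y hy
    have : {z : Eu N | δ n < z 0} ∈ 𝓝 y :=
      (isOpen_lt continuous_const (contDiff_coord (n := 0) 0).continuous).mem_nhds hy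
    filter_upwards [this] with z hz
    rw [hgF, hη1, one_mul]
    rw [← div_eq_inv_mul, le_div_iff₀ (hδ0 n), one_mul]
    exact le_of_lt hz
  have hgz : ∀ n y, y 0 < δ n / 2 → g n =ᶠ[𝓝 y] fun _ => 0 := by
    intro n y hy
    have : {z : Eu N | z 0 < δ n / 2} ∈ 𝓝 y :=
      (isOpen_lt (contDiff_coord (n := 0) 0).continuous continuous_const).mem_nhds hy
    filter_upwards [this] with z hz using hg0 n z (le_of_lt hz)
  have hibp : ∀ n, ∫ y in upper N, u y * (δ n ^ m * lap^[m] (g n) y) =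
      ∫ y in upper N, lap^[m] u y * (δ n ^ m * g n y) := by
    intro n
    have h := integral_mul_lap_iterate_upper (k := m) hu (hgs n) (hgc n) (half_pos (hδ0 n)) (hg0 n)
    have hn := hδ0 n
    rw [← setIntegral_upper_eq, ← setIntegral_upper_eq] at h
    · simp only [mul_left_comm _ (δ n ^ m), integral_const_mul]
      rw [h]
    · intro y hy
      rw [hg0 n y (by linarith), mul_zero]
    · intro y hy
      rw [lap_iterate_zero_of_eventuallyEq (hgz n y (by linarith)), mul_zero]
  have hev : ∀ y ∈ upper N, ∀ᶠ n in atTop, δ n < y 0 := fun y hy =>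
    hδlim.eventually (gt_mem_nhds hy)
  have hucont : ContinuousOn u (upper N) := hu.continuousOn
  have hlap : ∀ n y, δ n < y 0 → δ n ^ m * lap^[m] (g n) y = lap^[m] F y := by
    intro n y hy
    have := (lap_iterate_congr (hgF1 n y hy) m).eq_of_nhds
    rwa [lap_iterate_const_mul (hgs n)] at this
  have lim1 : Tendsto (fun n => ∫ y in upper N, u y * (δ n ^ m * lap^[m] (g n) y)) atTop
      (𝓝 (∫ y in upper N, u y * lap^[m] F y)) := by
    refine tendsto_integral_of_dominated_convergence
      (fun y => (tsupport F₀).indicator (fun _ => C * Cs) y + C * |y 0 ^ m * lap^[m] F y|) ?_ ?_ ?_ ?_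
    · intro n
      exact ((hucont.mul (continuous_const.mul
        (contDiff_lap_iterate (hgs n) m).continuous).continuousOn)).aestronglyMeasurable hms
    · refine Integrable.integrableOn (Integrable.add ?_ (Integrable.const_mul ?_ _))
      · rw [integrable_indicator_iff (isClosed_tsupport _).measurableSet]
        exact integrableOn_const (hFc.isCompact.measure_lt_top.ne)
      · refine Integrable.abs ?_
        exact (((contDiff_coord (n := 0) 0).continuous.pow m).mul
          (contDiff_lap_iterate hFs m).continuous).integrable_of_hasCompactSupport
          (hasCompactSupport_lap_iterate hFcs m).mul_left
    · intro n
      refine (ae_restrict_mem hms).mono fun y hy => ?_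
      have hy0 : 0 < y 0 := hy
      have hi0 : 0 ≤ (tsupport F₀).indicator (fun _ => C * Cs) y :=
        indicator_nonneg (fun _ _ => by positivity) _
      rw [Real.norm_eq_abs, abs_mul]
      rcases le_or_gt (y 0) (δ n) with h | h
      · by_cases hyK : y ∈ tsupport F₀
        · rw [indicator_of_mem hyK]
          refine le_trans ?_ (le_add_of_nonneg_right (by positivity))
          have hs := hCs (δ n) (hδ0 n) (hδ1 n) y hy0 h
          rw [abs_mul, abs_of_nonneg (pow_nonneg (hδ0 n).le m)]
          have hδn := hδ0 n
          calc |u y| * (δ n ^ m * |lap^[m] (g n) y|)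
              ≤ (C * δ n ^ m) * (δ n ^ m * (Cs * (δ n)⁻¹ ^ (2 * m))) := by
                refine mul_le_mul ((hum y hy0.le).trans (by gcongr)) (by gcongr) (by positivity)
                  (by positivity)
            _ = C * Cs * ((δ n * (δ n)⁻¹) ^ (2 * m)) := by ring
            _ = C * Cs := by rw [mul_inv_cancel₀ hδn.ne', one_pow, mul_one]
        · have : g n =ᶠ[𝓝 y] fun _ => 0 := by
            filter_upwards [notMem_tsupport_iff_eventuallyEq.1 hyK] with z hz
            simp [hg, hz]
          rw [lap_iterate_zero_of_eventuallyEq this]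
          simp only [mul_zero, abs_zero]
          positivity
      · rw [hlap n y h]
        refine le_trans ?_ (le_add_of_nonneg_left hi0)
        rw [abs_mul, abs_of_nonneg (pow_nonneg hy0.le m), ← mul_assoc]
        gcongr
        exact hum y hy0.le
    · refine (ae_restrict_mem hms).mono fun y hy => ?_
      refine tendsto_const_nhds.congr' ?_
      filter_upwards [hev y hy] with n hn
      rw [hlap n y hn]
  have lim2 : Tendsto (fun n => ∫ y in upper N, lap^[m] u y * (δ n ^ m * g n y)) atTop
      (𝓝 (∫ y in upper N, lap^[m] u y * F y)) := by
    refine tendsto_integral_of_dominated_convergence (fun y => B * |F y|) ?_ ?_ ?_ ?_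
    · intro n
      exact ((hcont.mul (continuous_const.mul
        (hgs n).continuous).continuousOn)).aestronglyMeasurable hms
    · exact ((hFs.continuous.integrable_of_hasCompactSupport hFcs).abs.const_mul B).integrableOn
    · intro n
      refine (ae_restrict_mem hms).mono fun y hy => ?_
      rw [Real.norm_eq_abs, abs_mul, hgF, abs_mul]
      have hB0 : 0 ≤ B := (abs_nonneg _).trans (hB y hy)
      refine mul_le_mul (hB y hy) ?_ (by positivity) hB0
      exact mul_le_of_le_one_left (abs_nonneg _) (hηle _)
    · refine (ae_restrict_mem hms).mono fun y hy => ?_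
      refine tendsto_const_nhds.congr' ?_
      filter_upwards [hev y hy] with n hn
      rw [hgF, hη1, one_mul]
      rw [← div_eq_inv_mul, le_div_iff₀ (hδ0 n), one_mul]
      exact hn.le
  refine tendsto_nhds_unique lim1 ?_
  simp only [hibp]
  exact lim2

end BoundaryParts

section Limits

/-- Dominated monotone-type convergence: nonnegative minorants converging pointwise, with convergent
integrals. -/
lemma integrable_and_integral_eq_of_minorants {α : Type*} [MeasurableSpace α] {μ : Measure α}
    {h : α → ℝ} {hn : ℕ → α → ℝ} {T : ℝ} (hi : ∀ᶠ n in atTop, Integrable (hn n) μ)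
    (h0 : ∀ᶠ n in atTop, ∀ᵐ y ∂μ, 0 ≤ hn n y) (hle : ∀ᶠ n in atTop, ∀ᵐ y ∂μ, hn n y ≤ h y)
    (hlim : ∀ᵐ y ∂μ, Tendsto (fun n => hn n y) atTop (𝓝 (h y)))
    (hT : Tendsto (fun n => ∫ y, hn n y ∂μ) atTop (𝓝 T)) :
    Integrable h μ ∧ ∫ y, h y ∂μ = T := by
  obtain ⟨n₀, hn₀⟩ := eventually_atTop.1 (hi.and (h0.and hle))
  have hi' : ∀ n, Integrable (hn (n + n₀)) μ := fun n => (hn₀ _ (by omega)).1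
  have h0' : ∀ n, ∀ᵐ y ∂μ, 0 ≤ hn (n + n₀) y := fun n => (hn₀ _ (by omega)).2.1
  have hle' : ∀ n, ∀ᵐ y ∂μ, hn (n + n₀) y ≤ h y := fun n => (hn₀ _ (by omega)).2.2
  have hlim' : ∀ᵐ y ∂μ, Tendsto (fun n => hn (n + n₀) y) atTop (𝓝 (h y)) :=
    hlim.mono fun y hy => hy.comp (tendsto_add_atTop_nat n₀)
  have hT' := hT.comp (tendsto_add_atTop_nat n₀)
  have hm : AEStronglyMeasurable h μ :=
    aestronglyMeasurable_of_tendsto_ae atTop (fun n => (hi' n).aestronglyMeasurable) hlim'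
  have hh0 : ∀ᵐ y ∂μ, 0 ≤ h y := by
    filter_upwards [h0' 0, hle' 0] with y h1 h2 using h1.trans h2
  have hInt : Integrable h μ := by
    refine ⟨hm, ?_⟩
    rw [hasFiniteIntegral_iff_ofReal hh0]
    have e : ∫⁻ y, ENNReal.ofReal (h y) ∂μ =
        ∫⁻ y, liminf (fun n => ENNReal.ofReal (hn (n + n₀) y)) atTop ∂μ := by
      refine lintegral_congr_ae (hlim'.mono fun y hy => ?_)
      exact (((ENNReal.continuous_ofReal.tendsto _).comp hy).liminf_eq).symm
    rw [e]
    refine (lintegral_liminf_le' fun n =>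
      (hi' n).aestronglyMeasurable.aemeasurable.ennreal_ofReal).trans_lt ?_
    have e2 : ∀ n, ∫⁻ y, ENNReal.ofReal (hn (n + n₀) y) ∂μ =
        ENNReal.ofReal (∫ y, hn (n + n₀) y ∂μ) := fun n =>
      (ofReal_integral_eq_lintegral_ofReal (hi' n) (h0' n)).symm
    simp only [e2]
    have hl : liminf (fun n => ENNReal.ofReal (∫ y, hn (n + n₀) y ∂μ)) atTop = ENNReal.ofReal T :=
      ((ENNReal.continuous_ofReal.tendsto _).comp hT').liminf_eq
    rw [hl]
    exact ENNReal.ofReal_lt_top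
  refine ⟨hInt, tendsto_nhds_unique ?_ hT'⟩
  refine tendsto_integral_of_dominated_convergence h (fun n => (hi' n).aestronglyMeasurable) hInt
    (fun n => ?_) hlim'
  filter_upwards [h0' n, hle' n] with y h1 h2
  rwa [Real.norm_eq_abs, abs_of_nonneg h1]

end Limits

section Representation

variable {N m : ℕ} [NeZero N] {u : Eu N → ℝ}

/-- The fixed cutoff function. -/
noncomputable def cutBump (N : ℕ) : ContDiffBump (0 : Eu N) := ⟨2, 3, by norm_num, by norm_num⟩

/-- The cutoff function at scale `R` centered at `b`. -/
noncomputable def cut (b : Eu N) (R : ℝ) (y : Eu N) : ℝ := cutBump N (R⁻¹ • (y - b))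

lemma contDiff_cut (b : Eu N) (R : ℝ) : ContDiff ℝ ∞ (cut b R) :=
  (cutBump N).contDiff.comp ((contDiff_id.sub contDiff_const).const_smul _)

lemma norm_inv_smul {R : ℝ} (hR : 0 < R) (v : Eu N) : ‖R⁻¹ • v‖ = ‖v‖ / R := by
  rw [norm_smul, Real.norm_eq_abs, abs_of_pos (inv_pos.2 hR), div_eq_inv_mul]

lemma cut_eq_one {b y : Eu N} {R : ℝ} (hR : 0 < R) (h : ‖y - b‖ ≤ 2 * R) : cut b R y = 1 := by
  refine (cutBump N).one_of_mem_closedBall ?_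
  rw [mem_closedBall_zero_iff, norm_inv_smul hR, div_le_iff₀ hR]
  exact h

lemma cut_eq_zero {b y : Eu N} {R : ℝ} (hR : 0 < R) (h : 3 * R ≤ ‖y - b‖) : cut b R y = 0 := by
  refine (cutBump N).zero_of_le_dist ?_
  rw [dist_zero_right, norm_inv_smul hR, le_div_iff₀ hR]
  exact h

lemma cut_nonneg (b y : Eu N) (R : ℝ) : 0 ≤ cut b R y := (cutBump N).nonneg

lemma cut_le_one (b y : Eu N) (R : ℝ) : cut b R y ≤ 1 := (cutBump N).le_one

lemma hasCompactSupport_cut (b : Eu N) {R : ℝ} (hR : 0 < R) : HasCompactSupport (cut b R) := by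
  refine HasCompactSupport.intro (isCompact_closedBall b (3 * R)) fun z hz => cut_eq_zero hR ?_
  rw [mem_closedBall_iff_norm, not_le] at hz
  exact hz.le

/-- The foot of `x` on the boundary hyperplane. -/
noncomputable def foot (x : Eu N) : Eu N := x - x 0 • e1 N

lemma foot_zero (x : Eu N) : foot x 0 = 0 := by simp [foot, e1_zero]

lemma cut_mul_rker_eq (hm : 0 < m) {ε R : ℝ} (hε : 0 < ε) {x y : Eu N} (hεx : ε ≤ x 0)
    (hR : 2 * x 0 ≤ R) (hy : 0 ≤ y 0) (hyR : 3 / 2 * R ≤ ‖y - foot x‖) :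
    rker (m - 1) (kap N ε) x y = (R ^ 2) ^ m * (R⁻¹ ^ N * (x 0 * R⁻¹) ^ m) *
      ((4 * (R⁻¹ • (y - foot x)) 0) ^ m * moment (m - 1) (kapOne N)
        (dp ((x 0 * R⁻¹) • e1 N) (R⁻¹ • (y - foot x)))) := by
  have hx0 : 0 < x 0 := hε.trans_le hεx
  have hR0 : 0 < R := by linarith
  set η := R⁻¹ • (y - foot x) with hη
  set s := x 0 * R⁻¹ with hs
  have hη0 : 0 ≤ η 0 := by
    simp only [hη, PiLp.smul_apply, PiLp.sub_apply, foot_zero, sub_zero, smul_eq_mul]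
    positivity
  have hs0 : 0 ≤ s := by positivity
  have hRη : R • η = y - foot x := smul_inv_smul₀ hR0.ne' _
  have hyx : y - x = R • (η - s • e1 N) := by
    rw [smul_sub, hRη, smul_smul, hs, mul_comm (x 0), mul_inv_cancel_left₀ hR0.ne', foot]
    abel
  have hy0 : y 0 = R * η 0 := by
    have := congrArg (fun v : Eu N => v 0) hRη
    simp only [PiLp.smul_apply, PiLp.sub_apply, foot_zero, sub_zero, smul_eq_mul] at this
    exact this.symm
  have hdp : dp x y = R ^ 2 • dp (s • e1 N) η := by
    ext
    · simp [dp, hyx, norm_smul, mul_pow]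
    · simp only [dp, Prod.smul_snd, smul_eq_mul, PiLp.smul_apply, e1_zero, mul_one]
      rw [hy0, hs]
      field_simp
  have h1 : 1 ≤ (dp (s • e1 N) η).1 := by
    have hn : 3 / 2 ≤ ‖η‖ := by
      rw [hη, norm_inv_smul hR0, le_div_iff₀ hR0]
      exact hyR
    have hs1 : ‖s • e1 N‖ ≤ 1 / 2 := by
      rw [norm_smul, norm_e1, mul_one, Real.norm_eq_abs, abs_of_nonneg hs0, hs,
        ← div_eq_mul_inv, div_le_iff₀ hR0]
      linarith
    have : 1 ≤ ‖η - s • e1 N‖ := by linarith [norm_sub_norm_le η (s • e1 N)]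
    simp only [dp]
    nlinarith
  have h2 : (dp (s • e1 N) η).2 = s * (4 * η 0) := by
    simp [dp, e1_zero]
    ring
  have h2' : 0 ≤ (dp (s • e1 N) η).2 := by rw [h2]; positivity
  have hk : ∀ σ, (dp (s • e1 N) η).1 ≤ σ → kap N ε (R ^ 2 * σ) = R⁻¹ ^ N * kapOne N σ := by
    intro σ hσ
    have hσ1 := h1.trans hσ
    have hR2 : ε ^ 2 ≤ R ^ 2 * σ := by
      have : ε ^ 2 ≤ R ^ 2 := by gcongr; linarith
      nlinarith [sq_nonneg R]
    have hi := inv_pow_mul_rpow (N := N) (inv_pos.2 hR0) (σ := σ) (by linarith)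
    rw [inv_inv] at hi
    rw [kap_eq hε hR2, kapOne_eq (by linarith), ← hi, ← mul_assoc, ← mul_pow,
      inv_mul_cancel₀ hR0.ne', one_pow, one_mul]
  rw [rker, hdp, ker_smul, ker_congr (m - 1) h2' hk, ker_const_mul, ker, h2,
    Nat.sub_add_cancel hm, mul_pow s]
  ring

lemma exists_far_bound (hm : 0 < m) {ε : ℝ} (hε : 0 < ε) {x : Eu N} (hεx : ε ≤ x 0) :
    ∃ C : ℝ, 0 ≤ C ∧ ∀ R : ℝ, 2 * x 0 ≤ R → ∀ y ∈ upper N, 2 * R ≤ ‖y - foot x‖ →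
      |lap^[m] (fun y => cut (foot x) R y * rker (m - 1) (kap N ε) x y) y| ≤ C * R⁻¹ ^ (N + m) := by
  have hx0 : 0 < x 0 := hε.trans_le hεx
  set F : ℝ × Eu N → ℝ := fun p => cutBump N p.2 * ((4 * p.2 0) ^ m *
    moment (m - 1) (kapOne N) (dp (p.1 • e1 N) p.2)) with hF
  have hFs : ContDiff ℝ ∞ F := by
    have h1 : ContDiff ℝ ∞ (fun p : ℝ × Eu N => (cutBump N) p.2) :=
      (cutBump N).contDiff.comp contDiff_snd
    have h2 : ContDiff ℝ ∞ (fun p : ℝ × Eu N => p.2 0) := (contDiff_coord 0).comp contDiff_snd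
    have h3 : ContDiff ℝ ∞ (fun p : ℝ × Eu N => dp (p.1 • e1 N) p.2) := by
      refine ContDiff.prodMk ((contDiff_snd.sub (contDiff_fst.smul contDiff_const)).norm_sq ℝ) ?_
      have : ContDiff ℝ ∞ (fun p : ℝ × Eu N => (p.1 • e1 N) 0) :=
        (contDiff_coord 0).comp (contDiff_fst.smul contDiff_const)
      exact (contDiff_const.mul this).mul h2
    exact h1.mul (((contDiff_const.mul h2).pow m).mul ((contDiff_moment _ contDiff_kapOne).comp h3))
  have hFx : ∀ s, ContDiff ℝ ∞ (fun z => F (s, z)) := fun s =>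
    hFs.comp (contDiff_const.prodMk contDiff_id)
  obtain ⟨C, hC⟩ := ((isCompact_Icc (a := (0 : ℝ)) (b := 1)).prod
    (isCompact_closedBall (0 : Eu N) 3)).exists_bound_of_continuousOn
    (contDiff_lap_iterate_param hFs m).continuous.continuousOn
  have hC0 : 0 ≤ C := (norm_nonneg _).trans (hC (0, 0) (by simp))
  refine ⟨C * x 0 ^ m, by positivity, fun R hR y hy hyR => ?_⟩
  have hR0 : 0 < R := by linarith
  rcases le_or_gt ‖y - foot x‖ (3 * R) with h3 | h3
  · set K := (R ^ 2) ^ m * (R⁻¹ ^ N * (x 0 * R⁻¹) ^ m) with hK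
    have hV : IsOpen (upper N ∩ {z | 3 / 2 * R < ‖z - foot x‖}) :=
      isOpen_upper.inter (isOpen_lt continuous_const (by fun_prop))
    have he : EqOn (fun y => cut (foot x) R y * rker (m - 1) (kap N ε) x y)
        (fun y => K * (fun z => F (x 0 * R⁻¹, z)) (R⁻¹ • (y - foot x)))
        (upper N ∩ {z | 3 / 2 * R < ‖z - foot x‖}) := by
      intro z hz
      have := cut_mul_rker_eq hm hε hεx hR (le_of_lt hz.1) (le_of_lt hz.2)
      simp only [hF, cut]
      rw [this]
      ring
    have hyV : y ∈ upper N ∩ {z | 3 / 2 * R < ‖z - foot x‖} :=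
      ⟨hy, by rw [mem_ofPred_eq]; linarith⟩
    have hs : ContDiff ℝ ∞ (fun y : Eu N => (fun z => F (x 0 * R⁻¹, z)) (R⁻¹ • (y - foot x))) :=
      (hFx _).comp ((contDiff_id.sub contDiff_const).const_smul _)
    rw [lap_iterate_eqOn hV he m hyV, lap_iterate_const_mul hs, lap_iterate_comp_affine (hFx _)]
    have hb := hC (x 0 * R⁻¹, R⁻¹ • (y - foot x)) ⟨⟨by positivity, by
      rw [← div_eq_mul_inv, div_le_one hR0]; linarith⟩, by
      rw [mem_closedBall_zero_iff, norm_inv_smul hR0, div_le_iff₀ hR0]; exact h3⟩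
    rw [Real.norm_eq_abs] at hb
    simp only at hb ⊢
    rw [← mul_assoc, abs_mul]
    have hKe : K * R⁻¹ ^ (2 * m) = x 0 ^ m * R⁻¹ ^ (N + m) := by
      have : (R ^ 2) ^ m * R⁻¹ ^ (2 * m) = 1 := by
        rw [← pow_mul, ← mul_pow, mul_inv_cancel₀ hR0.ne', one_pow]
      rw [hK, mul_pow, pow_add]
      linear_combination (R⁻¹ ^ N * (x 0 ^ m * R⁻¹ ^ m)) * this
    rw [hKe, abs_of_nonneg (by positivity)]
    calc x 0 ^ m * R⁻¹ ^ (N + m) * _ ≤ x 0 ^ m * R⁻¹ ^ (N + m) * C := by gcongr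
      _ = C * x 0 ^ m * R⁻¹ ^ (N + m) := by ring
  · have : (fun y => cut (foot x) R y * rker (m - 1) (kap N ε) x y) =ᶠ[𝓝 y] fun _ => 0 := by
      have : {z : Eu N | 3 * R < ‖z - foot x‖} ∈ 𝓝 y :=
        (isOpen_lt continuous_const (by fun_prop)).mem_nhds h3
      filter_upwards [this] with z hz
      rw [cut_eq_zero hR0 (le_of_lt hz), zero_mul]
    rw [lap_iterate_zero_of_eventuallyEq this, abs_zero]
    positivity

end Representation

section Representation

variable {N m : ℕ} [NeZero N] {u : Eu N → ℝ}

lemma integrableOn_upper_mul {v g : Eu N → ℝ} {B : ℝ} (hv : ContinuousOn v (upper N))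
    (hB : ∀ y ∈ upper N, |v y| ≤ B) (hg : Continuous g) (hgc : HasCompactSupport g) :
    IntegrableOn (fun y => v y * g y) (upper N) := by
  have hms : MeasurableSet (upper N) := isOpen_upper.measurableSet
  exact (hg.integrable_of_hasCompactSupport hgc).integrableOn.bdd_mul
    (hv.aestronglyMeasurable hms) ((ae_restrict_iff' hms).2 (Eventually.of_forall hB))

lemma tendsto_truncated (hm : 0 < m) {M : ℝ} (hM : ∀ y ∈ upper N, |u y| ≤ M) (hM0 : 0 ≤ M)
    (hu : ContinuousOn u (upper N)) {Ψ : Eu N → ℝ} (hΨc : Continuous Ψ)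
    (hΨ0 : ∀ z, 1 < ‖z‖ → Ψ z = 0) {ε : ℝ} (hε : 0 < ε) {x : Eu N} (hεx : ε ≤ x 0)
    (hΨ : ∀ y ∈ upper N, lap^[m] (rker (m - 1) (kap N ε) x) y = ε⁻¹ ^ N * Ψ (ε⁻¹ • (y - x))) :
    Tendsto (fun n : ℕ => ∫ y in upper N,
      u y * lap^[m] (fun y => cut (foot x) n y * rker (m - 1) (kap N ε) x y) y) atTop
      (𝓝 (∫ y in upper N, u y * (ε⁻¹ ^ N * Ψ (ε⁻¹ • (y - x))))) := by
  have hx0 : 0 < x 0 := hε.trans_le hεx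
  obtain ⟨C, hC0, hC⟩ := exists_far_bound hm hε hεx
  have hrk : ContDiff ℝ ∞ (rker (m - 1) (kap N ε) x) := contDiff_rker _ (contDiff_kap ε) x
  set G : Eu N → ℝ := fun y => ε⁻¹ ^ N * Ψ (ε⁻¹ • (y - x)) with hG
  have hGc : Continuous G := by fun_prop
  have hG0 : ∀ y, ε < ‖y - x‖ → G y = 0 := fun y hy => by
    rw [hG]
    simp only
    rw [hΨ0 _ (by rw [norm_inv_smul hε, lt_div_iff₀ hε]; linarith), mul_zero]
  have hGs : HasCompactSupport G := by
    refine HasCompactSupport.intro (isCompact_closedBall x ε) fun z hz => hG0 z ?_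
    rw [Metric.mem_closedBall, dist_eq_norm, not_le] at hz
    exact hz
  set A : ℕ → Eu N → ℝ := fun n => lap^[m] (fun y => cut (foot x) n y * rker (m - 1) (kap N ε) x y)
    with hA
  rw [tendsto_iff_norm_sub_tendsto_zero]
  set V := volume.real (Metric.ball (0 : Eu N) 1) with hV
  have hlim : Tendsto (fun n : ℕ => M * C * 3 ^ N * V * (n : ℝ)⁻¹ ^ m) atTop (𝓝 0) := by
    have := (tendsto_inv_atTop_nhds_zero_nat (𝕜 := ℝ)).pow m
    rw [zero_pow hm.ne'] at this
    simpa using this.const_mul (M * C * 3 ^ N * V)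
  refine squeeze_zero' (Eventually.of_forall fun _ => norm_nonneg _) ?_ hlim
  filter_upwards [eventually_ge_atTop (max 1 ⌈2 * x 0⌉₊)] with n hn
  have hnR : 2 * x 0 ≤ n := (Nat.le_ceil _).trans (by exact_mod_cast (le_max_right _ _).trans hn)
  have hn0 : (0 : ℝ) < n := by exact_mod_cast (le_max_left _ _).trans hn
  have hprod : ContDiff ℝ ∞ (fun y => cut (foot x) n y * rker (m - 1) (kap N ε) x y) :=
    (contDiff_cut _ _).mul hrk
  have hAc : Continuous (A n) := (contDiff_lap_iterate hprod m).continuous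
  have hAs : HasCompactSupport (A n) :=
    hasCompactSupport_lap_iterate (hasCompactSupport_cut _ hn0).mul_right m
  rw [← integral_sub (integrableOn_upper_mul hu hM hAc hAs) (integrableOn_upper_mul hu hM hGc hGs)]
  have hxf : ‖x - foot x‖ = x 0 := by
    rw [foot, sub_sub_cancel, norm_smul, norm_e1, mul_one, Real.norm_eq_abs, abs_of_pos hx0]
  have hfar : ∀ y, 2 * (n : ℝ) ≤ ‖y - foot x‖ → G y = 0 := fun y hy => hG0 y (by
    have := norm_sub_le_norm_sub_add_norm_sub y x (foot x)
    rw [hxf] at this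
    linarith)
  have hnear : ∀ y ∈ upper N, ‖y - foot x‖ < 2 * n → A n y = G y := fun y hy h => by
    have : EqOn (fun y => cut (foot x) n y * rker (m - 1) (kap N ε) x y)
        (rker (m - 1) (kap N ε) x) {y | ‖y - foot x‖ < 2 * n} := fun z hz => by
      simp only
      rw [cut_eq_one hn0 (le_of_lt hz), one_mul]
    rw [hA]
    simp only
    rw [lap_iterate_eqOn (isOpen_lt (by fun_prop) continuous_const) this m h, hΨ y hy]
  have hvfar : ∀ y, 3 * (n : ℝ) < ‖y - foot x‖ → A n y = 0 := fun y hy => by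
    refine lap_iterate_zero_of_eventuallyEq ?_ m
    filter_upwards [(isOpen_lt continuous_const (by fun_prop) :
      IsOpen {z : Eu N | 3 * (n : ℝ) < ‖z - foot x‖}).mem_nhds hy] with z hz
    rw [cut_eq_zero hn0 (le_of_lt hz), zero_mul]
  have hms : MeasurableSet (upper N) := isOpen_upper.measurableSet
  rw [setIntegral_eq_of_subset_of_forall_sdiff_eq_zero hms
    (inter_subset_left (t := Metric.closedBall (foot x) (3 * n)))]
  · refine (norm_setIntegral_le_of_norm_le_const (C := M * (C * (n : ℝ)⁻¹ ^ (N + m)))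
      ((measure_mono inter_subset_right).trans_lt measure_closedBall_lt_top) ?_).trans ?_
    · intro y hy
      rw [← mul_sub, norm_mul, Real.norm_eq_abs, Real.norm_eq_abs]
      refine mul_le_mul (hM y hy.1) ?_ (abs_nonneg _) hM0
      rcases lt_or_ge ‖y - foot x‖ (2 * n) with h | h
      · rw [hnear y hy.1 h, sub_self, abs_zero]
        positivity
      · rw [hfar y h, sub_zero]
        exact hC n hnR y hy.1 h
    · have h1 : volume.real (upper N ∩ Metric.closedBall (foot x) (3 * n)) ≤ (3 * n) ^ N * V := by
        have := Measure.addHaar_real_closedBall (volume : Measure (Eu N)) (foot x)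
          (r := 3 * n) (by positivity)
        rw [finrank_euclideanSpace_fin] at this
        rw [← this]
        exact measureReal_mono inter_subset_right measure_closedBall_lt_top.ne
      calc _ ≤ M * (C * (n : ℝ)⁻¹ ^ (N + m)) * ((3 * n) ^ N * V) := by gcongr
        _ = M * C * 3 ^ N * V * (n : ℝ)⁻¹ ^ m * ((n : ℝ)⁻¹ * n) ^ N := by ring
        _ = _ := by rw [inv_mul_cancel₀ hn0.ne', one_pow, mul_one]
  · rintro y ⟨hy, hy2⟩
    have h3 : 3 * (n : ℝ) < ‖y - foot x‖ := by
      by_contra h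
      exact hy2 ⟨hy, by rw [Metric.mem_closedBall, dist_eq_norm]; linarith⟩
    rw [← mul_sub, hfar y (by linarith), hvfar y h3, sub_zero, mul_zero]

lemma integrable_rker_and_integral_eq (hm : 0 < m) {C M B : ℝ} (hC : 0 ≤ C)
    (hu : ContDiffOn ℝ (2 * m : ℕ) u (upper N))
    (hum : ∀ y : Eu N, 0 ≤ y 0 → |u y| ≤ C * y 0 ^ m)
    (hM : ∀ y ∈ upper N, |u y| ≤ M) (hM0 : 0 ≤ M)
    (hB : ∀ y ∈ upper N, |lap^[m] u y| ≤ B) (hcont : ContinuousOn (lap^[m] u) (upper N))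
    (hpos : ∀ y ∈ upper N, 0 ≤ polyLap m u y) {Ψ : Eu N → ℝ} (hΨc : Continuous Ψ)
    (hΨ0 : ∀ z, 1 < ‖z‖ → Ψ z = 0) {ε : ℝ} (hε : 0 < ε) {x : Eu N} (hεx : ε ≤ x 0)
    (hΨ : ∀ y ∈ upper N, lap^[m] (rker (m - 1) (kap N ε) x) y = ε⁻¹ ^ N * Ψ (ε⁻¹ • (y - x))) :
    IntegrableOn (fun y => polyLap m u y * rker (m - 1) (kap N ε) x y) (upper N) ∧
    ∫ y in upper N, polyLap m u y * rker (m - 1) (kap N ε) x y =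
      (-1) ^ m * ∫ y in upper N, u y * (ε⁻¹ ^ N * Ψ (ε⁻¹ • (y - x))) := by
  have hx0 : 0 < x 0 := hε.trans_le hεx
  have hms : MeasurableSet (upper N) := isOpen_upper.measurableSet
  have hrk : ContDiff ℝ ∞ (rker (m - 1) (kap N ε) x) := contDiff_rker _ (contDiff_kap ε) x
  have key : ∀ R : ℝ, 0 < R →
      ∫ y in upper N, polyLap m u y * (cut (foot x) R y * rker (m - 1) (kap N ε) x y) =
      (-1) ^ m * ∫ y in upper N,
        u y * lap^[m] (fun y => cut (foot x) R y * rker (m - 1) (kap N ε) x y) y := by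
    intro R hR
    have := integral_upper_by_parts hC hu hum hB hcont
      (F₀ := fun y => cut (foot x) R y * ((4 * x 0) ^ m * moment (m - 1) (kap N ε) (dp x y)))
      ((contDiff_cut _ _).mul (contDiff_const.mul
        ((contDiff_moment _ (contDiff_kap ε)).comp (contDiff_dp x))))
      (hasCompactSupport_cut _ hR).mul_right
    have e : (fun y : Eu N => y 0 ^ m *
        (cut (foot x) R y * ((4 * x 0) ^ m * moment (m - 1) (kap N ε) (dp x y)))) =
        fun y => cut (foot x) R y * rker (m - 1) (kap N ε) x y := by
      ext y
      rw [rker, ker, Nat.sub_add_cancel hm]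
      simp only [dp, mul_pow]
      ring
    have e' := fun y => congrFun e y
    simp only at e'
    simp only [e'] at this
    rw [this, ← integral_const_mul]
    refine integral_congr_ae (Eventually.of_forall fun y => ?_)
    simp only [polyLap]
    ring
  have hpl : ContinuousOn (polyLap m u) (upper N) := by
    show ContinuousOn (fun y => polyLap m u y) (upper N)
    simp only [polyLap]
    exact continuousOn_const.mul hcont
  have hplB : ∀ y ∈ upper N, |polyLap m u y| ≤ B := fun y hy => by
    rw [polyLap, abs_mul, abs_pow, abs_neg, abs_one, one_pow, one_mul]
    exact hB y hy
  refine integrable_and_integral_eq_of_minorants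
    (hn := fun (n : ℕ) y => polyLap m u y * (cut (foot x) n y * rker (m - 1) (kap N ε) x y))
    ?_ ?_ ?_ ?_ ?_
  · filter_upwards [eventually_ge_atTop 1] with n hn
    exact integrableOn_upper_mul hpl hplB ((contDiff_cut _ _).mul hrk).continuous
      (hasCompactSupport_cut _ (by exact_mod_cast hn)).mul_right
  · refine Eventually.of_forall fun n => (ae_restrict_iff' hms).2 (Eventually.of_forall fun y hy => ?_)
    exact mul_nonneg (hpos y hy) (mul_nonneg (cut_nonneg _ _ _)
      (rker_kap_nonneg _ hε hx0.le (le_of_lt hy)))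
  · refine Eventually.of_forall fun n => (ae_restrict_iff' hms).2 (Eventually.of_forall fun y hy => ?_)
    have := rker_kap_nonneg (m - 1) hε hx0.le (le_of_lt hy)
    exact mul_le_mul_of_nonneg_left (mul_le_of_le_one_left this (cut_le_one _ _ _)) (hpos y hy)
  · refine Eventually.of_forall fun y => tendsto_const_nhds.congr' ?_
    filter_upwards [eventually_ge_atTop (max 1 ⌈‖y - foot x‖⌉₊)] with n hn
    have hnR : ‖y - foot x‖ ≤ n := (Nat.le_ceil _).trans (by exact_mod_cast (le_max_right _ _).trans hn)
    have hn0 : (0 : ℝ) < n := by exact_mod_cast (le_max_left _ _).trans hn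
    rw [cut_eq_one hn0 (by linarith), one_mul]
  · refine ((tendsto_truncated hm hM hM0 hu.continuousOn hΨc hΨ0 hε hεx hΨ).const_mul
      ((-1) ^ m)).congr' ?_
    filter_upwards [eventually_ge_atTop 1] with n hn
    exact (key n (by exact_mod_cast hn)).symm

lemma tendsto_mollified {M : ℝ} (hM : ∀ y ∈ upper N, |u y| ≤ M) (hM0 : 0 ≤ M)
    (hu : ContinuousOn u (upper N)) {Ψ : Eu N → ℝ} (hΨc : Continuous Ψ)
    (hΨ0 : ∀ z, 1 < ‖z‖ → Ψ z = 0) {x : Eu N} (hx : x ∈ upper N) {ε : ℕ → ℝ}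
    (hε : ∀ n, 0 < ε n) (hε0 : Tendsto ε atTop (𝓝 0)) :
    Tendsto (fun n => ∫ y in upper N, u y * ((ε n)⁻¹ ^ N * Ψ ((ε n)⁻¹ • (y - x)))) atTop
      (𝓝 (u x * ∫ z, Ψ z)) := by
  have hms : MeasurableSet (upper N) := isOpen_upper.measurableSet
  set v := (upper N).indicator u with hv
  have hvm : Measurable v := by
    rw [hv, ← piecewise_eq_indicator]
    exact hu.measurable_piecewise continuousOn_const hms
  have hvM : ∀ y, |v y| ≤ M := fun y => by
    by_cases hy : y ∈ upper N
    · rw [hv, indicator_of_mem hy]; exact hM y hy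
    · rw [hv, indicator_of_notMem hy, abs_zero]; exact hM0
  have hΨs : HasCompactSupport Ψ := by
    refine HasCompactSupport.intro (isCompact_closedBall 0 1) fun z hz => hΨ0 z ?_
    rw [mem_closedBall_zero_iff, not_le] at hz
    exact hz
  have e : ∀ n, ∫ y in upper N, u y * ((ε n)⁻¹ ^ N * Ψ ((ε n)⁻¹ • (y - x))) =
      ∫ z, v (x + ε n • z) * Ψ z := by
    intro n
    have h1 := Measure.integral_comp_smul (volume : Measure (Eu N))
      (fun z => v (x + ε n • z) * Ψ z) (ε n)⁻¹
    rw [← integral_sub_right_eq_self _ x, finrank_euclideanSpace_fin, abs_of_pos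
      (by have := hε n; positivity), smul_eq_mul] at h1
    have h2 : ∫ z, v (x + ε n • z) * Ψ z = (ε n)⁻¹ ^ N *
        ∫ y, v (x + ε n • (ε n)⁻¹ • (y - x)) * Ψ ((ε n)⁻¹ • (y - x)) := by
      rw [h1, mul_inv_cancel_left₀ (by have := hε n; positivity)]
    rw [h2, ← integral_indicator hms, ← integral_const_mul]
    refine integral_congr_ae (Eventually.of_forall fun y => ?_)
    simp only
    rw [smul_inv_smul₀ (hε n).ne', add_sub_cancel]
    by_cases hy : y ∈ upper N
    · rw [hv, indicator_of_mem hy, indicator_of_mem hy]; ring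
    · rw [hv, indicator_of_notMem hy, indicator_of_notMem hy]; ring
  simp only [e]
  rw [← integral_const_mul]
  refine tendsto_integral_of_dominated_convergence (fun z => M * |Ψ z|) (fun n => ?_) ?_
    (fun n => Eventually.of_forall fun z => ?_) (Eventually.of_forall fun z => ?_)
  · exact ((hvm.comp (by fun_prop)).mul hΨc.measurable).aestronglyMeasurable
  · exact (hΨc.integrable_of_hasCompactSupport hΨs).abs.const_mul M
  · rw [norm_mul, Real.norm_eq_abs, Real.norm_eq_abs]
    exact mul_le_mul_of_nonneg_right (hvM _) (abs_nonneg _)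
  · refine Tendsto.mul_const _ ?_
    have hvx : v =ᶠ[𝓝 x] u := by
      filter_upwards [isOpen_upper.mem_nhds hx] with y hy
      exact indicator_of_mem (s := upper N) hy u
    have hvc : ContinuousAt v x := (hu.continuousAt (isOpen_upper.mem_nhds hx)).congr hvx.symm
    have : Tendsto (fun n => x + ε n • z) atTop (𝓝 x) := by
      simpa using (hε0.smul_const z).const_add x
    rw [← hvx.eq_of_nhds]
    exact hvc.tendsto.comp this

/-- The Green representation formula in the half-space, up to a universal constant. -/
lemma exists_green_representation {q : ℝ} (hm : 0 < m) (hsol : IsBCSol N m q u) (hq : 0 < q)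
    (hpos : ∀ x : Eu N, 0 ≤ x 0 → 0 ≤ u x) :
    ∃ c : ℝ, ∀ x ∈ upper N, IntegrableOn (fun y => green m x y * u y ^ q) (upper N) ∧
      ∫ y in upper N, green m x y * u y ^ q = c * u x := by
  have hms : MeasurableSet (upper N) := isOpen_upper.measurableSet
  obtain ⟨C, hC, hum⟩ := exists_abs_le_pow hm hsol
  obtain ⟨M, hM0, hM⟩ := exists_abs_le hsol
  obtain ⟨Ψ, hΨc, hΨ0, hΨ⟩ := exists_lap_iterate_kap (N := N) m hm
  have hpl : ∀ y ∈ upper N, polyLap m u y = u y ^ q := hsol.2.2.2.1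
  have hlap : ∀ y ∈ upper N, lap^[m] u y = (-1) ^ m * u y ^ q := fun y hy => by
    rw [← hpl y hy, polyLap, ← mul_assoc, ← mul_pow]
    norm_num
  have huc : ContinuousOn u (upper N) := hsol.1.continuousOn
  have hqc : ContinuousOn (fun y => u y ^ q) (upper N) := huc.rpow_const fun y _ => Or.inr hq.le
  have hcont : ContinuousOn (lap^[m] u) (upper N) :=
    (continuousOn_const.mul hqc).congr hlap
  have hB : ∀ y ∈ upper N, |lap^[m] u y| ≤ M ^ q := fun y hy => by
    have hy' : 0 ≤ y 0 := le_of_lt hy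
    rw [hlap y hy, abs_mul, abs_pow, abs_neg, abs_one, one_pow, one_mul,
      abs_of_nonneg (Real.rpow_nonneg (hpos y hy') _)]
    exact Real.rpow_le_rpow (hpos y hy') ((le_abs_self _).trans (hM y hy')) hq.le
  refine ⟨(-1) ^ m * ∫ z, Ψ z, fun x hx => ?_⟩
  have hx0 : 0 < x 0 := hx
  set ε : ℕ → ℝ := fun n => x 0 / ((n : ℝ) + 1) with hεdef
  have hε : ∀ n, 0 < ε n := fun n => by positivity
  have hεx : ∀ n, ε n ≤ x 0 := fun n =>
    div_le_self hx0.le (by linarith [(Nat.cast_nonneg n : (0 : ℝ) ≤ n)])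
  have hε0 : Tendsto ε atTop (𝓝 0) := by
    have := (tendsto_one_div_add_atTop_nhds_zero_nat (𝕜 := ℝ)).const_mul (x 0)
    simpa [hεdef, div_eq_mul_inv] using this
  have hM' : ∀ y ∈ upper N, |u y| ≤ M := fun y hy => hM y (le_of_lt hy)
  have hrep := fun n => integrable_rker_and_integral_eq hm hC hsol.1 hum hM' hM0.le hB hcont
    (fun y hy => by rw [hpl y hy]; exact Real.rpow_nonneg (hpos y (le_of_lt hy)) _)
    hΨc hΨ0 (hε n) (hεx n) (hΨ (ε n) x (hε n) (hεx n))
  have hne : ∀ᵐ y ∂(volume.restrict (upper N)), y ≠ x :=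
    ae_restrict_of_ae (by simp [ae_iff, measure_singleton])
  have hmem : ∀ᵐ y ∂(volume.restrict (upper N)), y ∈ upper N := ae_restrict_mem hms
  refine integrable_and_integral_eq_of_minorants
    (hn := fun n y => polyLap m u y * rker (m - 1) (kap N (ε n)) x y)
    (Eventually.of_forall fun n => (hrep n).1) ?_ ?_ ?_ ?_
  · refine Eventually.of_forall fun n => ?_
    filter_upwards [hmem] with y hy
    rw [hpl y hy]
    exact mul_nonneg (Real.rpow_nonneg (hpos y (le_of_lt hy)) _)
      (rker_kap_nonneg _ (hε n) hx0.le (le_of_lt hy))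
  · refine Eventually.of_forall fun n => ?_
    filter_upwards [hmem, hne] with y hy hyx
    rw [hpl y hy, mul_comm]
    exact mul_le_mul_of_nonneg_right (rker_kap_le_green m (hε n) hx0.le (le_of_lt hy) hyx)
      (Real.rpow_nonneg (hpos y (le_of_lt hy)) _)
  · filter_upwards [hmem, hne] with y hy hyx
    refine tendsto_const_nhds.congr' ?_
    filter_upwards [hε0.eventually (gt_mem_nhds (norm_pos_iff.2 (sub_ne_zero.2 hyx)))] with n hn
    rw [hpl y hy, rker_kap_eq_green m (hε n) hx0.le (le_of_lt hy) hn.le, mul_comm]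
  · have := (tendsto_mollified hM' hM0.le huc hΨc hΨ0 hx hε hε0).const_mul ((-1) ^ m)
    rw [show (-1) ^ m * (∫ z, Ψ z) * u x = (-1) ^ m * (u x * ∫ z, Ψ z) by ring]
    exact this.congr fun n => (hrep n).2.symm

end Representation

section Kernel

/-- The Green function as a function of the squared distance and the product of the heights. -/
noncomputable def gk (m N : ℕ) (d P : ℝ) : ℝ :=
  ∫ τ in (0 : ℝ)..(4 * P), τ ^ (m - 1) * (d + τ) ^ (-(N / 2 : ℝ))

variable {m N : ℕ}

lemma green_eq_gk [NeZero N] (x y : Eu N) : green m x y = gk m N (‖y - x‖ ^ 2) (x 0 * y 0) := by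
  rw [green, gk, mul_assoc]

lemma gk_integrable {d : ℝ} (hd : 0 < d) {a b : ℝ} (ha : 0 ≤ a) (hb : 0 ≤ b) :
    IntervalIntegrable (fun τ => τ ^ (m - 1) * (d + τ) ^ (-(N / 2 : ℝ))) volume a b := by
  refine ContinuousOn.intervalIntegrable ?_
  refine (continuous_pow _).continuousOn.mul
    ((continuous_const.add continuous_id).continuousOn.rpow_const fun τ hτ => Or.inl ?_)
  have : 0 ≤ τ := (le_min ha hb).trans hτ.1
  exact (by positivity : (0 : ℝ) < d + τ).ne'

lemma gk_sub {d : ℝ} (hd : 0 < d) {P Q : ℝ} (hP : 0 ≤ P) (hQ : 0 ≤ Q) :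
    gk m N d P - gk m N d Q =
      ∫ τ in (4 * Q)..(4 * P), τ ^ (m - 1) * (d + τ) ^ (-(N / 2 : ℝ)) :=
  intervalIntegral.integral_interval_sub_left (gk_integrable hd le_rfl (by positivity))
    (gk_integrable hd le_rfl (by positivity))

lemma gk_smul (hm : 0 < m) {k d P : ℝ} (hk : 0 < k) (hd : 0 ≤ d) (hP : 0 ≤ P) :
    gk m N (k * d) (k * P) = k ^ ((m : ℝ) - N / 2) * gk m N d P := by
  rw [gk, gk, show 4 * (k * P) = k * (4 * P) by ring]
  conv_lhs => rw [show (0 : ℝ) = k * 0 by ring]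
  rw [← intervalIntegral.mul_integral_comp_mul_left, ← intervalIntegral.integral_const_mul,
    ← intervalIntegral.integral_const_mul]
  refine intervalIntegral.integral_congr fun τ hτ => ?_
  rw [uIcc_of_le (by positivity)] at hτ
  have hτ0 := hτ.1
  rw [← mul_add, Real.mul_rpow hk.le (by positivity), mul_pow, sub_eq_add_neg,
    Real.rpow_add hk, Real.rpow_natCast]
  obtain ⟨j, rfl⟩ : ∃ j, m = j + 1 := ⟨m - 1, by omega⟩
  rw [Nat.add_sub_cancel, pow_succ k]
  ring

lemma gk_mono {d d' P P' : ℝ} (hd : 0 < d) (hdd : d ≤ d') (hP' : 0 ≤ P') (hPP : P' ≤ P) :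
    gk m N d' P' ≤ gk m N d P := by
  have h1 : gk m N d' P' ≤ gk m N d P' := by
    refine intervalIntegral.integral_mono_on (by positivity)
      (gk_integrable (hd.trans_le hdd) le_rfl (by positivity))
      (gk_integrable hd le_rfl (by positivity)) fun τ hτ => ?_
    have := hτ.1
    exact mul_le_mul_of_nonneg_left
      (Real.rpow_le_rpow_of_nonpos (by positivity) (by linarith) (by simp; positivity))
      (by positivity)
  have h2 : 0 ≤ gk m N d P - gk m N d P' := by
    rw [gk_sub hd (hP'.trans hPP) hP']
    refine intervalIntegral.integral_nonneg (by linarith) fun τ hτ => ?_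
    have : 0 ≤ τ := (by positivity : (0 : ℝ) ≤ 4 * P').trans hτ.1
    positivity
  linarith

lemma gk_lt {d P P' : ℝ} (hd : 0 < d) (hP' : 0 ≤ P') (hPP : P' < P) :
    gk m N d P' < gk m N d P := by
  have h2 : 0 < gk m N d P - gk m N d P' := by
    rw [gk_sub hd (hP'.trans hPP.le) hP']
    refine intervalIntegral.intervalIntegral_pos_of_pos_on
      (gk_integrable hd (by positivity) (by linarith)) (fun τ hτ => ?_) (by linarith)
    have : 0 < τ := lt_of_le_of_lt (by positivity : (0 : ℝ) ≤ 4 * P') hτ.1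
    positivity
  linarith

lemma gk_nonneg {d P : ℝ} (hd : 0 ≤ d) (hP : 0 ≤ P) : 0 ≤ gk m N d P := by
  refine intervalIntegral.integral_nonneg (by positivity) fun τ hτ => ?_
  have := hτ.1
  positivity

lemma gk_pos {d P : ℝ} (hd : 0 < d) (hP : 0 < P) : 0 < gk m N d P := by
  have := gk_lt (m := m) (N := N) hd le_rfl hP
  rwa [show gk m N d 0 = 0 by simp [gk]] at this

lemma gk_le [NeZero N] {d P Q : ℝ} (hd : 0 < d) (hP : 0 ≤ P) (hPQ : P ≤ Q) :
    gk m N d P ≤ (4 * Q) ^ (m - 1) * (2 * (4 * Q) ^ (1 / 2 : ℝ)) * d ^ (-((N - 1) / 2 : ℝ)) := by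
  have hQ : 0 ≤ Q := hP.trans hPQ
  have hN : (1 : ℝ) ≤ N := by exact_mod_cast Nat.one_le_iff_ne_zero.2 (NeZero.ne N)
  have hi : IntervalIntegrable (fun τ : ℝ => τ ^ (-(1 / 2) : ℝ)) volume 0 (4 * Q) :=
    intervalIntegral.intervalIntegrable_rpow' (by norm_num)
  have h1 : gk m N d Q ≤ ∫ τ in (0 : ℝ)..(4 * Q),
      (4 * Q) ^ (m - 1) * d ^ (-((N - 1) / 2 : ℝ)) * τ ^ (-(1 / 2) : ℝ) := by
    refine intervalIntegral.integral_mono_on_of_le_Ioo (by positivity)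
      (gk_integrable hd le_rfl (by positivity)) (hi.const_mul _) fun τ hτ => ?_
    have hτ0 : 0 < τ := hτ.1
    have e : (d + τ) ^ (-(N / 2 : ℝ)) = (d + τ) ^ (-((N - 1) / 2 : ℝ)) * (d + τ) ^ (-(1 / 2) : ℝ) := by
      rw [← Real.rpow_add (by positivity)]
      congr 1
      ring
    rw [e, mul_assoc]
    have h2 : (d + τ) ^ (-((N - 1) / 2 : ℝ)) ≤ d ^ (-((N - 1) / 2 : ℝ)) :=
      Real.rpow_le_rpow_of_nonpos hd (by linarith) (by linarith)
    have h3 : (d + τ) ^ (-(1 / 2) : ℝ) ≤ τ ^ (-(1 / 2) : ℝ) :=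
      Real.rpow_le_rpow_of_nonpos hτ0 (by linarith) (by norm_num)
    have h4 : τ ^ (m - 1) ≤ (4 * Q) ^ (m - 1) := pow_le_pow_left₀ hτ0.le hτ.2.le _
    gcongr
  have h2 : gk m N d P ≤ gk m N d Q := gk_mono hd le_rfl hP hPQ
  refine h2.trans (h1.trans_eq ?_)
  rw [intervalIntegral.integral_const_mul, integral_rpow (Or.inl (by norm_num)),
    show (-(1 / 2) + 1 : ℝ) = 1 / 2 by norm_num, Real.zero_rpow (by norm_num)]
  ring

/-- The key positivity of the combination of Green functions in the method of moving spheres. -/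
lemma gk_rearrange {d d' a b α β : ℝ} (hd : 0 < d) (hdd : d ≤ d') (ha : 0 < a) (hb : 0 < b)
    (haα : a < α) (hbβ : b < β) :
    0 < gk m N d (α * β) - gk m N d' (a * β) + (gk m N d' (α * b) - gk m N d (a * b)) := by
  have hα := ha.trans haα
  have hβ := hb.trans hbβ
  rcases le_or_gt (a * β) (α * b) with h | h
  · have h1 : gk m N d' (a * β) ≤ gk m N d' (α * b) := gk_mono (hd.trans_le hdd) le_rfl (by positivity) h
    have h2 : gk m N d (a * b) < gk m N d (α * β) := gk_lt hd (by positivity) (by nlinarith)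
    linarith
  · have h1 : gk m N d' (a * β) - gk m N d' (α * b) ≤ gk m N d (a * β) - gk m N d (α * b) := by
      rw [gk_sub (hd.trans_le hdd) (by positivity) (by positivity),
        gk_sub hd (by positivity) (by positivity)]
      refine intervalIntegral.integral_mono_on (by linarith)
        (gk_integrable (hd.trans_le hdd) (by positivity) (by positivity))
        (gk_integrable hd (by positivity) (by positivity)) fun τ hτ => ?_
      have : 0 ≤ τ := (by positivity : (0 : ℝ) ≤ 4 * (α * b)).trans hτ.1
      exact mul_le_mul_of_nonneg_left
        (Real.rpow_le_rpow_of_nonpos (by positivity) (by linarith) (by simp; positivity))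
        (by positivity)
    have h2 : gk m N d (a * b) < gk m N d (α * b) := gk_lt hd (by positivity) (by nlinarith)
    have h3 : gk m N d (a * β) < gk m N d (α * β) := gk_lt hd (by positivity) (by nlinarith)
    linarith

end Kernel

section Inversion

open EuclideanGeometry

variable {m N : ℕ} [NeZero N]

/-- The conformal factor of the inversion. -/
noncomputable def cf (b : Eu N) (l : ℝ) (x : Eu N) : ℝ := (l / ‖x - b‖) ^ 2

/-- The rescaled height of the inverted point. -/
noncomputable def ht (b : Eu N) (l : ℝ) (x : Eu N) : ℝ := x 0 + 1 - ‖x - b‖ ^ 2 / l ^ 2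

lemma inversion_sub (b : Eu N) (l : ℝ) (x : Eu N) : inversion b l x - b = cf b l x • (x - b) := by
  rw [inversion, cf, dist_eq_norm, vsub_eq_sub, vadd_eq_add, add_sub_cancel_right]

lemma coord_zero_le_norm {b x : Eu N} (hb : b 0 = -1) :
    x 0 + 1 ≤ ‖x - b‖ := by
  have h := EuclideanSpace.norm_eq (x - b) ▸ Real.le_sqrt_of_sq_le
    (Finset.single_le_sum (f := fun i => ‖(x - b) i‖ ^ 2) (fun i _ => sq_nonneg _)
      (Finset.mem_univ 0))
  simp only [PiLp.sub_apply, hb, Real.norm_eq_abs] at h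
  have := (le_abs_self _).trans h
  linarith

lemma one_lt_norm_sub {b x : Eu N} (hb : b 0 = -1) (hx : x ∈ upper N) : 1 < ‖x - b‖ := by
  have h1 := coord_zero_le_norm (x := x) hb
  have h2 : 0 < x 0 := hx
  linarith

lemma cf_pos {b x : Eu N} {l : ℝ} (hb : b 0 = -1) (hl : 0 < l) (hx : x ∈ upper N) :
    0 < cf b l x := by
  have := one_lt_norm_sub hb hx
  have : 0 < ‖x - b‖ := by linarith
  rw [cf]
  positivity

lemma inversion_zero {b x : Eu N} {l : ℝ} (hb : b 0 = -1) (hl : 0 < l) (hx : x ∈ upper N) :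
    inversion b l x 0 = cf b l x * ht b l x := by
  have := congrArg (fun v : Eu N => v 0) (inversion_sub b l x)
  simp only [PiLp.sub_apply, PiLp.smul_apply, smul_eq_mul, hb] at this
  have h1 := one_lt_norm_sub hb hx
  have h2 : ‖x - b‖ ≠ 0 := by linarith
  have h3 : cf b l x * (‖x - b‖ ^ 2 / l ^ 2) = 1 := by
    rw [cf]
    field_simp
  rw [ht]
  linear_combination this + h3

lemma le_ht {b x : Eu N} {l : ℝ} (hl : 0 < l) (h : ‖x - b‖ ≤ l) : x 0 ≤ ht b l x := by
  have : ‖x - b‖ ^ 2 / l ^ 2 ≤ 1 := (div_le_one (by positivity)).2 (by gcongr)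
  rw [ht]
  linarith

lemma lt_ht {b x : Eu N} {l : ℝ} (hl : 0 < l) (h : ‖x - b‖ < l) : x 0 < ht b l x := by
  have : ‖x - b‖ ^ 2 / l ^ 2 < 1 := (div_lt_one (by positivity)).2 (by gcongr)
  rw [ht]
  linarith

/-- The rescaled squared distance between a point and an inverted point. -/
noncomputable def crossDist (b : Eu N) (l : ℝ) (x y : Eu N) : ℝ :=
  ‖y - x‖ ^ 2 + (l ^ 2 - ‖x - b‖ ^ 2) * (l ^ 2 - ‖y - b‖ ^ 2) / l ^ 2

lemma crossDist_comm (b : Eu N) (l : ℝ) (x y : Eu N) : crossDist b l x y = crossDist b l y x := by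
  rw [crossDist, crossDist, norm_sub_rev]
  ring

lemma norm_inversion_sub_sq {b x y : Eu N} {l : ℝ} (hl : 0 < l) (hy : y ≠ b) :
    ‖inversion b l y - x‖ ^ 2 = cf b l y * crossDist b l x y := by
  have h0 : ‖y - b‖ ≠ 0 := norm_ne_zero_iff.2 (sub_ne_zero.2 hy)
  have e1 : inversion b l y - x = cf b l y • (y - b) - (x - b) := by
    rw [← inversion_sub]; abel
  have e2 : y - x = (y - b) - (x - b) := by abel
  rw [e1, crossDist, e2]
  generalize x - b = w
  rw [cf] at *
  generalize y - b = v at *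
  rw [norm_sub_sq_real, norm_sub_sq_real, norm_smul, real_inner_smul_left, Real.norm_eq_abs, mul_pow, sq_abs]
  field_simp
  ring

lemma norm_inversion_sub_inversion_sq {b x y : Eu N} (l : ℝ) (hx : x ≠ b) (hy : y ≠ b) :
    ‖inversion b l y - inversion b l x‖ ^ 2 = cf b l x * cf b l y * ‖y - x‖ ^ 2 := by
  rw [← dist_eq_norm, dist_inversion_inversion hy hx, cf, cf, dist_eq_norm, dist_eq_norm,
    dist_eq_norm]
  have h0 : ‖y - b‖ ≠ 0 := norm_ne_zero_iff.2 (sub_ne_zero.2 hy)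
  have h1 : ‖x - b‖ ≠ 0 := norm_ne_zero_iff.2 (sub_ne_zero.2 hx)
  field_simp

lemma ne_of_mem_upper {b x : Eu N} (hb : b 0 = -1) (hx : x ∈ upper N) : x ≠ b := by
  rintro rfl
  have : 0 < x 0 := hx
  linarith

lemma green_inversion_inversion (hm : 0 < m) {b x y : Eu N} {l : ℝ} (hb : b 0 = -1) (hl : 0 < l)
    (hx : x ∈ upper N) (hy : y ∈ upper N) (hhx : 0 ≤ ht b l x) (hhy : 0 ≤ ht b l y) :
    green m (inversion b l x) (inversion b l y) =
      cf b l x ^ ((m : ℝ) - N / 2) * cf b l y ^ ((m : ℝ) - N / 2) *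
        gk m N (‖y - x‖ ^ 2) (ht b l x * ht b l y) := by
  have h1 := cf_pos hb hl hx
  have h2 := cf_pos hb hl hy
  rw [green_eq_gk, norm_inversion_sub_inversion_sq l (ne_of_mem_upper hb hx) (ne_of_mem_upper hb hy),
    inversion_zero hb hl hx, inversion_zero hb hl hy,
    show cf b l x * ht b l x * (cf b l y * ht b l y) =
      cf b l x * cf b l y * (ht b l x * ht b l y) by ring,
    gk_smul hm (by positivity) (by positivity) (by positivity), Real.mul_rpow h1.le h2.le]

lemma crossDist_nonneg {b x y : Eu N} {l : ℝ} (hb : b 0 = -1) (hl : 0 < l) (hy : y ∈ upper N) :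
    0 ≤ crossDist b l x y := by
  have h1 := cf_pos hb hl hy
  have := norm_inversion_sub_sq (x := x) hl (ne_of_mem_upper hb hy)
  nlinarith [sq_nonneg ‖inversion b l y - x‖]

lemma green_inversion_right (hm : 0 < m) {b x y : Eu N} {l : ℝ} (hb : b 0 = -1) (hl : 0 < l)
    (hx : 0 ≤ x 0) (hy : y ∈ upper N) (hhy : 0 ≤ ht b l y) :
    green m x (inversion b l y) =
      cf b l y ^ ((m : ℝ) - N / 2) * gk m N (crossDist b l x y) (x 0 * ht b l y) := by
  have h2 := cf_pos hb hl hy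
  rw [green_eq_gk, norm_inversion_sub_sq hl (ne_of_mem_upper hb hy), inversion_zero hb hl hy,
    show x 0 * (cf b l y * ht b l y) = cf b l y * (x 0 * ht b l y) by ring,
    gk_smul hm h2 (crossDist_nonneg hb hl hy) (by positivity)]

lemma green_inversion_left (hm : 0 < m) {b x y : Eu N} {l : ℝ} (hb : b 0 = -1) (hl : 0 < l)
    (hx : x ∈ upper N) (hy : 0 ≤ y 0) (hhx : 0 ≤ ht b l x) :
    green m (inversion b l x) y =
      cf b l x ^ ((m : ℝ) - N / 2) * gk m N (crossDist b l x y) (ht b l x * y 0) := by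
  have h := green_inversion_right hm hb hl hy hx hhx
  have hs : green m (inversion b l x) y = green m y (inversion b l x) := by
    rw [green_eq_gk, green_eq_gk, norm_sub_rev, mul_comm (y 0)]
  rw [hs, h, crossDist_comm, mul_comm (y 0)]

lemma abs_det_reflection_smul (c : ℝ) (K : Submodule ℝ (Eu N)) :
    |(c • (K.reflection : Eu N →L[ℝ] Eu N)).det| = |c| ^ N := by
  change |LinearMap.det (c • K.reflection.toLinearMap)| = _
  rw [LinearMap.det_smul, Submodule.det_reflection, abs_mul, abs_pow,
    abs_pow, abs_neg, abs_one, one_pow, mul_one, finrank_euclideanSpace_fin]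

end Inversion

section Comparison

variable {m N : ℕ} [NeZero N] {b : Eu N} {l q : ℝ} {u : Eu N → ℝ}

/-- The part of the half-space inside the sphere of inversion. -/
def cap (b : Eu N) (l : ℝ) : Set (Eu N) := upper N ∩ {x | ‖x - b‖ < l}

/-- The conformal transform of `u` under the inversion. -/
noncomputable def kelvin (m : ℕ) (b : Eu N) (l : ℝ) (u : Eu N → ℝ) (x : Eu N) : ℝ :=
  cf b l x ^ ((N : ℝ) / 2 - m) * u (inversion b l x)

lemma isOpen_cap (b : Eu N) (l : ℝ) : IsOpen (cap b l) :=
  isOpen_upper.inter (isOpen_lt (by fun_prop) continuous_const)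

lemma one_le_cf {x : Eu N} (hb : b 0 = -1) (hx : x ∈ upper N) (h : ‖x - b‖ ≤ l) :
    1 ≤ cf b l x := by
  have h1 := one_lt_norm_sub hb hx
  have h2 : 0 < ‖x - b‖ := by linarith
  rw [cf]
  exact one_le_pow₀ ((one_le_div h2).2 h)

lemma inversion_mem_upper {x : Eu N} (hb : b 0 = -1) (hl : 0 < l) (hx : x ∈ upper N)
    (h : ‖x - b‖ ≤ l) : inversion b l x ∈ upper N := by
  have h1 : 0 < x 0 := hx
  show 0 < inversion b l x 0
  rw [inversion_zero hb hl hx]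
  exact mul_pos (cf_pos hb hl hx) (h1.trans_le (le_ht hl h))

lemma le_norm_inversion_sub {x : Eu N} (hb : b 0 = -1) (hl : 0 < l) (hx : x ∈ upper N)
    (h : ‖x - b‖ ≤ l) : l ≤ ‖inversion b l x - b‖ := by
  have h1 := one_lt_norm_sub hb hx
  have h2 : 0 < ‖x - b‖ := by linarith
  rw [← dist_eq_norm, dist_inversion_center, dist_eq_norm, le_div_iff₀ h2]
  nlinarith

lemma integral_upper_split (hb : b 0 = -1) (hl : 0 < l) {h : Eu N → ℝ}
    (hi : IntegrableOn h (upper N)) :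
    IntegrableOn (fun y => cf b l y ^ N * h (inversion b l y)) (cap b l) ∧
    ∫ y in upper N, h y = (∫ y in cap b l, h y) +
      (∫ y in cap b l, cf b l y ^ N * h (inversion b l y)) +
      ∫ y in upper N \ (cap b l ∪ inversion b l '' cap b l), h y := by
  have hms : MeasurableSet (cap b l) := (isOpen_cap b l).measurableSet
  have hinj : InjOn (inversion b l) (cap b l) := (inversion_injective b hl.ne').injOn
  have hder : ∀ y ∈ cap b l, HasFDerivWithinAt (inversion b l)
      ((l / dist y b) ^ 2 • ((Submodule.span ℝ {y - b})ᗮ.reflection : Eu N →L[ℝ] Eu N))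
      (cap b l) y := fun y hy =>
    (hasFDerivAt_inversion (ne_of_mem_upper hb hy.1)).hasFDerivWithinAt
  have hdet : ∀ y, |((l / dist y b) ^ 2 •
      ((Submodule.span ℝ {y - b})ᗮ.reflection : Eu N →L[ℝ] Eu N)).det| = cf b l y ^ N := by
    intro y
    rw [abs_det_reflection_smul, abs_of_nonneg (sq_nonneg _), cf, dist_eq_norm]
  have himm : MeasurableSet (inversion b l '' cap b l) :=
    hms.image_of_continuousOn_injOn (fun y hy => (hder y hy).continuousWithinAt) hinj
  have hsub : inversion b l '' cap b l ⊆ upper N := by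
    rintro _ ⟨y, hy, rfl⟩
    exact inversion_mem_upper hb hl hy.1 (le_of_lt hy.2)
  have hdisj : Disjoint (cap b l) (inversion b l '' cap b l) := by
    rw [disjoint_left]
    rintro _ hz ⟨y, hy, rfl⟩
    exact absurd hz.2 (not_lt.2 (le_norm_inversion_sub hb hl hy.1 (le_of_lt hy.2)))
  have hi1 : IntegrableOn h (cap b l) := hi.mono_set inter_subset_left
  have hi2 : IntegrableOn h (inversion b l '' cap b l) := hi.mono_set hsub
  constructor
  · have := (integrableOn_image_iff_integrableOn_abs_det_fderiv_smul volume hms hder hinj h).1 hi2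
    simpa only [hdet, smul_eq_mul] using this
  · have hch := integral_image_eq_integral_abs_det_fderiv_smul volume hms hder hinj h
    simp only [hdet, smul_eq_mul] at hch
    rw [← hch, ← setIntegral_union hdisj himm hi1 hi2]
    have hsub' : cap b l ∪ inversion b l '' cap b l ⊆ upper N := union_subset inter_subset_left hsub
    have := (integral_inter_add_sdiff (hms.union himm) hi).symm
    rwa [inter_eq_self_of_subset_right hsub'] at this

/-- The integrand comparing `u` and its conformal transform. -/
noncomputable def cmp (m : ℕ) (b : Eu N) (l q : ℝ) (u : Eu N → ℝ) (x y : Eu N) : ℝ :=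
  (gk m N (‖y - x‖ ^ 2) (ht b l x * ht b l y) - gk m N (crossDist b l x y) (x 0 * ht b l y)) *
    (cf b l y ^ ((N : ℝ) / 2 + m) * u (inversion b l y) ^ q) +
  (gk m N (crossDist b l x y) (ht b l x * y 0) - gk m N (‖y - x‖ ^ 2) (x 0 * y 0)) * u y ^ q

lemma integral_cmp_le {c : ℝ} (hm : 0 < m) (hb : b 0 = -1) (hl : 0 < l)
    (hpos : ∀ x : Eu N, 0 ≤ x 0 → 0 ≤ u x)
    (hrep : ∀ x ∈ upper N, IntegrableOn (fun y => green m x y * u y ^ q) (upper N) ∧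
      ∫ y in upper N, green m x y * u y ^ q = c * u x) {x : Eu N} (hx : x ∈ cap b l) :
    IntegrableOn (cmp m b l q u x) (cap b l) ∧
    ∫ y in cap b l, cmp m b l q u x y ≤ c * (kelvin m b l u x - u x) := by
  have hxl : ‖x - b‖ ≤ l := le_of_lt hx.2
  have hx0 : 0 < x 0 := hx.1
  have hTx := inversion_mem_upper hb hl hx.1 hxl
  have hms : MeasurableSet (cap b l) := (isOpen_cap b l).measurableSet
  obtain ⟨hi1, he1⟩ := hrep x hx.1
  obtain ⟨hi2, he2⟩ := hrep _ hTx
  obtain ⟨hj1, hs1⟩ := integral_upper_split hb hl hi1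
  obtain ⟨hj2, hs2⟩ := integral_upper_split hb hl hi2
  set w := cf b l x ^ ((N : ℝ) / 2 - m) with hw
  have hcx := cf_pos hb hl hx.1
  have hw0 : 0 < w := Real.rpow_pos_of_pos hcx _
  have hww : w * cf b l x ^ ((m : ℝ) - N / 2) = 1 := by
    rw [hw, ← Real.rpow_add hcx]
    simp
  have hhx : 0 ≤ ht b l x := hx0.le.trans (le_ht hl hxl)
  have hcy : ∀ y ∈ cap b l, cf b l y ^ N * cf b l y ^ ((m : ℝ) - N / 2) =
      cf b l y ^ ((N : ℝ) / 2 + m) := fun y hy => by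
    rw [← Real.rpow_natCast, ← Real.rpow_add (cf_pos hb hl hy.1)]
    congr 1
    ring
  have hhy : ∀ y ∈ cap b l, 0 ≤ ht b l y := fun y hy =>
    (le_of_lt hy.1 : 0 ≤ y 0).trans (le_ht hl (le_of_lt hy.2))
  have hcap1 : IntegrableOn (fun y => green m x y * u y ^ q) (cap b l) := hi1.mono_set inter_subset_left
  have hcap2 : IntegrableOn (fun y => green m (inversion b l x) y * u y ^ q) (cap b l) :=
    hi2.mono_set inter_subset_left
  have heq : EqOn (cmp m b l q u x) (fun y =>
      (w * (cf b l y ^ N * (green m (inversion b l x) (inversion b l y) * u (inversion b l y) ^ q)) +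
        w * (green m (inversion b l x) y * u y ^ q)) -
      (cf b l y ^ N * (green m x (inversion b l y) * u (inversion b l y) ^ q) +
        green m x y * u y ^ q)) (cap b l) := by
    intro y hy
    simp only
    rw [green_inversion_inversion hm hb hl hx.1 hy.1 hhx (hhy y hy),
      green_inversion_left hm hb hl hx.1 (le_of_lt hy.1) hhx,
      green_inversion_right hm hb hl hx0.le hy.1 (hhy y hy), green_eq_gk, cmp, ← hcy y hy]
    linear_combination (-(cf b l y ^ N * cf b l y ^ ((m : ℝ) - N / 2) *
      gk m N (‖y - x‖ ^ 2) (ht b l x * ht b l y) * u (inversion b l y) ^ q +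
      gk m N (crossDist b l x y) (ht b l x * y 0) * u y ^ q)) * hww
  have hInt : IntegrableOn (cmp m b l q u x) (cap b l) := by
    refine IntegrableOn.congr_fun ?_ heq.symm hms
    exact ((hj2.const_mul w).add (hcap2.const_mul w)).sub (hj1.add hcap1)
  refine ⟨hInt, ?_⟩
  rw [setIntegral_congr_fun hms heq]
  have hsplit := integral_sub ((hj2.const_mul w).add (hcap2.const_mul w)) (hj1.add hcap1)
  simp only [Pi.add_apply] at hsplit
  rw [hsplit, integral_add (hj2.const_mul w) (hcap2.const_mul w), integral_add hj1 hcap1,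
    integral_const_mul, integral_const_mul]
  have hR : ∫ y in upper N \ (cap b l ∪ inversion b l '' cap b l), green m x y * u y ^ q ≤
      w * ∫ y in upper N \ (cap b l ∪ inversion b l '' cap b l),
        green m (inversion b l x) y * u y ^ q := by
    rw [← integral_const_mul]
    have hmR : MeasurableSet (upper N \ (cap b l ∪ inversion b l '' cap b l)) := by
      refine isOpen_upper.measurableSet.diff (hms.union ?_)
      refine hms.image_of_continuousOn_injOn (fun y hy => ?_) (inversion_injective b hl.ne').injOn
      exact (hasFDerivAt_inversion (ne_of_mem_upper hb hy.1)).continuousAt.continuousWithinAt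
    refine setIntegral_mono_on (hi1.mono_set sdiff_subset) ((hi2.mono_set sdiff_subset).const_mul w)
      hmR fun z hz => ?_
    have hz0 : 0 < z 0 := hz.1
    have hzl : l ≤ ‖z - b‖ := by
      by_contra hlt
      exact hz.2 (Or.inl ⟨hz.1, not_le.1 hlt⟩)
    have hzT : inversion b l x ≠ z := fun h => hz.2 (Or.inr ⟨x, hx, h⟩)
    have hcd : 0 < crossDist b l x z := by
      have h1 := norm_inversion_sub_sq (x := z) hl (ne_of_mem_upper hb hx.1)
      have h2 : 0 < ‖inversion b l x - z‖ ^ 2 := by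
        have := norm_pos_iff.2 (sub_ne_zero.2 hzT)
        positivity
      rw [h1, crossDist_comm] at h2
      exact pos_of_mul_pos_right h2 hcx.le
    have hcd2 : crossDist b l x z ≤ ‖z - x‖ ^ 2 := by
      rw [crossDist]
      have h1 : 0 ≤ l ^ 2 - ‖x - b‖ ^ 2 := by nlinarith [norm_nonneg (x - b)]
      have h2 : l ^ 2 - ‖z - b‖ ^ 2 ≤ 0 := by nlinarith [norm_nonneg (z - b)]
      have := div_nonpos_of_nonpos_of_nonneg (mul_nonpos_of_nonneg_of_nonpos h1 h2) (sq_nonneg l)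
      linarith
    rw [green_inversion_left hm hb hl hx.1 hz0.le hhx, green_eq_gk, ← mul_assoc, ← mul_assoc, hww,
      one_mul]
    refine mul_le_mul_of_nonneg_right (gk_mono hcd hcd2 (by positivity) ?_)
      (Real.rpow_nonneg (hpos z hz0.le) _)
    exact mul_le_mul_of_nonneg_right (le_ht hl hxl) hz0.le
  have hk : kelvin m b l u x = w * u (inversion b l x) := rfl
  rw [hk, mul_sub, show c * (w * u (inversion b l x)) = w * (c * u (inversion b l x)) by ring,
    ← he1, ← he2, hs1, hs2]
  linarith

lemma rpow_sub_rpow_le {s t : ℝ} (hs : 0 ≤ s) (hst : s ≤ t) (hq : 1 ≤ q) :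
    t ^ q - s ^ q ≤ q * t ^ (q - 1) * (t - s) := by
  rcases hs.trans hst |>.eq_or_lt with h | ht
  · have : s = 0 := le_antisymm (h ▸ hst) hs
    simp [← h, this]
  · have h1 := one_add_mul_self_le_rpow_one_add (s := s / t - 1)
      (by have : 0 ≤ s / t := by positivity
          linarith) hq
    rw [add_sub_cancel, Real.div_rpow hs ht.le, le_div_iff₀ (by positivity)] at h1
    have h2 : t ^ q = t ^ (q - 1) * t := by
      rw [← Real.rpow_add_one ht.ne', sub_add_cancel]
    have h3 : t ^ q * (s / t - 1) = t ^ (q - 1) * (s - t) := by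
      rw [h2]
      field_simp
    linear_combination h1 - q * h3

lemma cmp_aux {A B F f g : ℝ} (hA : 0 ≤ A) (hAB : 0 ≤ A + B) (hF : g ≤ F) (hf : 0 ≤ f) :
    -(A * (f - g)) ≤ A * F + B * f := by
  nlinarith [mul_nonneg hA (sub_nonneg.2 hF), mul_nonneg hAB hf]

lemma kelvin_nonneg (hb : b 0 = -1) (hl : 0 < l)
    (hpos : ∀ x : Eu N, 0 ≤ x 0 → 0 ≤ u x) {y : Eu N} (hy : y ∈ cap b l) : 0 ≤ kelvin m b l u y :=
  mul_nonneg (Real.rpow_nonneg (sq_nonneg _) _)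
    (hpos _ (le_of_lt (inversion_mem_upper hb hl hy.1 (le_of_lt hy.2))))

lemma kelvin_rpow_le (hb : b 0 = -1) (hl : 0 < l) (hq : 1 < q)
    (hqN : 2 * m < N → q ≤ ((N : ℝ) + 2 * m) / ((N : ℝ) - 2 * m))
    (hpos : ∀ x : Eu N, 0 ≤ x 0 → 0 ≤ u x) {y : Eu N} (hy : y ∈ cap b l) :
    kelvin m b l u y ^ q ≤ cf b l y ^ ((N : ℝ) / 2 + m) * u (inversion b l y) ^ q := by
  have hc := one_le_cf hb hy.1 (le_of_lt hy.2)
  have hu := hpos _ (le_of_lt (inversion_mem_upper hb hl hy.1 (le_of_lt hy.2)))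
  rw [kelvin, Real.mul_rpow (by positivity) hu, ← Real.rpow_mul (by positivity)]
  refine mul_le_mul_of_nonneg_right (Real.rpow_le_rpow_of_exponent_le hc ?_)
    (Real.rpow_nonneg hu _)
  rcases lt_or_ge (2 * m) N with h | h
  · have h1 : (0 : ℝ) < N - 2 * m := by
      have : ((2 * m : ℕ) : ℝ) < N := by exact_mod_cast h
      push_cast at this
      linarith
    have h2 := (le_div_iff₀ h1).1 (hqN h)
    linarith
  · have h1 : (N : ℝ) ≤ 2 * m := by exact_mod_cast h
    have h2 : (0 : ℝ) ≤ N := Nat.cast_nonneg _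
    nlinarith

lemma cmp_lower (hb : b 0 = -1) (hl : 0 < l) (hq : 1 < q)
    (hqN : 2 * m < N → q ≤ ((N : ℝ) + 2 * m) / ((N : ℝ) - 2 * m))
    (hpos : ∀ x : Eu N, 0 ≤ x 0 → 0 ≤ u x)
    {x y : Eu N} (hx : x ∈ cap b l) (hy : y ∈ cap b l) (hyx : y ≠ x) :
    -(gk m N (‖y - x‖ ^ 2) (ht b l x * ht b l y) * max (u y ^ q - kelvin m b l u y ^ q) 0) ≤
      cmp m b l q u x y ∧ (0 < u y → u y ≤ kelvin m b l u y → 0 < cmp m b l q u x y) := by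
  have hx0 : 0 < x 0 := hx.1
  have hy0 : 0 < y 0 := hy.1
  have hhx := lt_ht hl hx.2
  have hhy := lt_ht hl hy.2
  have hd : 0 < ‖y - x‖ ^ 2 := by
    have := norm_pos_iff.2 (sub_ne_zero.2 hyx)
    positivity
  have hdd : ‖y - x‖ ^ 2 ≤ crossDist b l x y := by
    rw [crossDist]
    have h1 : 0 ≤ l ^ 2 - ‖x - b‖ ^ 2 := by
      nlinarith [norm_nonneg (x - b), (le_of_lt hx.2 : ‖x - b‖ ≤ l)]
    have h2 : 0 ≤ l ^ 2 - ‖y - b‖ ^ 2 := by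
      nlinarith [norm_nonneg (y - b), (le_of_lt hy.2 : ‖y - b‖ ≤ l)]
    have : 0 ≤ (l ^ 2 - ‖x - b‖ ^ 2) * (l ^ 2 - ‖y - b‖ ^ 2) / l ^ 2 := by positivity
    linarith
  have hA1 : gk m N (crossDist b l x y) (x 0 * ht b l y) ≤
      gk m N (‖y - x‖ ^ 2) (ht b l x * ht b l y) :=
    gk_mono hd hdd (by nlinarith) (by nlinarith)
  have hAB := gk_rearrange (m := m) (N := N) hd hdd hx0 hy0 hhx hhy
  have hF := kelvin_rpow_le hb hl hq hqN hpos hy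
  have hf := Real.rpow_nonneg (hpos y hy0.le) q
  have hG := gk_nonneg (m := m) (N := N) (hd.le.trans hdd) (P := x 0 * ht b l y) (by nlinarith)
  constructor
  · refine le_trans ?_ (cmp_aux (sub_nonneg.2 hA1) hAB.le hF hf)
    rw [neg_le_neg_iff]
    refine (mul_le_mul_of_nonneg_left (le_max_left _ 0) (sub_nonneg.2 hA1)).trans ?_
    exact mul_le_mul_of_nonneg_right (by linarith) (le_max_right _ _)
  · intro hu huk
    have h1 : u y ^ q ≤ kelvin m b l u y ^ q := Real.rpow_le_rpow hu.le huk (by linarith)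
    have h2 : 0 < u y ^ q := Real.rpow_pos_of_pos hu q
    rw [cmp]
    nlinarith [mul_nonneg (sub_nonneg.2 hA1) (sub_nonneg.2 (h1.trans hF)), mul_pos hAB h2]

end Comparison

section Potential

variable {N : ℕ} [NeZero N]

lemma integrable_potential (L : ℝ) : Integrable (fun z : Eu N =>
    (Iic L).indicator (fun r : ℝ => (r ^ 2) ^ (-((N - 1) / 2 : ℝ))) ‖z‖) := by
  have hnt : Nontrivial (Eu N) := nontrivial_of_ne (e1 N) 0 (norm_ne_zero_iff.1 (by simp [norm_e1]))
  rw [integrable_fun_norm_addHaar volume (f := (Iic L).indicator fun r : ℝ =>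
    (r ^ 2) ^ (-((N - 1) / 2 : ℝ))), finrank_euclideanSpace_fin]
  have : IntegrableOn ((Iic L).indicator fun _ => (1 : ℝ)) (Ioi 0) := by
    rw [IntegrableOn, integrable_indicator_iff measurableSet_Iic, IntegrableOn,
      Measure.restrict_restrict measurableSet_Iic, inter_comm, Ioi_inter_Iic]
    exact integrableOn_const (by simp)
  refine this.congr_fun (fun y hy => ?_) measurableSet_Ioi
  have hy0 : 0 < y := hy
  have hN : ((N - 1 : ℕ) : ℝ) = N - 1 := by
    rw [Nat.cast_sub (Nat.one_le_iff_ne_zero.2 (NeZero.ne N)), Nat.cast_one]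
  by_cases h : y ∈ Iic L
  · rw [indicator_of_mem h, indicator_of_mem h, smul_eq_mul, ← Real.rpow_natCast y 2,
      ← Real.rpow_mul hy0.le, ← Real.rpow_natCast, ← Real.rpow_add hy0, hN]
    push_cast
    rw [show (N : ℝ) - 1 + 2 * -((N - 1) / 2) = 0 by ring, Real.rpow_zero]
  · rw [indicator_of_notMem h, indicator_of_notMem h, smul_zero]

/-- Uniform absolute continuity of the potential with kernel `‖y - x‖^(1 - N)`. -/
lemma exists_potential_small (N : ℕ) [NeZero N] (L : ℝ) {η : ℝ} (hη : 0 < η) :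
    ∃ δ : ENNReal, 0 < δ ∧ ∀ D : Set (Eu N), MeasurableSet D → volume D < δ → ∀ x : Eu N,
      (∀ y ∈ D, ‖y - x‖ ≤ L) →
      IntegrableOn (fun y => (‖y - x‖ ^ 2) ^ (-((N - 1) / 2 : ℝ))) D ∧
      ∫ y in D, (‖y - x‖ ^ 2) ^ (-((N - 1) / 2 : ℝ)) ≤ η := by
  set φ : Eu N → ℝ := fun z =>
    (Iic L).indicator (fun r : ℝ => (r ^ 2) ^ (-((N - 1) / 2 : ℝ))) ‖z‖ with hφ
  have hφi : Integrable φ := integrable_potential L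
  have hφ0 : ∀ z, 0 ≤ φ z := fun z => indicator_nonneg (fun r _ => by positivity) _
  have hφm : Measurable φ := by
    have : Measurable (fun r : ℝ => (r ^ 2) ^ (-((N - 1) / 2 : ℝ))) := by fun_prop
    exact (this.indicator measurableSet_Iic).comp measurable_norm
  have hfin : ∫⁻ z, ENNReal.ofReal (φ z) ≠ ⊤ := by
    rw [← ofReal_integral_eq_lintegral_ofReal hφi (Eventually.of_forall hφ0)]
    exact ENNReal.ofReal_ne_top
  obtain ⟨δ, hδ, h⟩ := exists_pos_setLIntegral_lt_of_measure_lt hfin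
    (ENNReal.ofReal_pos.2 hη).ne'
  refine ⟨δ, hδ, fun D hD hDδ x hDx => ?_⟩
  have he : EqOn (fun y => (‖y - x‖ ^ 2) ^ (-((N - 1) / 2 : ℝ))) (fun y => φ (y - x)) D := by
    intro y hy
    simp only [hφ]
    rw [indicator_of_mem (show ‖y - x‖ ∈ Iic L from hDx y hy)]
  have hi : IntegrableOn (fun y => φ (y - x)) D := (hφi.comp_sub_right x).integrableOn
  refine ⟨hi.congr_fun he.symm hD, ?_⟩
  rw [setIntegral_congr_fun hD he, integral_eq_lintegral_of_nonneg_ae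
    (Eventually.of_forall fun y => hφ0 _) hi.aestronglyMeasurable]
  refine ENNReal.toReal_le_of_le_ofReal hη.le ?_
  have hmp := measurePreserving_sub_right (volume : Measure (Eu N)) x
  have hD' : MeasurableSet ((fun z : Eu N => z + x) ⁻¹' D) := hD.preimage (by fun_prop)
  have hpre : (fun y : Eu N => y - x) ⁻¹' ((fun z : Eu N => z + x) ⁻¹' D) = D := by
    ext y; simp
  have hvol := hmp.measure_preimage hD'.nullMeasurableSet
  have hl := hmp.setLIntegral_comp_preimage hD' (f := fun z => ENNReal.ofReal (φ z))
    hφm.ennreal_ofReal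
  rw [hpre] at hvol hl
  rw [hl]
  exact (h _ (hvol ▸ hDδ)).le

end Potential

section Spheres

variable {m N : ℕ} [NeZero N] {b : Eu N} {l q : ℝ} {u : Eu N → ℝ}

lemma continuousAt_kelvin_left (hu : ContinuousOn u (upper N)) {x : Eu N} (hb : b 0 = -1)
    (hl : 0 < l) (hx : x ∈ upper N) (h : ‖x - b‖ ≤ l) :
    ContinuousAt (fun l => kelvin m b l u x) l := by
  have h1 := inversion_mem_upper hb hl hx h
  have h2 := cf_pos hb hl hx
  have hc : ContinuousAt (fun l => cf b l x) l := by
    unfold cf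
    fun_prop
  have hi : ContinuousAt (fun l => inversion b l x) l := by
    have : (fun l => inversion b l x) = fun l => cf b l x • (x - b) + b := by
      ext1 l
      rw [← inversion_sub, sub_add_cancel]
    rw [this]
    exact (hc.smul continuousAt_const).add continuousAt_const
  unfold kelvin
  exact (hc.rpow_const (Or.inl h2.ne')).mul
    (ContinuousAt.comp (f := fun l => inversion b l x) (hu.continuousAt (isOpen_upper.mem_nhds h1)) hi)

lemma continuousOn_kelvin (hu : ContinuousOn u (upper N)) (hb : b 0 = -1) (hl : 0 < l) :
    ContinuousOn (kelvin m b l u) (cap b l) := by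
  intro x hx
  have h1 := inversion_mem_upper hb hl hx.1 (le_of_lt hx.2)
  have h2 := cf_pos hb hl hx.1
  have h3 := ne_of_mem_upper hb hx.1
  have hc : ContinuousAt (fun x => cf b l x) x := by
    unfold cf
    have : ‖x - b‖ ≠ 0 := norm_ne_zero_iff.2 (sub_ne_zero.2 h3)
    fun_prop (disch := assumption)
  have hi : ContinuousAt (inversion b l) x := (hasFDerivAt_inversion h3).continuousAt
  refine ContinuousAt.continuousWithinAt ?_
  unfold kelvin
  exact (hc.rpow_const (Or.inl h2.ne')).mul
    (ContinuousAt.comp (f := inversion b l) (hu.continuousAt (isOpen_upper.mem_nhds h1)) hi)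

lemma ae_ne_restrict (s : Set (Eu N)) (x : Eu N) : ∀ᵐ y ∂(volume.restrict s), y ≠ x := by
  have hnt : Nontrivial (Eu N) := nontrivial_of_ne (e1 N) 0 (norm_ne_zero_iff.1 (by simp [norm_e1]))
  exact ae_restrict_of_ae (by simp [ae_iff, measure_singleton])

lemma lt_kelvin {c : ℝ} (hm : 0 < m) (hb : b 0 = -1) (hl : 0 < l) (hq : 1 < q)
    (hqN : 2 * m < N → q ≤ ((N : ℝ) + 2 * m) / ((N : ℝ) - 2 * m))
    (hpos : ∀ x : Eu N, 0 ≤ x 0 → 0 ≤ u x) (hpos' : ∀ x ∈ upper N, 0 < u x) (hc : 0 < c)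
    (hrep : ∀ x ∈ upper N, IntegrableOn (fun y => green m x y * u y ^ q) (upper N) ∧
      ∫ y in upper N, green m x y * u y ^ q = c * u x)
    (hle : ∀ x ∈ cap b l, u x ≤ kelvin m b l u x) {x : Eu N} (hx : x ∈ cap b l) :
    u x < kelvin m b l u x := by
  have hms : MeasurableSet (cap b l) := (isOpen_cap b l).measurableSet
  obtain ⟨hi, hlt⟩ := integral_cmp_le hm hb hl hpos hrep hx
  have hae : ∀ᵐ y ∂(volume.restrict (cap b l)), 0 < cmp m b l q u x y := by
    filter_upwards [ae_restrict_mem hms, ae_ne_restrict (cap b l) x] with y hy hyx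
    exact (cmp_lower hb hl hq hqN hpos hx hy hyx).2 (hpos' y hy.1) (hle y hy)
  have h0 : 0 < ∫ y in cap b l, cmp m b l q u x y := by
    rw [integral_pos_iff_support_of_nonneg_ae (hae.mono fun y h => h.le) hi]
    have h1 : (volume.restrict (cap b l)) (Function.support (cmp m b l q u x))ᶜ = 0 :=
      mem_ae_iff.1 (hae.mono fun y h => h.ne')
    refine pos_iff_ne_zero.2 fun h2 => ?_
    have h3 : (volume.restrict (cap b l)) univ = 0 := by
      rw [← union_compl_self (Function.support (cmp m b l q u x))]
      exact measure_union_null h2 h1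
    rw [Measure.restrict_apply_univ] at h3
    exact ((isOpen_cap b l).measure_pos volume ⟨x, hx⟩).ne' h3
  have := pos_of_mul_pos_right (h0.trans_le hlt) hc.le
  linarith

lemma exists_contraction {c M L : ℝ} (hm : 0 < m) (hb : b 0 = -1) (hq : 1 < q)
    (hqN : 2 * m < N → q ≤ ((N : ℝ) + 2 * m) / ((N : ℝ) - 2 * m))
    (hpos : ∀ x : Eu N, 0 ≤ x 0 → 0 ≤ u x) (hu : ContinuousOn u (upper N)) (hc : 0 < c)
    (hM : ∀ x ∈ upper N, u x ≤ M) (hM0 : 0 < M)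
    (hrep : ∀ x ∈ upper N, IntegrableOn (fun y => green m x y * u y ^ q) (upper N) ∧
      ∫ y in upper N, green m x y * u y ^ q = c * u x) (hL : 0 < L) :
    ∃ δ : ENNReal, 0 < δ ∧ ∀ l, 0 < l → l ≤ L →
      volume (cap b l ∩ {y | kelvin m b l u y < u y}) < δ → ∀ x ∈ cap b l, u x ≤ kelvin m b l u x := by
  set K := (4 * L ^ 2) ^ (m - 1) * (2 * (4 * L ^ 2) ^ (1 / 2 : ℝ)) with hK
  have hK0 : 0 < K := by positivity
  set Q := q * M ^ (q - 1) with hQ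
  have hQ0 : 0 < Q := by positivity
  set η := c / (2 * (K * Q)) with hη
  have hη0 : 0 < η := by positivity
  obtain ⟨δ, hδ, hsmall⟩ := exists_potential_small N (L + L) hη0
  refine ⟨δ, hδ, fun l hl hlL hD => ?_⟩
  set D := cap b l ∩ {y | kelvin m b l u y < u y} with hDdef
  have hms : MeasurableSet (cap b l) := (isOpen_cap b l).measurableSet
  have hDm : MeasurableSet D := by
    have h := ((hu.mono (inter_subset_left : cap b l ⊆ upper N)).sub (continuousOn_kelvin (m := m) hu hb hl))
    have h2 := h.isOpen_inter_preimage (isOpen_cap b l) (isOpen_Ioi (a := (0 : ℝ)))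
    convert h2.measurableSet using 1
    ext y
    simp [hDdef, cap]
  have step : ∀ S, 0 ≤ S → (∀ y ∈ cap b l, u y - kelvin m b l u y ≤ S) →
      ∀ x ∈ cap b l, u x - kelvin m b l u x ≤ S / 2 := by
    intro S hS hSu x hx
    obtain ⟨hi, hlt⟩ := integral_cmp_le hm hb hl hpos hrep hx
    have hDx : ∀ y ∈ D, ‖y - x‖ ≤ L + L := fun y hy => by
      have h1 := norm_sub_le_norm_sub_add_norm_sub y b x
      rw [norm_sub_rev b x] at h1
      have h2 : ‖y - b‖ < l := hy.1.2
      have h3 : ‖x - b‖ < l := hx.2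
      linarith
    obtain ⟨hpi, hpη⟩ := hsmall D hDm hD x hDx
    set p : Eu N → ℝ := fun y => (‖y - x‖ ^ 2) ^ (-((N - 1) / 2 : ℝ)) with hp
    have hind : Integrable (D.indicator fun y => K * (Q * S) * p y) (volume.restrict (cap b l)) :=
      ((integrable_indicator_iff hDm).2 (hpi.const_mul _)).mono_measure Measure.restrict_le_self
    have hmono : ∫ y in cap b l, -(D.indicator (fun y => K * (Q * S) * p y) y) ≤
        ∫ y in cap b l, cmp m b l q u x y := by
      refine integral_mono_ae hind.neg hi ?_
      filter_upwards [ae_restrict_mem hms, ae_ne_restrict (cap b l) x] with y hy hyx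
      refine le_trans ?_ (cmp_lower hb hl hq hqN hpos hx hy hyx).1
      rw [neg_le_neg_iff]
      have huy := hpos y (le_of_lt hy.1)
      have hky := kelvin_nonneg (m := m) hb hl hpos hy
      by_cases hyD : y ∈ D
      · rw [indicator_of_mem hyD]
        have hlt : kelvin m b l u y < u y := hyD.2
        have hht : ∀ z ∈ cap b l, 0 ≤ ht b l z ∧ ht b l z ≤ L := fun z hz => by
          have h1 := le_ht hl (le_of_lt hz.2)
          have h2 := coord_zero_le_norm (x := z) hb
          have h3 : 0 < z 0 := hz.1
          have h4 : ‖z - b‖ < l := hz.2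
          have h5 : ht b l z ≤ z 0 + 1 := by
            rw [ht]
            have : 0 ≤ ‖z - b‖ ^ 2 / l ^ 2 := by positivity
            linarith
          constructor <;> linarith
        have hgk : gk m N (‖y - x‖ ^ 2) (ht b l x * ht b l y) ≤ K * p y := by
          refine gk_le (pow_pos (norm_pos_iff.2 (sub_ne_zero.2 hyx)) 2)
            (mul_nonneg (hht x hx).1 (hht y hy).1) ?_
          rw [sq]
          exact mul_le_mul (hht x hx).2 (hht y hy).2 (hht y hy).1 hL.le
        have hmax : max (u y ^ q - kelvin m b l u y ^ q) 0 ≤ Q * S := by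
          refine max_le ((rpow_sub_rpow_le hky hlt.le hq.le).trans ?_) (by positivity)
          have h1 : u y ^ (q - 1) ≤ M ^ (q - 1) :=
            Real.rpow_le_rpow huy (hM y hy.1) (by linarith)
          have h2 := hSu y hy
          have h3 : 0 ≤ u y - kelvin m b l u y := by linarith
          exact mul_le_mul (mul_le_mul_of_nonneg_left h1 (by linarith)) h2 h3 (by positivity)
        calc _ ≤ (K * p y) * (Q * S) :=
              mul_le_mul hgk hmax (le_max_right _ _) (mul_nonneg hK0.le (by positivity))
          _ = K * (Q * S) * p y := by ring
      · rw [indicator_of_notMem hyD]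
        have hle : u y ≤ kelvin m b l u y := not_lt.1 fun h => hyD ⟨hy, h⟩
        have : u y ^ q ≤ kelvin m b l u y ^ q := Real.rpow_le_rpow huy hle (by linarith)
        rw [max_eq_right (by linarith), mul_zero]
    rw [integral_neg, setIntegral_indicator hDm,
      inter_eq_self_of_subset_right (inter_subset_left : D ⊆ cap b l), integral_const_mul] at hmono
    have h1 : K * (Q * S) * ∫ y in D, p y ≤ K * (Q * S) * η :=
      mul_le_mul_of_nonneg_left hpη (by positivity)
    have h2 : K * (Q * S) * η = c * (S / 2) := by
      rw [hη]
      field_simp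
    have h3 : c * (u x - kelvin m b l u x) ≤ c * (S / 2) := by linarith
    exact le_of_mul_le_mul_left h3 hc
  have hiter : ∀ k : ℕ, ∀ x ∈ cap b l, u x - kelvin m b l u x ≤ M / 2 ^ k := by
    intro k
    induction k with
    | zero =>
      intro x hx
      have := hM x hx.1
      have := kelvin_nonneg (m := m) hb hl hpos hx
      simp only [pow_zero, div_one]
      linarith
    | succ k ih =>
      intro x hx
      have := step (M / 2 ^ k) (by positivity) ih x hx
      rwa [div_div, ← pow_succ] at this
  intro x hx
  have hlim : Tendsto (fun k : ℕ => M / 2 ^ k) atTop (𝓝 0) := by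
    have := (tendsto_pow_atTop_nhds_zero_of_lt_one (r := (1 / 2 : ℝ)) (by norm_num)
      (by norm_num)).const_mul M
    simpa [div_eq_mul_inv] using this
  have := ge_of_tendsto' hlim fun k => hiter k x hx
  linarith

/-- The method of moving spheres, with centers below the boundary. -/
lemma le_kelvin {c M L : ℝ} (hm : 0 < m) (hb : b 0 = -1) (hq : 1 < q)
    (hqN : 2 * m < N → q ≤ ((N : ℝ) + 2 * m) / ((N : ℝ) - 2 * m))
    (hpos : ∀ x : Eu N, 0 ≤ x 0 → 0 ≤ u x) (hpos' : ∀ x ∈ upper N, 0 < u x)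
    (hu : ContinuousOn u (upper N)) (hc : 0 < c)
    (hM : ∀ x ∈ upper N, u x ≤ M) (hM0 : 0 < M)
    (hrep : ∀ x ∈ upper N, IntegrableOn (fun y => green m x y * u y ^ q) (upper N) ∧
      ∫ y in upper N, green m x y * u y ^ q = c * u x) (hL : 1 ≤ L) :
    ∀ x ∈ cap b L, u x ≤ kelvin m b L u x := by
  have hnt : Nontrivial (Eu N) := nontrivial_of_ne (e1 N) 0 (norm_ne_zero_iff.1 (by simp [norm_e1]))
  set s : Set ℝ := {l | ∀ x ∈ cap b l, u x ≤ kelvin m b l u x} with hs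
  obtain ⟨δ, hδ, hcontr⟩ := exists_contraction (b := b) hm hb hq hqN hpos hu hc hM hM0 hrep
    (zero_lt_one.trans_le hL)
  suffices Icc 1 L ⊆ s from this (right_mem_Icc.2 hL)
  refine IsClosed.Icc_subset_of_forall_exists_gt ?_ ?_ ?_
  · refine IsSeqClosed.isClosed fun ln l hn hlim => ?_
    have hl : l ∈ Icc 1 L := isClosed_Icc.mem_of_tendsto hlim
      (Eventually.of_forall fun n => (hn n).2)
    refine ⟨fun x hx => ?_, hl⟩
    have hxl : ‖x - b‖ < l := hx.2
    have ht := (continuousAt_kelvin_left (m := m) hu hb (zero_lt_one.trans_le hl.1) hx.1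
      hxl.le).tendsto.comp hlim
    refine ge_of_tendsto ht ?_
    filter_upwards [hlim.eventually (lt_mem_nhds hxl)] with n hxn
    exact (hn n).1 x ⟨hx.1, hxn⟩
  · intro x hx
    have h1 : ‖x - b‖ < 1 := hx.2
    linarith [one_lt_norm_sub hb hx.1]
  · rintro l ⟨hls, hl1, hlL⟩ r hr
    have hl0 : 0 < l := zero_lt_one.trans_le hl1
    have hstrict : ∀ x ∈ cap b l, u x < kelvin m b l u x := fun x hx =>
      lt_kelvin hm hb hl0 hq hqN hpos hpos' hc hrep hls hx
    set μ : ℕ → ℝ := fun n => l + 1 / ((n : ℝ) + 1) with hμ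
    have hμl : ∀ n, l < μ n := fun n => lt_add_of_pos_right _ (by positivity)
    have hμlim : Tendsto μ atTop (𝓝 l) := by
      simpa [hμ] using (tendsto_one_div_add_atTop_nhds_zero_nat (𝕜 := ℝ)).const_add l
    set D : ℕ → Set (Eu N) := fun n => cap b (μ n) ∩ {y | kelvin m b (μ n) u y < u y} with hD
    have hDm : ∀ n, MeasurableSet (D n) := by
      intro n
      have h := ((hu.mono (inter_subset_left : cap b (μ n) ⊆ upper N)).sub
        (continuousOn_kelvin (m := m) hu hb (hl0.trans (hμl n))))
      have h2 := h.isOpen_inter_preimage (isOpen_cap b (μ n)) (isOpen_Ioi (a := (0 : ℝ)))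
      convert h2.measurableSet using 1
      ext y
      simp [hD, cap]
    have hDlim : Tendsto (fun n => volume (D n)) atTop (𝓝 (volume (∅ : Set (Eu N)))) := by
      refine tendsto_measure_of_ae_tendsto_indicator atTop MeasurableSet.empty hDm
        (B := Metric.ball b (l + 1)) measurableSet_ball measure_ball_lt_top.ne ?_ ?_
      · refine Eventually.of_forall fun n y hy => ?_
        have h1 : ‖y - b‖ < μ n := hy.1.2
        have h2 : μ n ≤ l + 1 := by
          have : 1 / ((n : ℝ) + 1) ≤ 1 := by
            rw [div_le_one (by positivity)]
            linarith [(Nat.cast_nonneg n : (0 : ℝ) ≤ n)]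
          simp only [hμ]
          linarith
        rw [Metric.mem_ball, dist_eq_norm]
        linarith
      · have hsph : ∀ᵐ y : Eu N, y ∉ Metric.sphere b l :=
          measure_eq_zero_iff_ae_notMem.1 (Measure.addHaar_sphere volume b l)
        filter_upwards [hsph] with y hy
        rw [mem_sphere_iff_norm] at hy
        rcases lt_or_gt_of_ne hy with h | h
        · by_cases hyu : y ∈ upper N
          · have ht := (continuousAt_kelvin_left (m := m) hu hb hl0 hyu h.le).tendsto.comp hμlim
            filter_upwards [ht.eventually (lt_mem_nhds (hstrict y ⟨hyu, h⟩))] with n hn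
            simp only [mem_empty_iff_false, iff_false]
            exact fun hyD => lt_asymm hyD.2 hn
          · refine Eventually.of_forall fun n => ?_
            simp only [mem_empty_iff_false, iff_false]
            exact fun hyD => hyu hyD.1.1
        · filter_upwards [hμlim.eventually (gt_mem_nhds h)] with n hn
          simp only [mem_empty_iff_false, iff_false]
          exact fun hyD => lt_asymm hyD.1.2 hn
    rw [measure_empty] at hDlim
    have h1 := hDlim.eventually (gt_mem_nhds hδ)
    have h2 := hμlim.eventually (gt_mem_nhds hlL)
    have h3 := hμlim.eventually (gt_mem_nhds (show l < r from hr))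
    obtain ⟨n, hn1, hn2, hn3⟩ := (h1.and (h2.and h3)).exists
    exact ⟨μ n, hcontr (μ n) (hl0.trans (hμl n)) hn2.le hn1, hμl n, hn3.le⟩

end Spheres

section Conclusion

variable {m N : ℕ} [NeZero N] {q : ℝ} {u : Eu N → ℝ}

lemma pos_or_eq_zero {c : ℝ} (hq : 0 < q)
    (hpos : ∀ x : Eu N, 0 ≤ x 0 → 0 ≤ u x) (hu : ContinuousOn u (upper N))
    (hrep : ∀ x ∈ upper N, IntegrableOn (fun y => green m x y * u y ^ q) (upper N) ∧
      ∫ y in upper N, green m x y * u y ^ q = c * u x) :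
    (0 < c ∧ ∀ x ∈ upper N, 0 < u x) ∨ ∀ x ∈ upper N, u x = 0 := by
  have hms : MeasurableSet (upper N) := isOpen_upper.measurableSet
  have hnn : ∀ x ∈ upper N, ∀ y ∈ upper N, 0 ≤ green m x y * u y ^ q := fun x hx y hy =>
    mul_nonneg (green_eq_gk (m := m) x y ▸ gk_nonneg (by positivity)
      (mul_nonneg (le_of_lt hx) (le_of_lt hy))) (Real.rpow_nonneg (hpos y (le_of_lt hy)) _)
  have hzero : ∀ x ∈ upper N, c * u x ≤ 0 → ∀ y ∈ upper N, u y = 0 := by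
    intro x hx hcx
    obtain ⟨hi, he⟩ := hrep x hx
    have h0 : 0 ≤ᵐ[volume.restrict (upper N)] fun y => green m x y * u y ^ q := by
      filter_upwards [ae_restrict_mem hms] with y hy using hnn x hx y hy
    have h1 : ∫ y in upper N, green m x y * u y ^ q = 0 :=
      le_antisymm (he ▸ hcx) (integral_nonneg_of_ae h0)
    have h2 := (integral_eq_zero_iff_of_nonneg_ae h0 hi).1 h1
    have h3 : u =ᵐ[volume.restrict (upper N)] fun _ => 0 := by
      filter_upwards [h2, ae_restrict_mem hms, ae_ne_restrict (upper N) x] with y hy hyU hyx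
      have hg : 0 < green m x y := by
        rw [green_eq_gk]
        exact gk_pos (pow_pos (norm_pos_iff.2 (sub_ne_zero.2 hyx)) 2) (mul_pos hx hyU)
      have h4 : u y ^ q = 0 := by
        simpa [hg.ne'] using hy
      exact ((Real.rpow_eq_zero (hpos y (le_of_lt hyU)) hq.ne').1 h4)
    exact Measure.eqOn_open_of_ae_eq h3 isOpen_upper hu continuousOn_const
  by_cases h : ∃ x ∈ upper N, c * u x ≤ 0
  · obtain ⟨x, hx, hcx⟩ := h
    exact Or.inr (hzero x hx hcx)
  · push Not at h
    refine Or.inl ⟨?_, fun x hx => ?_⟩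
    · have he : e1 N ∈ upper N := by simp [upper, e1_zero]
      exact pos_of_mul_pos_left (h _ he) (hpos _ (le_of_lt he))
    · rcases (hpos x (le_of_lt hx)).eq_or_lt with h0 | h0
      · have := h x hx
        rw [← h0, mul_zero] at this
        exact absurd this (lt_irrefl _)
      · exact h0

/-- Inversions in large spheres separating `x` from `y` converge to a translation taking `x` to `y`. -/
lemma le_of_le_kelvin (hu : ContinuousOn u (upper N))
    (hk : ∀ b : Eu N, b 0 = -1 → ∀ L : ℝ, 1 ≤ L → ∀ x ∈ cap b L, u x ≤ kelvin m b L u x)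
    {x y : Eu N} (hx : x ∈ upper N) (hy : y ∈ upper N) (hxy : x 0 = y 0) : u x ≤ u y := by
  rcases eq_or_ne x y with rfl | hne
  · exact le_rfl
  set d := ‖y - x‖ with hd
  have hd0 : 0 < d := norm_pos_iff.2 (sub_ne_zero.2 hne.symm)
  set w : ℝ → Eu N := fun r => (x 0 + 1) • e1 N + (r / d) • (y - x) with hw
  have hw0 : ∀ r, w r 0 = x 0 + 1 := fun r => by
    simp [hw, e1_zero, hxy]
  have hwn : ∀ r, x 0 + 1 ≤ ‖w r‖ := fun r => by
    have h1 := PiLp.norm_apply_le (w r) 0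
    rw [hw0, Real.norm_eq_abs] at h1
    exact (le_abs_self _).trans h1
  have hx0 : 0 < x 0 := hx
  have hwp : ∀ r, 0 < ‖w r‖ := fun r => by linarith [hwn r]
  set b : ℝ → Eu N := fun r => x - w r with hb
  have hb0 : ∀ r, b r 0 = -1 := fun r => by
    simp [hb, hw0]
  have hxb : ∀ r, x - b r = w r := fun r => by simp [hb]
  set l : ℝ → ℝ := fun r => Real.sqrt (‖w r‖ * (‖w r‖ + d)) with hl
  have hlsq : ∀ r, l r ^ 2 = ‖w r‖ * (‖w r‖ + d) := fun r => Real.sq_sqrt (by positivity)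
  have hwl : ∀ r, ‖w r‖ < l r := fun r => by
    refine Real.lt_sqrt_of_sq_lt ?_
    nlinarith [hwp r]
  have hcf : ∀ r, cf (b r) (l r) x = 1 + d / ‖w r‖ := fun r => by
    have := (hwp r).ne'
    rw [cf, hxb, div_pow, hlsq]
    field_simp
  have hinv : ∀ r, inversion (b r) (l r) x = x + (d / ‖w r‖) • w r := fun r => by
    have h := inversion_sub (b r) (l r) x
    rw [hcf, hxb, sub_eq_iff_eq_add] at h
    rw [h, add_smul, one_smul]
    simp only [hb]
    abel
  have hle : ∀ r, u x ≤ (1 + d / ‖w r‖) ^ ((N : ℝ) / 2 - m) * u (x + (d / ‖w r‖) • w r) := by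
    intro r
    have := hk (b r) (hb0 r) (l r) (by linarith [hwn r, hwl r]) x
      ⟨hx, by rw [mem_ofPred_eq, hxb]; exact hwl r⟩
    rwa [kelvin, hcf, hinv] at this
  -- asymptotics of the centers
  have hdiv : Tendsto (fun r : ℝ => r⁻¹ • w r) atTop (𝓝 ((1 / d) • (y - x))) := by
    have h1 : Tendsto (fun r : ℝ => r⁻¹ • ((x 0 + 1) • e1 N) + (1 / d) • (y - x)) atTop
        (𝓝 ((0 : ℝ) • ((x 0 + 1) • e1 N) + (1 / d) • (y - x))) :=
      (tendsto_inv_atTop_zero.smul_const _).add_const _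
    rw [zero_smul, zero_add] at h1
    refine h1.congr' ?_
    filter_upwards [eventually_gt_atTop 0] with r hr
    simp only [hw]
    rw [smul_add, smul_smul r⁻¹ (r / d)]
    congr 2
    field_simp
  have hnorm : Tendsto (fun r : ℝ => ‖r⁻¹ • w r‖) atTop (𝓝 1) := by
    have := hdiv.norm
    rwa [norm_smul, ← hd, Real.norm_of_nonneg (by positivity), one_div_mul_cancel hd0.ne'] at this
  have hlimT : Tendsto (fun r : ℝ => x + (d / ‖w r‖) • w r) atTop (𝓝 y) := by
    have h1 := ((tendsto_const_nhds (x := d)).div hnorm one_ne_zero).smul hdiv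
    have h2 : x + (d / 1) • ((1 / d) • (y - x)) = y := by
      rw [smul_smul, div_one, mul_one_div_cancel hd0.ne', one_smul, add_sub_cancel]
    have h3 := h1.const_add x
    rw [h2] at h3
    refine h3.congr' ?_
    filter_upwards [eventually_gt_atTop 0] with r hr
    simp only [Pi.div_apply]
    have := (hwp r).ne'
    rw [norm_smul, smul_smul, norm_inv, Real.norm_of_nonneg hr.le]
    congr 2
    field_simp
  have hlimc : Tendsto (fun r : ℝ => (1 + d / ‖w r‖) ^ ((N : ℝ) / 2 - m)) atTop (𝓝 1) := by
    have h1 := (tendsto_inv_atTop_zero (𝕜 := ℝ)).mul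
      ((tendsto_const_nhds (x := d)).div hnorm one_ne_zero)
    rw [zero_mul] at h1
    have h2 : Tendsto (fun r : ℝ => 1 + d / ‖w r‖) atTop (𝓝 1) := by
      have h3 := h1.const_add 1
      rw [add_zero] at h3
      refine h3.congr' ?_
      filter_upwards [eventually_gt_atTop 0] with r hr
      simp only [Pi.div_apply]
      have := (hwp r).ne'
      rw [norm_smul, norm_inv, Real.norm_of_nonneg hr.le]
      field_simp
    have h4 := h2.rpow_const (p := (N : ℝ) / 2 - m) (Or.inl one_ne_zero)
    rwa [Real.one_rpow] at h4
  have hlim := hlimc.mul ((hu.continuousAt (isOpen_upper.mem_nhds hy)).tendsto.comp hlimT)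
  rw [one_mul] at hlim
  exact ge_of_tendsto' hlim hle

end Conclusion

end HalfSpace

/-- One-dimensionality: a nonnegative bounded classical solution of the half-space
Dirichlet problem `(-Δ)^m u = u^q` depends only on the `x₁`-variable. -/
theorem stmt_12 {N m : ℕ} [NeZero N] (hm : 0 < m) (q : ℝ)
    (hq1 : 1 < q) (hq2 : 2 * m < N → q ≤ ((N : ℝ) + 2 * m) / ((N : ℝ) - 2 * m))
    (u : EuclideanSpace ℝ (Fin N) → ℝ)
    (hsol : IsBCSol N m q u)
    (hpos : ∀ x : EuclideanSpace ℝ (Fin N), 0 ≤ x 0 → 0 ≤ u x) :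
    ∀ x y : EuclideanSpace ℝ (Fin N), 0 ≤ x 0 → 0 ≤ y 0 → x 0 = y 0 → u x = u y := by
  have hu : ContinuousOn u (HalfSpace.upper N) := hsol.1.continuousOn
  obtain ⟨C, -, hC⟩ := HalfSpace.exists_abs_le_pow hm hsol
  obtain ⟨M, hM0, hM⟩ := HalfSpace.exists_abs_le hsol
  obtain ⟨c, hrep⟩ := HalfSpace.exists_green_representation hm hsol (by linarith) hpos
  have hbd : ∀ x : EuclideanSpace ℝ (Fin N), x 0 = 0 → u x = 0 := fun x hx => by
    have := hC x hx.ge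
    rw [hx, zero_pow hm.ne', mul_zero] at this
    exact abs_nonpos_iff.1 this
  intro x y hx hy hxy
  rcases hx.eq_or_lt with hx0 | hx0
  · rw [hbd x hx0.symm, hbd y (hxy ▸ hx0.symm)]
  have hy0 : 0 < y 0 := hxy ▸ hx0
  rcases HalfSpace.pos_or_eq_zero (by linarith) hpos hu hrep with ⟨hc, hpos'⟩ | h
  · have hk : ∀ b : HalfSpace.Eu N, b 0 = -1 → ∀ L : ℝ, 1 ≤ L →
        ∀ x ∈ HalfSpace.cap b L, u x ≤ HalfSpace.kelvin m b L u x := fun b hb L hL =>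
      HalfSpace.le_kelvin hm hb hq1 hq2 hpos hpos' hu hc
        (fun x hx => (le_abs_self _).trans (hM x (le_of_lt hx))) hM0 hrep hL
    exact le_antisymm (HalfSpace.le_of_le_kelvin hu hk hx0 hy0 hxy)
      (HalfSpace.le_of_le_kelvin hu hk hy0 hx0 hxy.symm)
  · rw [h x hx0, h y hy0]
end

section
/- Let m ≥ 1 be an integer and let f : [0,∞) → [0,∞) be continuous with f(0) = 0 and f(s) > 0 for s > 0. Suppose u : [0,∞) → ℝ is C^{2m} on (0,∞) and C^{2m−1} on [0,∞), u(t) ≥ 0 for all t ≥ 0, u and its derivatives u', u'', …, u^{(2m−1)} are bounded on [0,∞), u satisfies (−1)^m u^{(2m)}(t) = f(u(t)) for all t > 0, and u(0) = u'(0) = … = u^{(m−1)}(0) = 0. Then u ≡ 0. -/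
/-- A function whose derivative is at most a negative constant near infinity is unbounded. -/
theorem not_abs_le_of_hasDerivAt_le_neg {H h : ℝ → ℝ} {a c C : ℝ} (hc : 0 < c)
    (hH : ∀ t, a ≤ t → HasDerivAt H (h t) t) (hh : ∀ t, a ≤ t → h t ≤ -c)
    (hC : ∀ t, a ≤ t → |H t| ≤ C) : False := by
  have hC0 : 0 ≤ C := (abs_nonneg _).trans (hC a le_rfl)
  have hb : a ≤ a + (2 * C + 1) / c := by
    have : 0 ≤ (2 * C + 1) / c := by positivity
    linarith
  have key : H (a + (2 * C + 1) / c) - H a ≤ -c * (a + (2 * C + 1) / c - a) := by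
    refine (convex_Ici a).image_sub_le_mul_sub_of_deriv_le
      (fun t ht => (hH t ht).continuousAt.continuousWithinAt)
      (fun t ht => (hH t (interior_subset ht)).differentiableAt.differentiableWithinAt)
      (fun t ht => ?_) a Set.self_mem_Ici _ hb hb
    rw [(hH t (interior_subset ht)).deriv]
    exact hh t (interior_subset ht)
  have hmul : -c * (a + (2 * C + 1) / c - a) = -(2 * C + 1) := by
    field_simp
    ring
  have h1 := abs_le.1 (hC a le_rfl)
  have h2 := abs_le.1 (hC _ hb)
  linarith [h1.2, h2.1]

/-- An antitone function on `(0, ∞)` with a bounded antiderivative is nonnegative. -/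
theorem nonneg_of_antitoneOn_of_bounded_antideriv {H h : ℝ → ℝ} {C : ℝ}
    (hH : ∀ t, 0 < t → HasDerivAt H (h t) t) (hh : AntitoneOn h (Set.Ioi 0))
    (hC : ∀ t, 0 < t → |H t| ≤ C) {t : ℝ} (ht : 0 < t) : 0 ≤ h t := by
  by_contra! hneg
  exact not_abs_le_of_hasDerivAt_le_neg (a := t) (neg_pos.2 hneg)
    (fun s hs => hH s (ht.trans_le hs))
    (fun s hs => by simpa using hh ht (ht.trans_le hs) hs)
    (fun s hs => hC s (ht.trans_le hs))

/-- If `g 0, …, g n` are successive derivatives on `(0, ∞)`, the functions `g 0, …, g (n - 1)` are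
bounded and `(-1) ^ n * g n` is nonnegative up to the sign `ε`, then the signs of the `g j` with
`1 ≤ j ≤ n` alternate. -/
theorem alternating_sign_of_bounded {g : ℕ → ℝ → ℝ} {n : ℕ} {ε : ℝ}
    (hg : ∀ j < n, ∀ t, 0 < t → HasDerivAt (g j) (g (j + 1) t) t)
    (hb : ∀ j < n, ∃ C : ℝ, ∀ t, 0 < t → |g j t| ≤ C)
    (hn : ∀ t, 0 < t → 0 ≤ ε * (-1) ^ n * g n t) {j : ℕ} (hj : 1 ≤ j) (hjn : j ≤ n) :
    ∀ t, 0 < t → 0 ≤ ε * (-1) ^ j * g j t := by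
  induction hjn using Nat.decreasingInduction with
  | self => exact hn
  | of_succ j hjn ih =>
    have ih := ih (by omega)
    obtain ⟨C, hC⟩ := hb (j - 1) (by omega)
    have hderiv : ∀ t, 0 < t → HasDerivAt (fun s => ε * (-1) ^ j * g j s)
        (ε * (-1) ^ j * g (j + 1) t) t := fun t ht => (hg j hjn t ht).const_mul _
    have hprev : ∀ t, 0 < t → HasDerivAt (fun s => ε * (-1) ^ j * g (j - 1) s)
        (ε * (-1) ^ j * g j t) t := fun t ht => by
      have := hg (j - 1) (by omega) t ht
      rw [Nat.sub_add_cancel hj] at this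
      exact this.const_mul _
    have hanti : AntitoneOn (fun s => ε * (-1) ^ j * g j s) (Set.Ioi 0) := by
      refine antitoneOn_of_deriv_nonpos (convex_Ioi 0)
        (fun t ht => (hderiv t ht).continuousAt.continuousWithinAt)
        (fun t ht => (hderiv t (interior_subset ht)).differentiableAt.differentiableWithinAt)
        (fun t ht => ?_)
      rw [(hderiv t (interior_subset ht)).deriv]
      have := ih t (interior_subset ht)
      rw [pow_succ] at this
      linarith
    intro t ht
    refine nonneg_of_antitoneOn_of_bounded_antideriv (C := |ε * (-1) ^ j| * C) hprev hanti
      (fun s hs => ?_) ht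
    rw [abs_mul]
    exact mul_le_mul_of_nonneg_left (hC s hs) (abs_nonneg _)


/-- ODE Liouville theorem: if `f : [0,∞) → [0,∞)` is continuous with `f(0) = 0` and
`f(s) > 0` for `s > 0`, and `u` is a nonnegative classical solution of
`(-1)^m u^{(2m)} = f(u)` on `(0,∞)` which is `C^{2m}` on `(0,∞)`, `C^{2m-1}` up to `0`,
bounded together with its derivatives of order `≤ 2m-1`, and satisfies
`u(0) = u'(0) = … = u^{(m-1)}(0) = 0`, then `u ≡ 0`. -/
theorem stmt_13 {m : ℕ} (hm : 0 < m) (f : ℝ → ℝ)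
    (hf_cont : ContinuousOn f (Set.Ici 0)) (hf0 : f 0 = 0)
    (hf_nonneg : ∀ s : ℝ, 0 ≤ s → 0 ≤ f s) (hf_pos : ∀ s : ℝ, 0 < s → 0 < f s)
    (u : ℝ → ℝ)
    (hu_smooth : ContDiffOn ℝ (2 * m : ℕ) u (Set.Ioi 0))
    (hu_smooth' : ContDiffOn ℝ (2 * m - 1 : ℕ) u (Set.Ici 0))
    (hu_nonneg : ∀ t : ℝ, 0 ≤ t → 0 ≤ u t)
    (hu_bdd : ∀ j : ℕ, j ≤ 2 * m - 1 → ∃ C : ℝ, ∀ t : ℝ, 0 ≤ t →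
      |iteratedDerivWithin j u (Set.Ici 0) t| ≤ C)
    (hode : ∀ t : ℝ, 0 < t → (-1 : ℝ) ^ m * iteratedDeriv (2 * m) u t = f (u t))
    (hbc : ∀ j : ℕ, j < m → iteratedDerivWithin j u (Set.Ici 0) 0 = 0) :
    ∀ t : ℝ, 0 ≤ t → u t = 0 := by
  have hat : ∀ t : ℝ, 0 < t → ContDiffAt ℝ (2 * m : ℕ) u t := fun t ht =>
    hu_smooth.contDiffAt (Ioi_mem_nhds ht)
  have hg : ∀ j < 2 * m, ∀ t, 0 < t →
      HasDerivAt (iteratedDeriv j u) (iteratedDeriv (j + 1) u t) t := by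
    intro j hj t ht
    rw [iteratedDeriv_succ]
    have hdiff := (hu_smooth.differentiableOn_iteratedDerivWithin (m := j) (by exact_mod_cast hj)
      isOpen_Ioi.uniqueDiffOn).congr fun s hs => (iteratedDerivWithin_of_isOpen isOpen_Ioi hs).symm
    exact (hdiff.differentiableAt (Ioi_mem_nhds ht)).hasDerivAt
  have hb : ∀ j < 2 * m, ∃ C : ℝ, ∀ t, 0 < t → |iteratedDeriv j u t| ≤ C := by
    intro j hj
    obtain ⟨C, hC⟩ := hu_bdd j (by omega)
    refine ⟨C, fun t ht => ?_⟩
    rw [← iteratedDerivWithin_eq_iteratedDeriv (uniqueDiffOn_Ici 0)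
      ((hat t ht).of_le (by exact_mod_cast hj.le)) ht.le]
    exact hC t ht.le
  have hsign : ∀ t, 0 < t → 0 ≤ (-1) ^ m * (-1) ^ 1 * iteratedDeriv 1 u t := by
    refine alternating_sign_of_bounded hg hb (fun t ht => ?_) le_rfl (by omega)
    rw [pow_mul, neg_one_sq, one_pow, mul_one, hode t ht]
    exact hf_nonneg _ (hu_nonneg t ht.le)
  simp only [iteratedDeriv_one] at hsign
  have hu0 : u 0 = 0 := by simpa using hbc 0 hm
  have hcont : ContinuousOn u (Set.Ici 0) := hu_smooth'.continuousOn
  have hdiff : DifferentiableOn ℝ u (interior (Set.Ici 0)) := by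
    rw [interior_Ici]
    intro t ht
    have := (hg 0 (by omega) t ht).differentiableAt
    rw [iteratedDeriv_zero] at this
    exact this.differentiableWithinAt
  rcases Nat.even_or_odd m with hpar | hpar
  · have hanti : AntitoneOn u (Set.Ici 0) := by
      refine antitoneOn_of_deriv_nonpos (convex_Ici 0) hcont hdiff (fun t ht => ?_)
      rw [interior_Ici] at ht
      have := hsign t ht
      rw [hpar.neg_one_pow] at this
      linarith
    intro t ht
    exact le_antisymm (hu0 ▸ hanti Set.self_mem_Ici ht ht) (hu_nonneg t ht)
  · have hmono : MonotoneOn u (Set.Ici 0) := by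
      refine monotoneOn_of_deriv_nonneg (convex_Ici 0) hcont hdiff (fun t ht => ?_)
      rw [interior_Ici] at ht
      have := hsign t ht
      rw [hpar.neg_one_pow] at this
      linarith
    intro a ha
    by_contra hne
    have hpos : 0 < u a := lt_of_le_of_ne (hu_nonneg a ha) (Ne.symm hne)
    have ha0 : 0 < a := lt_of_le_of_ne ha (by rintro rfl; exact hne hu0)
    obtain ⟨M, hM⟩ := hb 0 (by omega)
    simp only [iteratedDeriv_zero] at hM
    have hmem : ∀ t, a ≤ t → u t ∈ Set.Icc (u a) M := fun t ht =>
      ⟨hmono ha (ha.trans ht) ht, (le_abs_self _).trans (hM t (ha0.trans_le ht))⟩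
    obtain ⟨s, hs, hmin⟩ := isCompact_Icc.exists_isMinOn ⟨u a, hmem a le_rfl⟩
      (hf_cont.mono fun x (hx : x ∈ Set.Icc (u a) M) => hpos.le.trans hx.1)
    obtain ⟨C, hC⟩ := hb (2 * m - 1) (by omega)
    refine not_abs_le_of_hasDerivAt_le_neg (a := a) (hf_pos s (hpos.trans_le hs.1))
      (fun t ht => hg (2 * m - 1) (by omega) t (ha0.trans_le ht)) (fun t ht => ?_)
      (fun t ht => hC t (ha0.trans_le ht))
    have h1 : f s ≤ f (u t) := hmin (hmem t ht)
    rw [← hode t (ha0.trans_le ht), hpar.neg_one_pow] at h1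
    rw [Nat.sub_add_cancel (by omega)]
    linarith
end
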